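/- For any infinite set X, the lattice Con P_X of congruences of the partition monoid P_X is distributive: for all congruences c, d, e on P_X, c ⊓ (d ⊔ e) = (c ⊓ d) ⊔ (c ⊓ e). (Theorem 6.1 for P_X.) -/

import Mathlib

open Cardinal
open scoped symmDiff

namespace PartitionCongruences

variable {X : Type*}

/-- A partition over `X` is a setoid on `X ⊕ X`; `PMon X` is the carrier of the
partition monoid. -/
abbrev PMon (X : Type*) := Setoid (X ⊕ X)

/-- The set of blocks of a partition. -/
def cl (α : PMon X) : Set (Set (X ⊕ X)) := α.classes

/-- A block of `α` is a transversal if it meets both summands. -/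
def IsTransversal (α : PMon X) (B : Set (X ⊕ X)) : Prop :=
  B ∈ α.classes ∧ (∃ x : X, Sum.inl x ∈ B) ∧ (∃ x : X, Sum.inr x ∈ B)

/-- The rank of a partition: the number of its transversals. -/
def rank (α : PMon X) : Cardinal :=
  #{B : Set (X ⊕ X) // IsTransversal α B}

/-- The kernel partition `ᾱ`. -/
def ker (α : PMon X) : Set (Set X) := (Setoid.comap Sum.inl α).classes

/-- The cokernel partition `α̲`. -/
def coker (α : PMon X) : Set (Set X) := (Setoid.comap Sum.inr α).classes

/-- Left summand to top copy, right summand to middle copy. -/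
def dmap (X : Type*) : X ⊕ X → X ⊕ (X ⊕ X) :=
  Sum.elim Sum.inl (fun x => Sum.inr (Sum.inl x))

/-- Left summand to middle copy, right summand to bottom copy. -/
def umap (X : Type*) : X ⊕ X → X ⊕ (X ⊕ X) :=
  Sum.elim (fun x => Sum.inr (Sum.inl x)) (fun x => Sum.inr (Sum.inr x))

/-- Left summand to top copy, right summand to bottom copy. -/
def emap (X : Type*) : X ⊕ X → X ⊕ (X ⊕ X) :=
  Sum.elim Sum.inl (fun x => Sum.inr (Sum.inr x))

/-- The pushforward of a setoid along a map: the smallest setoid relating `f x` and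
`f y` whenever `σ` relates `x` and `y`. -/
def push {A B : Type*} (f : A → B) (σ : Setoid A) : Setoid B :=
  Relation.EqvGen.setoid (fun a b => ∃ x y, σ x y ∧ f x = a ∧ f y = b)

/-- The product of the partition monoid. -/
instance : Mul (PMon X) :=
  ⟨fun α β => Setoid.comap (emap X) (push (dmap X) α ⊔ push (umap X) β)⟩

universe u

/-- The relation which is `α` on `S`, `τ` off `S`, and relates no point of `S` to a point
off `S`. -/
def rep {A : Type*} (S : Set A) (τ α : Setoid A) : Setoid A where
  r x y := (x ∈ S ∧ y ∈ S ∧ α x y) ∨ (x ∉ S ∧ y ∉ S ∧ τ x y)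
  iseqv := by
    refine ⟨fun x => ?_, fun {x y} h => ?_, fun {x y z} h h' => ?_⟩
    · by_cases hx : x ∈ S
      · exact Or.inl ⟨hx, hx, α.refl' x⟩
      · exact Or.inr ⟨hx, hx, τ.refl' x⟩
    · rcases h with ⟨a, b, h⟩ | ⟨a, b, h⟩
      · exact Or.inl ⟨b, a, α.symm' h⟩
      · exact Or.inr ⟨b, a, τ.symm' h⟩
    · rcases h with ⟨a, b, h⟩ | ⟨a, b, h⟩ <;> rcases h' with ⟨a', b', h'⟩ | ⟨a', b', h'⟩
      · exact Or.inl ⟨a, b', α.trans' h h'⟩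
      · exact absurd b a'
      · exact absurd a' b
      · exact Or.inr ⟨a, b', τ.trans' h h'⟩

theorem rep_rel {A : Type*} {S : Set A} {τ α : Setoid A} {x y : A} :
    rep S τ α x y ↔ (x ∈ S ∧ y ∈ S ∧ α x y) ∨ (x ∉ S ∧ y ∉ S ∧ τ x y) := Iff.rfl

/-- A setoid on a sum without transversals. -/
def Split {Y Z : Type*} (τ : Setoid (Y ⊕ Z)) : Prop := ∀ y z, ¬ τ (Sum.inl y) (Sum.inr z)

/-- The side-wise disjoint union of two setoids. -/
def SS {Y Z : Type*} (K : Setoid Y) (C : Setoid Z) : Setoid (Y ⊕ Z) where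
  r := Sum.LiftRel K C
  iseqv := by
    refine ⟨fun x => ?_, fun {x y} h => ?_, fun {x y z} h h' => ?_⟩
    · cases x
      · exact Sum.LiftRel.inl (K.refl' _)
      · exact Sum.LiftRel.inr (C.refl' _)
    · cases h with
      | inl h => exact Sum.LiftRel.inl (K.symm' h)
      | inr h => exact Sum.LiftRel.inr (C.symm' h)
    · cases h with
      | inl h => cases h' with
        | inl h' => exact Sum.LiftRel.inl (K.trans' h h')
      | inr h => cases h' with
        | inr h' => exact Sum.LiftRel.inr (C.trans' h h')

section
variable {Y Z : Type*} (K : Setoid Y) (C : Setoid Z)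

@[simp] theorem SS_inl_inl {a b : Y} : SS K C (Sum.inl a) (Sum.inl b) ↔ K a b :=
  Sum.liftRel_inl_inl

@[simp] theorem SS_inr_inr {a b : Z} : SS K C (Sum.inr a) (Sum.inr b) ↔ C a b :=
  Sum.liftRel_inr_inr

@[simp] theorem SS_inl_inr {a : Y} {b : Z} : ¬ SS K C (Sum.inl a) (Sum.inr b) :=
  Sum.not_liftRel_inl_inr

@[simp] theorem SS_inr_inl {a : Y} {b : Z} : ¬ SS K C (Sum.inr b) (Sum.inl a) :=
  Sum.not_liftRel_inr_inl

theorem split_SS : Split (SS K C) := fun _ _ => SS_inl_inr K C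

end

theorem Split.symm {Y Z : Type*} {τ : Setoid (Y ⊕ Z)} (h : Split τ) (y : Y) (z : Z) :
    ¬ τ (Sum.inr z) (Sum.inl y) := fun h' => h y z (τ.symm' h')

/-- The restriction of a setoid to pairs of points on the same side. -/
def hat {Y Z : Type*} (α : Setoid (Y ⊕ Z)) : Setoid (Y ⊕ Z) :=
  SS (α.comap Sum.inl) (α.comap Sum.inr)

theorem split_hat {Y Z : Type*} (α : Setoid (Y ⊕ Z)) : Split (hat α) := split_SS _ _

@[simp] theorem hat_inl_inl {Y Z : Type*} {α : Setoid (Y ⊕ Z)} {a b : Y} :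
    hat α (Sum.inl a) (Sum.inl b) ↔ α (Sum.inl a) (Sum.inl b) :=
  SS_inl_inl _ _

@[simp] theorem hat_inr_inr {Y Z : Type*} {α : Setoid (Y ⊕ Z)} {a b : Z} :
    hat α (Sum.inr a) (Sum.inr b) ↔ α (Sum.inr a) (Sum.inr b) :=
  SS_inr_inr _ _

@[simp] theorem hat_inl_inr {Y Z : Type*} {α : Setoid (Y ⊕ Z)} {a : Y} {b : Z} :
    ¬ hat α (Sum.inl a) (Sum.inr b) := SS_inl_inr _ _

@[simp] theorem hat_inr_inl {Y Z : Type*} {α : Setoid (Y ⊕ Z)} {a : Y} {b : Z} :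
    ¬ hat α (Sum.inr b) (Sum.inl a) := SS_inr_inl _ _

theorem Split.hat_eq {Y Z : Type*} {τ : Setoid (Y ⊕ Z)} (h : Split τ) : hat τ = τ := by
  ext x y
  rcases x with x | x <;> rcases y with y | y <;> simp [h _ _, h.symm]

theorem rel_left_of_rel {A : Type*} {α : Setoid A} {a a' b : A} (h : α a a') :
    α a b ↔ α a' b := ⟨α.trans' (α.symm' h), α.trans' h⟩

theorem rel_right_of_rel {A : Type*} {α : Setoid A} {a a' b : A} (h : α a a') :
    α b a ↔ α b a' := ⟨fun h' => α.trans' h' h, fun h' => α.trans' h' (α.symm' h)⟩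

theorem le_join {A : Type*} {α σ : Setoid A} {x y : A} (h : α x y) : (α ⊔ σ) x y :=
  (le_sup_left : α ≤ α ⊔ σ) h

theorem le_join' {A : Type*} {α σ : Setoid A} {x y : A} (h : σ x y) : (α ⊔ σ) x y :=
  (le_sup_right : σ ≤ α ⊔ σ) h

theorem mul_le {α β : PMon X} {T : Setoid (X ⊕ (X ⊕ X))} (h₁ : α ≤ T.comap (dmap X))
    (h₂ : β ≤ T.comap (umap X)) : α * β ≤ T.comap (emap X) := by
  intro x y h
  have : push (dmap X) α ⊔ push (umap X) β ≤ T := by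
    apply sup_le
    · apply Setoid.eqvGen_le
      rintro _ _ ⟨x, y, h, rfl, rfl⟩
      exact h₁ h
    · apply Setoid.eqvGen_le
      rintro _ _ ⟨x, y, h, rfl, rfl⟩
      exact h₂ h
  exact this h

theorem exists_mul_eq (α β : PMon X) : ∃ T : Setoid (X ⊕ (X ⊕ X)),
    α * β = T.comap (emap X) ∧ α ≤ T.comap (dmap X) ∧ β ≤ T.comap (umap X) := by
  refine ⟨_, rfl, ?_, ?_⟩
  · intro x y h
    exact le_join (Relation.EqvGen.rel _ _ ⟨x, y, h, rfl, rfl⟩)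
  · intro x y h
    exact le_join' (Relation.EqvGen.rel _ _ ⟨x, y, h, rfl, rfl⟩)

theorem le_mul_of {α β γ : PMon X} (h : ∀ T : Setoid (X ⊕ (X ⊕ X)), α ≤ T.comap (dmap X) →
    β ≤ T.comap (umap X) → γ ≤ T.comap (emap X)) : γ ≤ α * β := by
  obtain ⟨T, h₀, h₁, h₂⟩ := exists_mul_eq α β
  exact h₀ ▸ h T h₁ h₂

theorem mul_comap_swap_le (α β : PMon X) :
    α.comap Sum.swap * β.comap Sum.swap ≤ (β * α).comap Sum.swap := by
  obtain ⟨T, h₀, h₁, h₂⟩ := exists_mul_eq β α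
  let ρ : X ⊕ (X ⊕ X) → X ⊕ (X ⊕ X) :=
    Sum.elim (fun x => Sum.inr (Sum.inr x)) (Sum.elim (fun x => Sum.inr (Sum.inl x)) Sum.inl)
  have key := @mul_le X (α.comap Sum.swap) (β.comap Sum.swap) (T.comap ρ) ?_ ?_
  · rw [h₀]
    intro x y h
    have := key h
    rcases x with x | x <;> rcases y with y | y <;> exact this
  · intro x y h
    have := h₂ h
    rcases x with x | x <;> rcases y with y | y <;> exact this
  · intro x y h
    have := h₁ h
    rcases x with x | x <;> rcases y with y | y <;> exact this

theorem comap_swap_swap {Y Z : Type*} (α : Setoid (Y ⊕ Z)) :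
    (α.comap Sum.swap).comap Sum.swap = α := by
  ext x y
  simp [Setoid.comap_rel]

theorem mul_comap_swap (α β : PMon X) :
    α.comap Sum.swap * β.comap Sum.swap = (β * α).comap Sum.swap := by
  refine le_antisymm (mul_comap_swap_le α β) ?_
  have := mul_comap_swap_le (β.comap Sum.swap) (α.comap Sum.swap)
  rw [comap_swap_swap, comap_swap_swap] at this
  intro x y h
  have := this h
  simpa [Setoid.comap_rel] using this

theorem exists_mul_comap_left (h : X → X) : ∃ γ : PMon X, ∀ α : PMon X,
    γ * α = α.comap (Sum.map h id) := by
  refine ⟨Setoid.ker (Sum.elim h id), fun α => le_antisymm ?_ ?_⟩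
  · let m : X ⊕ (X ⊕ X) → X ⊕ X := Sum.elim (fun x => Sum.inl (h x)) id
    have key := @mul_le X (Setoid.ker (Sum.elim h id)) α (α.comap m) ?_ ?_
    · intro x y h
      have := key h
      rcases x with x | x <;> rcases y with y | y <;> exact this
    · intro x y hxy
      rw [Setoid.ker_def] at hxy
      rw [Setoid.comap_rel, Setoid.comap_rel]
      convert α.refl' _ using 1
      rcases x with x | x <;> rcases y with y | y <;> simp_all [m, dmap]
    · intro x y hxy
      rcases x with x | x <;> rcases y with y | y <;> exact hxy
  · refine le_mul_of fun T h₁ h₂ => ?_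
    have e : ∀ x, T (emap X x) (umap X (Sum.map h id x)) := by
      rintro (x | x)
      · exact h₁ (Setoid.ker_def.2 rfl : Setoid.ker (Sum.elim h id) (Sum.inl x) (Sum.inr (h x)))
      · exact T.refl' _
    intro x y hxy
    exact T.trans' (e x) (T.trans' (h₂ hxy) (T.symm' (e y)))

theorem exists_mul_join_left (K : Setoid X) : ∃ γ : PMon X, ∀ α : PMon X,
    γ * α = α ⊔ SS K ⊥ := by
  refine ⟨K.comap (Sum.elim id id), fun α => le_antisymm ?_ ?_⟩
  · let m : X ⊕ (X ⊕ X) → X ⊕ X := Sum.elim Sum.inl id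
    have key := @mul_le X (K.comap (Sum.elim id id)) α ((α ⊔ SS K ⊥).comap m) ?_ ?_
    · intro x y h
      have := key h
      rcases x with x | x <;> rcases y with y | y <;> exact this
    · intro x y hxy
      apply le_join'
      rcases x with x | x <;> rcases y with y | y <;> simpa [m, dmap, Setoid.comap_rel] using hxy
    · intro x y hxy
      apply le_join
      rcases x with x | x <;> rcases y with y | y <;> exact hxy
  · refine le_mul_of fun T h₁ h₂ => ?_
    have e : ∀ x, T (emap X x) (umap X x) := by
      rintro (x | x)
      · exact @h₁ (Sum.inl x) (Sum.inr x) (K.refl' x)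
      · exact T.refl' _
    apply sup_le
    · intro x y hxy
      exact T.trans' (e x) (T.trans' (h₂ hxy) (T.symm' (e y)))
    · intro x y hxy
      rcases x with x | x <;> rcases y with y | y <;> simp at hxy
      · exact @h₁ (Sum.inl x) (Sum.inl y) hxy
      · change x = y at hxy
        subst hxy
        exact T.refl' _

theorem exists_mul_rep_left (S : Set X) (K : Setoid X) : ∃ γ : PMon X, ∀ α : PMon X,
    γ * α = rep {x | ∀ y, x = Sum.inl y → y ∈ S} (SS K ⊥) α := by
  refine ⟨rep {x | Sum.elim id id x ∈ S} (SS K ⊥) (Setoid.ker (Sum.elim id id)),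
    fun α => le_antisymm ?_ ?_⟩
  · let m : X ⊕ (X ⊕ X) → X ⊕ X := Sum.elim Sum.inl id
    have key := @mul_le X (rep {x | Sum.elim id id x ∈ S} (SS K ⊥) (Setoid.ker (Sum.elim id id))) α
      (rep {x | ∀ y, x = Sum.inl y → y ∈ S} ((SS K ⊥).comap m) (α.comap m)) ?_ ?_
    · intro x y h
      have := key h
      rw [Setoid.comap_rel, rep_rel] at this
      rw [rep_rel]
      rcases x with x | x <;> rcases y with y | y <;>
        simpa [emap, m, Setoid.comap_rel] using this
    · intro x y hxy
      rw [rep_rel] at hxy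
      rw [Setoid.comap_rel, rep_rel]
      rcases x with x | x <;> rcases y with y | y <;>
        simp only [dmap, m, Setoid.comap_rel, Setoid.ker_def, Set.mem_ofPred_eq, Sum.elim_inl,
          Sum.elim_inr, id, SS_inl_inl, SS_inr_inr, SS_inl_inr, SS_inr_inl, Sum.inl.injEq,
          forall_eq', reduceCtorEq, false_implies, implies_true, true_and, not_true_eq_false,
          false_and, and_false, or_false] at hxy ⊢
      · rcases hxy with ⟨a, b, rfl⟩ | h
        · exact Or.inl ⟨a, a, α.refl' _⟩
        · exact Or.inr h
      · obtain ⟨a, b, rfl⟩ := hxy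
        exact ⟨a, α.refl' _⟩
      · obtain ⟨a, b, rfl⟩ := hxy
        exact ⟨a, α.refl' _⟩
      · rcases hxy with ⟨a, b, rfl⟩ | ⟨a, b, h⟩
        · exact α.refl' _
        · change x = y at h
          subst h
          exact α.refl' _
    · intro x y hxy
      rw [Setoid.comap_rel, rep_rel]
      left
      rcases x with x | x <;> rcases y with y | y <;> simpa [umap, m, Setoid.comap_rel] using hxy
  · refine le_mul_of fun T h₁ h₂ => ?_
    have e : ∀ x, x ∈ {x | ∀ y, x = Sum.inl y → y ∈ S} → T (emap X x) (umap X x) := by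
      rintro (x | x) hx
      · refine @h₁ (Sum.inl x) (Sum.inr x) (Or.inl ⟨hx x rfl, hx x rfl, rfl⟩)
      · exact T.refl' _
    intro x y hxy
    rw [rep_rel] at hxy
    rcases hxy with ⟨hx, hy, h⟩ | ⟨hx, hy, h⟩
    · exact T.trans' (e x hx) (T.trans' (h₂ h) (T.symm' (e y hy)))
    · rcases x with x | x
      · rcases y with y | y
        · refine @h₁ (Sum.inl x) (Sum.inl y) (Or.inr ⟨?_, ?_, h⟩)
          · simpa using hx
          · simpa using hy
        · simp at hy
      · simp at hx

theorem comap_sup_of_surjective {A B : Type*} {m : A → B} (hm : Function.Surjective m)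
    (α σ : Setoid B) : (α ⊔ σ).comap m = α.comap m ⊔ σ.comap m := by
  refine le_antisymm ?_ (sup_le ?_ ?_)
  · obtain ⟨s, hs⟩ := hm.hasRightInverse
    have key : α ⊔ σ ≤ (α.comap m ⊔ σ.comap m).comap s := by
      apply sup_le
      · intro a b h
        refine le_join ?_
        change α (m (s a)) (m (s b))
        rwa [hs, hs]
      · intro a b h
        refine le_join' ?_
        change σ (m (s a)) (m (s b))
        rwa [hs, hs]
    have e : ∀ x, (α.comap m ⊔ σ.comap m) x (s (m x)) := fun x => by
      refine le_join ?_
      change α (m x) (m (s (m x)))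
      rw [hs]
    intro x y h
    exact Setoid.trans' _ (e x) (Setoid.trans' _ (key h) (Setoid.symm' _ (e y)))
  · exact fun x y h => le_join h
  · exact fun x y h => le_join' h

theorem comap_map_id {Y Z : Type*} (α : Setoid (Y ⊕ Z)) : α.comap (Sum.map id id) = α := by
  rw [Sum.map_id_id]
  rfl

/-- The congruence obtained by exchanging the roles of the two summands. -/
def conFlip (f : Con (PMon X)) : Con (PMon X) where
  r α β := f (α.comap Sum.swap) (β.comap Sum.swap)
  iseqv := ⟨fun _ => f.refl _, fun h => f.symm h, fun h h' => f.trans h h'⟩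
  mul' := by
    intro w x y z h h'
    rw [← mul_comap_swap, ← mul_comap_swap]
    exact f.mul h' h

theorem conFlip_iff {f : Con (PMon X)} {α β : PMon X} :
    conFlip f α β ↔ f (α.comap Sum.swap) (β.comap Sum.swap) := Iff.rfl

section Con

variable {f : Con (PMon X)} {α β : PMon X}

theorem con_comap_left (H : f α β) (h : X → X) :
    f (α.comap (Sum.map h id)) (β.comap (Sum.map h id)) := by
  obtain ⟨γ, hγ⟩ := exists_mul_comap_left h
  rw [← hγ, ← hγ]
  exact f.mul (f.refl γ) H

theorem con_join_left (H : f α β) (K : Setoid X) : f (α ⊔ SS K ⊥) (β ⊔ SS K ⊥) := by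
  obtain ⟨γ, hγ⟩ := exists_mul_join_left K
  rw [← hγ, ← hγ]
  exact f.mul (f.refl γ) H

theorem con_rep_left (H : f α β) (S : Set X) (K : Setoid X) :
    f (rep {x | ∀ y, x = Sum.inl y → y ∈ S} (SS K ⊥) α)
      (rep {x | ∀ y, x = Sum.inl y → y ∈ S} (SS K ⊥) β) := by
  obtain ⟨γ, hγ⟩ := exists_mul_rep_left S K
  rw [← hγ, ← hγ]
  exact f.mul (f.refl γ) H

theorem conFlip_swap (H : f α β) : conFlip f (α.comap Sum.swap) (β.comap Sum.swap) := by
  rw [conFlip_iff, comap_swap_swap, comap_swap_swap]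
  exact H

theorem con_comap (H : f α β) (h k : X → X) :
    f (α.comap (Sum.map h k)) (β.comap (Sum.map h k)) := by
  have e : ∀ γ : PMon X, (((γ.comap (Sum.map h id)).comap Sum.swap).comap
      (Sum.map k id)).comap Sum.swap = γ.comap (Sum.map h k) := by
    intro γ
    ext x y
    rcases x with x | x <;> rcases y with y | y <;> rfl
  have := con_comap_left (conFlip_swap (con_comap_left H h)) k
  rw [conFlip_iff, e, e] at this
  exact this

theorem con_join (H : f α β) {σ : PMon X} (hσ : Split σ) : f (α ⊔ σ) (β ⊔ σ) := by
  have e : ∀ γ : PMon X, ((γ ⊔ SS (σ.comap Sum.inl) ⊥).comap Sum.swap ⊔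
      SS (σ.comap Sum.inr) ⊥).comap Sum.swap = γ ⊔ σ := by
    intro γ
    have hs : Function.Surjective (Sum.swap : X ⊕ X → X ⊕ X) := Sum.swap_rightInverse.surjective
    rw [comap_sup_of_surjective hs, comap_swap_swap]
    refine le_antisymm (sup_le (sup_le (fun x y h => le_join h) ?_) ?_) (sup_le ?_ ?_)
    · intro x y h
      rcases x with x | x <;> rcases y with y | y <;> simp at h
      · exact le_join' h
      · change x = y at h
        subst h
        exact Setoid.refl' _ _
    · intro x y h
      rw [Setoid.comap_rel] at h
      rcases x with x | x <;> rcases y with y | y <;> simp at h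
      · change x = y at h
        subst h
        exact Setoid.refl' _ _
      · exact le_join' h
    · exact fun x y h => le_join (le_join h)
    · intro x y h
      rcases x with x | x <;> rcases y with y | y
      · exact le_join (le_join' ((SS_inl_inl _ _).2 h))
      · exact absurd h (hσ _ _)
      · exact absurd h (hσ.symm _ _)
      · exact le_join' ((SS_inl_inl _ _).2 h)
  have := con_join_left (conFlip_swap (con_join_left H (σ.comap Sum.inl))) (σ.comap Sum.inr)
  rw [conFlip_iff, e, e] at this
  exact this

theorem con_rep (H : f α β) (S : Set (X ⊕ X)) {τ : PMon X} (hτ : Split τ) :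
    f (rep S τ α) (rep S τ β) := by
  have e : ∀ γ : PMon X, (rep {x | ∀ y, x = Sum.inl y → y ∈ Sum.inr ⁻¹' S}
      (SS (τ.comap Sum.inr) ⊥) ((rep {x | ∀ y, x = Sum.inl y → y ∈ Sum.inl ⁻¹' S}
      (SS (τ.comap Sum.inl) ⊥) γ).comap Sum.swap)).comap Sum.swap = rep S τ γ := by
    intro γ
    ext x y
    have := hτ.symm
    rcases x with x | x <;> rcases y with y | y <;>
      simp [rep_rel, Setoid.comap_rel, hτ _ _, hτ.symm _ _]
    all_goals tauto
  have := con_rep_left (conFlip_swap (con_rep_left H (Sum.inl ⁻¹' S) (τ.comap Sum.inl)))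
    (Sum.inr ⁻¹' S) (τ.comap Sum.inr)
  rw [conFlip_iff, e, e] at this
  exact this

end Con

/-- A family of equivalence relations on the bipartite setoids, closed under the operations
induced by multiplication in the partition monoid. -/
structure Fam (X : Type u) where
  /-- The underlying relations. -/
  R : ∀ {Y Z : Type u}, Setoid (Y ⊕ Z) → Setoid (Y ⊕ Z) → Prop
  refl : ∀ {Y Z : Type u} (α : Setoid (Y ⊕ Z)), R α α
  symm : ∀ {Y Z : Type u} {α β : Setoid (Y ⊕ Z)}, R α β → R β α
  trans : ∀ {Y Z : Type u} {α β γ : Setoid (Y ⊕ Z)}, R α β → R β γ → R α γ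
  comap : ∀ {Y Z Y' Z' : Type u} {α β : Setoid (Y ⊕ Z)}, R α β → ∀ (h : Y' → Y) (k : Z' → Z),
    R (α.comap (Sum.map h k)) (β.comap (Sum.map h k))
  rep : ∀ {Y Z : Type u} {α β : Setoid (Y ⊕ Z)}, R α β → ∀ (S : Set (Y ⊕ Z))
    {τ : Setoid (Y ⊕ Z)}, Split τ → R (rep S τ α) (rep S τ β)
  join : ∀ {Y Z : Type u}, #Y ≤ #X → #Z ≤ #X → ∀ {α β : Setoid (Y ⊕ Z)}, R α β →
    ∀ {σ : Setoid (Y ⊕ Z)}, Split σ → R (α ⊔ σ) (β ⊔ σ)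

theorem exists_surjective_of_card_le {X Y : Type u} [Nonempty Y] (h : #Y ≤ #X) :
    ∃ r : X → Y, Function.Surjective r := by
  obtain ⟨g⟩ := h
  exact ⟨Function.invFun g, Function.invFun_surjective g.injective⟩

/-- The family generated by a congruence. -/
def Fam.ofCon {X : Type u} (f : Con (PMon X)) : Fam X where
  R α β := ∀ h k, f (α.comap (Sum.map h k)) (β.comap (Sum.map h k))
  refl _ _ _ := f.refl _
  symm H h k := f.symm (H h k)
  trans H H' h k := f.trans (H h k) (H' h k)
  comap := by
    intro Y Z Y' Z' α β H h k h' k'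
    have e : ∀ γ : Setoid (Y ⊕ Z), (γ.comap (Sum.map h k)).comap (Sum.map h' k') =
        γ.comap (Sum.map (h ∘ h') (k ∘ k')) := by
      intro γ
      ext x y
      rcases x with x | x <;> rcases y with y | y <;> rfl
    rw [e, e]
    exact H _ _
  rep := by
    intro Y Z α β H S τ hτ h k
    have := con_rep (H h k) (Sum.map h k ⁻¹' S) (τ := τ.comap (Sum.map h k)) (fun y z => hτ _ _)
    exact this
  join := by
    intro Y Z hY hZ α β H σ hσ h k
    rcases isEmpty_or_nonempty X with hX | hX
    · have : ∀ a b : PMon X, f a b := fun a b => by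
        rw [Setoid.ext (s := b) (t := a) fun x => isEmptyElim x]
        exact f.refl a
      exact this _ _
    have hY' : Nonempty Y := hX.map h
    have hZ' : Nonempty Z := hX.map k
    obtain ⟨r, hr⟩ := exists_surjective_of_card_le hY
    obtain ⟨t, ht⟩ := exists_surjective_of_card_le hZ
    have H' := con_join (H r t) (σ := σ.comap (Sum.map r t)) (fun y z => hσ _ _)
    rw [← comap_sup_of_surjective (Sum.map_surjective.2 ⟨hr, ht⟩),
      ← comap_sup_of_surjective (Sum.map_surjective.2 ⟨hr, ht⟩)] at H'
    obtain ⟨r', hr'⟩ := hr.hasRightInverse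
    obtain ⟨t', ht'⟩ := ht.hasRightInverse
    have H'' := con_comap H' (r' ∘ h) (t' ∘ k)
    have e : ∀ γ : Setoid (Y ⊕ Z), (γ.comap (Sum.map r t)).comap (Sum.map (r' ∘ h) (t' ∘ k)) =
        γ.comap (Sum.map h k) := by
      intro γ
      ext x y
      rcases x with x | x <;> rcases y with y | y <;>
        simp [Setoid.comap_rel, hr' _, ht' _]
    rwa [e, e] at H''

theorem Fam.ofCon_iff {X : Type u} {f : Con (PMon X)} {α β : PMon X} :
    (Fam.ofCon f).R α β ↔ f α β := by
  refine ⟨fun h => ?_, fun h k k' => con_comap h k k'⟩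
  have := h id id
  rwa [comap_map_id, comap_map_id] at this

/-- The family with the two sides exchanged. -/
def Fam.flip {X : Type u} (F : Fam X) : Fam X where
  R α β := F.R (α.comap Sum.swap) (β.comap Sum.swap)
  refl _ := F.refl _
  symm H := F.symm H
  trans H H' := F.trans H H'
  comap := by
    intro Y Z Y' Z' α β H h k
    have e : ∀ γ : Setoid (Y ⊕ Z), (γ.comap Sum.swap).comap (Sum.map k h) =
        (γ.comap (Sum.map h k)).comap Sum.swap := by
      intro γ
      ext x y
      rcases x with x | x <;> rcases y with y | y <;> rfl
    have := F.comap H k h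
    rwa [e, e] at this
  rep := by
    intro Y Z α β H S τ hτ
    exact F.rep H (Sum.swap ⁻¹' S) (τ := τ.comap Sum.swap) (fun y z => hτ.symm _ _)
  join := by
    intro Y Z hY hZ α β H σ hσ
    have hs : Function.Surjective (Sum.swap : Z ⊕ Y → Y ⊕ Z) := Sum.swap_rightInverse.surjective
    have := F.join hZ hY H (σ := σ.comap Sum.swap) (fun y z => hσ.symm _ _)
    rwa [← comap_sup_of_surjective hs, ← comap_sup_of_surjective hs] at this

theorem Fam.flip_iff {X : Type u} {F : Fam X} {Y Z : Type u} {α β : Setoid (Y ⊕ Z)} :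
    F.flip.R α β ↔ F.R (α.comap Sum.swap) (β.comap Sum.swap) := Iff.rfl

theorem Fam.flip_swap {X : Type u} {F : Fam X} {Y Z : Type u} {α β : Setoid (Y ⊕ Z)} :
    F.flip.R (α.comap Sum.swap) (β.comap Sum.swap) ↔ F.R α β := by
  rw [flip_iff, comap_swap_swap, comap_swap_swap]

/-- The identity partition. -/
def idS (P : Type*) : Setoid (P ⊕ P) := Setoid.ker (Sum.elim id id)

section
variable {P : Type*} {a b : P}

theorem idS_rel {x y : P ⊕ P} : idS P x y ↔ Sum.elim id id x = Sum.elim id id y := Iff.rfl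

@[simp] theorem idS_inl_inl : idS P (Sum.inl a) (Sum.inl b) ↔ a = b := Iff.rfl
@[simp] theorem idS_inl_inr : idS P (Sum.inl a) (Sum.inr b) ↔ a = b := Iff.rfl
@[simp] theorem idS_inr_inl : idS P (Sum.inr a) (Sum.inl b) ↔ a = b := Iff.rfl
@[simp] theorem idS_inr_inr : idS P (Sum.inr a) (Sum.inr b) ↔ a = b := Iff.rfl

theorem bot_rel {A : Type*} {x y : A} : (⊥ : Setoid A) x y ↔ x = y := Iff.rfl

theorem split_bot {Y Z : Type*} : Split (⊥ : Setoid (Y ⊕ Z)) := fun _ _ h => by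
  rw [bot_rel] at h
  simp at h

end

/-- The block of a point. -/
def blk {A : Type*} (α : Setoid A) (x : A) : Set A := {y | α x y}

theorem mem_blk {A : Type*} {α : Setoid A} {x y : A} : y ∈ blk α x ↔ α x y := Iff.rfl

theorem blk_eq_iff {A : Type*} {α : Setoid A} {x y : A} : blk α x = blk α y ↔ α x y := by
  constructor
  · intro h
    rw [← mem_blk, h, mem_blk]
  · intro h
    ext z
    rw [mem_blk, mem_blk, rel_left_of_rel h]

/-- The set of transversal blocks. -/
def TR {Y Z : Type*} (α : Setoid (Y ⊕ Z)) : Set (Set (Y ⊕ Z)) :=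
  {B | ∃ y z, α (Sum.inl y) (Sum.inr z) ∧ B = blk α (Sum.inl y)}

theorem blk_inl_mem_TR {Y Z : Type*} {α : Setoid (Y ⊕ Z)} {y : Y} :
    blk α (Sum.inl y) ∈ TR α ↔ ∃ z, α (Sum.inl y) (Sum.inr z) := by
  constructor
  · rintro ⟨y', z, h, e⟩
    exact ⟨z, α.trans' (blk_eq_iff.1 e) h⟩
  · rintro ⟨z, h⟩
    exact ⟨y, z, h, rfl⟩

theorem blk_inr_mem_TR {Y Z : Type*} {α : Setoid (Y ⊕ Z)} {z : Z} :
    blk α (Sum.inr z) ∈ TR α ↔ ∃ y, α (Sum.inl y) (Sum.inr z) := by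
  constructor
  · rintro ⟨y', z', h, e⟩
    exact ⟨y', α.symm' (blk_eq_iff.1 e)⟩
  · rintro ⟨y, h⟩
    exact ⟨y, z, h, blk_eq_iff.2 (α.symm' h)⟩

theorem Split.TR_eq {Y Z : Type*} {α : Setoid (Y ⊕ Z)} (h : Split α) : TR α = ∅ := by
  ext B
  simp only [Set.mem_empty_iff_false, iff_false]
  rintro ⟨y, z, h', -⟩
  exact h y z h'

theorem split_of_TR_eq {Y Z : Type*} {α : Setoid (Y ⊕ Z)} (h : TR α = ∅) : Split α := by
  intro y z h'
  have : blk α (Sum.inl y) ∈ TR α := ⟨y, z, h', rfl⟩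
  rw [h] at this
  exact this

/-- The classification map underlying `DS`. -/
def ds (Q P P' : Type*) : (Q ⊕ P) ⊕ (Q ⊕ P') → Q ⊕ (P ⊕ P') :=
  Sum.elim (Sum.map id Sum.inl) (Sum.map id Sum.inr)

theorem ds_surjective (Q P P' : Type*) : Function.Surjective (ds Q P P') := by
  rintro (q | p | p)
  · exact ⟨Sum.inl (Sum.inl q), rfl⟩
  · exact ⟨Sum.inl (Sum.inr p), rfl⟩
  · exact ⟨Sum.inr (Sum.inr p), rfl⟩

/-- The direct sum of the identity on `Q` and `β`. -/
def DS (Q : Type*) {P P' : Type*} (β : Setoid (P ⊕ P')) : Setoid ((Q ⊕ P) ⊕ (Q ⊕ P')) :=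
  (SS ⊥ β).comap (ds Q P P')

theorem DS_rel {Q P P' : Type*} {β : Setoid (P ⊕ P')} {x y : (Q ⊕ P) ⊕ (Q ⊕ P')} :
    DS Q β x y ↔ SS ⊥ β (ds Q P P' x) (ds Q P P' y) := Iff.rfl

theorem DS_idS {Q P : Type*} : DS Q (idS P) = idS (Q ⊕ P) := by
  ext x y
  rw [DS_rel, idS_rel]
  rcases x with (x | x) | (x | x) <;> rcases y with (y | y) | (y | y) <;> simp [ds]

theorem DS_comap {Q P P' R R' : Type*} {β : Setoid (P ⊕ P')} (h : R → P) (k : R' → P') :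
    DS Q (β.comap (Sum.map h k)) =
      (DS Q β).comap (Sum.map (Sum.map id h) (Sum.map id k)) := by
  ext x y
  change SS ⊥ _ _ _ ↔ SS ⊥ β (ds Q P P' _) (ds Q P P' _)
  rcases x with (x | x) | (x | x) <;> rcases y with (y | y) | (y | y) <;>
    simp [ds, Setoid.comap_rel]

theorem DS_rep {Q P P' : Type*} {β τ : Setoid (P ⊕ P')} (hτ : Split τ) (S : Set (P ⊕ P')) :
    DS Q (rep S τ β) =
      rep (ds Q P P' ⁻¹' {x | ∀ p, x = Sum.inr p → p ∈ S}) (hat (DS Q τ)) (DS Q β) := by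
  ext x y
  rw [DS_rel, rep_rel, DS_rel]
  have := hτ.symm
  rcases x with (x | x) | (x | x) <;> rcases y with (y | y) | (y | y) <;>
    simp [ds, rep_rel, DS_rel, hτ _ _, hτ.symm _ _]

theorem DS_join {Q P P' : Type*} {β σ : Setoid (P ⊕ P')} (hσ : Split σ) :
    DS Q (β ⊔ σ) = DS Q β ⊔ hat (DS Q σ) := by
  have e : SS (⊥ : Setoid Q) (β ⊔ σ) = SS ⊥ β ⊔ SS ⊥ σ := by
    refine le_antisymm ?_ (sup_le ?_ ?_)
    · have key : β ⊔ σ ≤ (SS (⊥ : Setoid Q) β ⊔ SS ⊥ σ).comap Sum.inr :=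
        sup_le (fun x y h => le_join ((SS_inr_inr _ _).2 h))
          (fun x y h => le_join' ((SS_inr_inr _ _).2 h))
      intro x y h
      rcases x with x | x <;> rcases y with y | y <;> simp at h
      · subst h
        exact Setoid.refl' _ _
      · exact key h
    · intro x y h
      rcases x with x | x <;> rcases y with y | y <;> simp at h ⊢
      · exact h
      · exact le_join h
    · intro x y h
      rcases x with x | x <;> rcases y with y | y <;> simp at h ⊢
      · exact h
      · exact le_join' h
  rw [DS, e, comap_sup_of_surjective (ds_surjective Q P P')]
  refine le_antisymm (sup_le (fun x y h => le_join h) ?_) (sup_le (fun x y h => le_join h) ?_)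
  · have hd : ∀ q : Q, (DS Q β ⊔ hat (DS Q σ)) (Sum.inl (Sum.inl q)) (Sum.inr (Sum.inl q)) :=
      fun q => le_join ((SS_inl_inl _ _).2 rfl)
    intro x y h
    rcases x with x | x <;> rcases y with y | y
    · exact le_join' (hat_inl_inl.2 h)
    · rcases x with x | x <;> rcases y with y | y <;>
        simp [Setoid.comap_rel, ds] at h
      · subst h
        exact hd x
      · exact absurd h (hσ _ _)
    · rcases x with x | x <;> rcases y with y | y <;>
        simp [Setoid.comap_rel, ds] at h
      · subst h
        exact Setoid.symm' _ (hd x)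
      · exact absurd h (hσ.symm _ _)
    · exact le_join' (hat_inr_inr.2 h)
  · intro x y h
    rcases x with x | x <;> rcases y with y | y <;> simp at h
    · exact le_join' h
    · exact le_join' h

theorem card_sum_le {X : Type u} [Infinite X] {A B : Type u} (hA : #A ≤ #X) (hB : #B ≤ #X) :
    #(A ⊕ B) ≤ #X := by
  rw [← add_def]
  exact add_le_of_le (aleph0_le_mk X) hA hB

/-- The relations induced by `F` on the second summand of a direct sum with an identity. -/
def Fam.under {X : Type u} [Infinite X] (F : Fam X) (Q : Type u) (hQ : #Q ≤ #X) : Fam X where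
  R α β := F.R (DS Q α) (DS Q β)
  refl _ := F.refl _
  symm H := F.symm H
  trans H H' := F.trans H H'
  comap H h k := by
    rw [DS_comap, DS_comap]
    exact F.comap H _ _
  rep H S τ hτ := by
    rw [DS_rep hτ, DS_rep hτ]
    exact F.rep H _ (split_hat _)
  join hY hZ α β H σ hσ := by
    rw [DS_join hσ, DS_join hσ]
    exact F.join (card_sum_le hQ hY) (card_sum_le hQ hZ) H (split_hat _)

theorem Fam.under_iff {X : Type u} [Infinite X] {F : Fam X} {Q : Type u} {hQ : #Q ≤ #X}
    {Y Z : Type u} {α β : Setoid (Y ⊕ Z)} :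
    (F.under Q hQ).R α β ↔ F.R (DS Q α) (DS Q β) := Iff.rfl

/-- `F` relates the identity of `P` to the trivial partition. -/
def KK {X : Type u} (F : Fam X) (P : Type u) : Prop := F.R (idS P) ⊥

section Basic

variable {X : Type u} {F : Fam X} {Y Z P Q T : Type u}

theorem comap_idS_of_injective {i : P → Q} (hi : Function.Injective i) :
    (idS Q).comap (Sum.map i i) = idS P := by
  ext x y
  rw [Setoid.comap_rel]
  rcases x with x | x <;> rcases y with y | y <;> simp [hi.eq_iff]

theorem comap_bot_of_injective {Y' Z' : Type u} {h : Y' → Y} {k : Z' → Z}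
    (hh : Function.Injective h) (hk : Function.Injective k) :
    (⊥ : Setoid (Y ⊕ Z)).comap (Sum.map h k) = ⊥ := by
  ext x y
  rw [Setoid.comap_rel, bot_rel, bot_rel, (hh.sumMap hk).eq_iff]

theorem KK.transfer (H : KK F P) (h : #T ≤ #P) : KK F T := by
  obtain ⟨i, hi⟩ := h
  have := F.comap H i i
  rwa [comap_idS_of_injective hi, comap_bot_of_injective hi hi] at this

theorem KK.of_isEmpty [IsEmpty P] : KK F P := by
  have : idS P = ⊥ := Setoid.ext fun x => isEmptyElim x
  rw [KK, this]
  exact F.refl _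

theorem KK.hat {γ : Setoid (Y ⊕ Z)} (H : KK F T) (h : #(TR γ) ≤ #T) : F.R γ (hat γ) := by
  classical
  rcases isEmpty_or_nonempty T with hT | ⟨⟨t₀⟩⟩
  · rw [mk_eq_zero T, nonpos_iff_eq_zero, mk_eq_zero_iff, Set.isEmpty_coe_sort] at h
    rw [(split_of_TR_eq h).hat_eq]
    exact F.refl _
  obtain ⟨j, hj⟩ := h
  let idx : Y ⊕ Z → T := fun w => if hw : blk γ w ∈ TR γ then j ⟨_, hw⟩ else t₀
  have hidx : ∀ {x y}, blk γ x ∈ TR γ → blk γ y ∈ TR γ → (idx x = idx y ↔ γ x y) := by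
    intro x y hx hy
    simp only [idx, dif_pos hx, dif_pos hy, hj.eq_iff, Subtype.mk.injEq, blk_eq_iff]
  have key := F.rep (F.comap H (idx ∘ Sum.inl) (idx ∘ Sum.inr)) {w | blk γ w ∈ TR γ}
    (split_hat γ)
  have hsame : ∀ {x y}, γ x y → (blk γ x ∈ TR γ ↔ blk γ y ∈ TR γ) := fun h => by
    rw [blk_eq_iff.2 h]
  convert key using 1
  · ext x y
    rw [rep_rel]
    have h1 : Setoid.comap (Sum.map (idx ∘ Sum.inl) (idx ∘ Sum.inr)) (idS T) x y ↔
        idx x = idx y := by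
      rcases x with x | x <;> rcases y with y | y <;> rfl
    rw [h1]
    simp only [Set.mem_ofPred_eq]
    by_cases hx : blk γ x ∈ TR γ
    · by_cases hy : blk γ y ∈ TR γ
      · simp [hx, hy, hidx hx hy]
      · simp [hx, hy]
        exact fun h => hy ((hsame h).1 hx)
    · by_cases hy : blk γ y ∈ TR γ
      · simp [hx, hy]
        exact fun h => hx ((hsame h).2 hy)
      · simp only [hx, hy, false_and, not_false_eq_true, true_and, false_or]
        rcases x with x | x <;> rcases y with y | y
        · simp
        · simp only [hat_inl_inr, iff_false]
          exact fun h => hx (blk_inl_mem_TR.2 ⟨_, h⟩)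
        · simp only [hat_inr_inl, iff_false]
          exact fun h => hy (blk_inl_mem_TR.2 ⟨_, γ.symm' h⟩)
        · simp
  · ext x y
    rw [rep_rel]
    simp only [Set.mem_ofPred_eq]
    rcases x with x | x <;> rcases y with y | y
    · by_cases hx : blk γ (Sum.inl x) ∈ TR γ
      · by_cases hy : blk γ (Sum.inl y) ∈ TR γ
        · simp [hx, hy, hidx hx hy]
        · simp [hx, hy]
          exact fun h => hy ((hsame h).1 hx)
      · by_cases hy : blk γ (Sum.inl y) ∈ TR γ
        · simp [hx, hy]
          exact fun h => hx ((hsame h).2 hy)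
        · simp [hx, hy]
    · simp
    · simp
    · by_cases hx : blk γ (Sum.inr x) ∈ TR γ
      · by_cases hy : blk γ (Sum.inr y) ∈ TR γ
        · simp [hx, hy, hidx hx hy]
        · simp [hx, hy]
          exact fun h => hy ((hsame h).1 hx)
      · by_cases hy : blk γ (Sum.inr y) ∈ TR γ
        · simp [hx, hy]
          exact fun h => hx ((hsame h).2 hy)
        · simp [hx, hy]

theorem KK.of_split {θ : Setoid (P ⊕ P)} (H : F.R (idS P) θ) (hθ : Split θ) : KK F P := by
  have h1 := F.rep H {x | x.isLeft} hθ
  have h2 := F.rep H {x | x.isRight} (split_bot)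
  have e1 : rep {x | x.isLeft} θ θ = θ := by
    ext x y
    rw [rep_rel]
    rcases x with x | x <;> rcases y with y | y <;> simp [hθ _ _, hθ.symm _ _]
  have e2 : rep {x | x.isLeft} θ (idS P) = rep {x | x.isRight} ⊥ θ := by
    ext x y
    rw [rep_rel, rep_rel]
    rcases x with x | x <;> rcases y with y | y <;> simp
  have e3 : rep {x | x.isRight} ⊥ (idS P) = ⊥ := by
    ext x y
    rw [rep_rel]
    rcases x with x | x <;> rcases y with y | y <;> simp
  rw [e1, e2] at h1
  rw [e3] at h2
  exact F.trans H (F.trans (F.symm h1) (F.symm h2))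

theorem KK_of_hat {β : Setoid (P ⊕ P)} (H : F.R (idS P) β) (H' : KK F T) (h : #(TR β) ≤ #T) :
    KK F P := KK.of_split (F.trans H (H'.hat h)) (split_hat _)

theorem comap_const_of_rel {γ : Setoid (Y ⊕ Z)} {y : Y} {z : Z}
    (h : γ (Sum.inl y) (Sum.inr z)) :
    γ.comap (Sum.map (fun _ : PUnit.{u + 1} => y) (fun _ : PUnit.{u + 1} => z)) = idS PUnit := by
  ext a b
  rcases a with a | a <;> rcases b with b | b <;> simp [Setoid.comap_rel, h, γ.symm' h]

theorem comap_const_of_not_rel {γ : Setoid (Y ⊕ Z)} {y : Y} {z : Z}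
    (h : ¬ γ (Sum.inl y) (Sum.inr z)) :
    γ.comap (Sum.map (fun _ : PUnit.{u + 1} => y) (fun _ : PUnit.{u + 1} => z)) = ⊥ := by
  ext a b
  have : ¬ γ (Sum.inr z) (Sum.inl y) := fun h' => h (γ.symm' h')
  rcases a with a | a <;> rcases b with b | b <;> simp [Setoid.comap_rel, h, this]

theorem KK_punit_of_rel {β γ : Setoid (Y ⊕ Z)} (H : F.R β γ) {y : Y} {z : Z}
    (h : β (Sum.inl y) (Sum.inr z)) (h' : ¬ γ (Sum.inl y) (Sum.inr z)) : KK F PUnit := by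
  have := F.comap H (fun _ : PUnit => y) (fun _ : PUnit => z)
  rwa [comap_const_of_rel h, comap_const_of_not_rel h'] at this

theorem KK_punit_of_ne {β : Setoid (P ⊕ P)} (H : F.R (idS P) β) {i j : P}
    (h : ¬ (i = j ↔ β (Sum.inl i) (Sum.inr j))) : KK F PUnit := by
  by_cases hij : i = j
  · exact KK_punit_of_rel H (idS_inl_inr.2 hij) (fun h' => h ⟨fun _ => h', fun _ => hij⟩)
  · exact KK_punit_of_rel (F.symm H)
      (by_contra fun h' => h ⟨fun h => absurd h hij, fun h => absurd h h'⟩)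
      (fun h' => hij (idS_inl_inr.1 h'))

theorem KK.of_merge (H : F.R (idS P) ⊤) {p r : P} (h : p ≠ r) : KK F P := by
  have h1 : KK F PUnit := KK_punit_of_ne H (i := p) (j := r) (by simp [h])
  refine KK_of_hat H h1 ?_
  rw [mk_punit, mk_le_one_iff_set_subsingleton]
  rintro _ ⟨y, z, -, rfl⟩ _ ⟨y', z', -, rfl⟩
  exact blk_eq_iff.2 trivial

end Basic

section RankDrop

variable {X : Type u} {F : Fam X} {Y Z P Q T : Type u}

/-- A family of points meeting all transversals bounds the rank. -/
theorem card_TR_le {α : Setoid (Y ⊕ Z)} (i : T → Y ⊕ Z)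
    (h : ∀ B ∈ TR α, ∃ t, B = blk α (i t)) : #(TR α) ≤ #T := by
  choose g hg using fun B : TR α => h B.1 B.2
  refine ⟨⟨g, fun B B' e => Subtype.ext ?_⟩⟩
  rw [hg B, hg B', e]

theorem le_card_TR {α : Setoid (Y ⊕ Z)} (i : T → Y ⊕ Z) (h : ∀ t, blk α (i t) ∈ TR α)
    (hi : ∀ t t', α (i t) (i t') → t = t') : #T ≤ #(TR α) :=
  ⟨⟨fun t => ⟨blk α (i t), h t⟩, fun t t' e => hi t t' (blk_eq_iff.1 (Subtype.ext_iff.1 e))⟩⟩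

theorem KK_punit_of_card_lt {β : Setoid (Q ⊕ Q)} (H : F.R (idS Q) β) (h : #(TR β) < #Q) :
    KK F PUnit := by
  by_contra hK
  have key : ∀ i j : Q, i = j ↔ β (Sum.inl i) (Sum.inr j) := fun i j =>
    by_contra fun h' => hK (KK_punit_of_ne H h')
  refine absurd (le_card_TR (α := β) Sum.inl (fun t => ?_) fun t t' h' => ?_) h.not_ge
  · exact blk_inl_mem_TR.2 ⟨t, (key t t).1 rfl⟩
  · exact (key t t').2 (β.trans' h' ((key t' t').1 rfl))

/-- Some upper point is outside all transversals, or two upper points are related. -/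
def Bad {Y Z : Type*} (β : Setoid (Y ⊕ Z)) (x y : Y) : Prop :=
  (x = y ∧ ∀ z, ¬ β (Sum.inl x) (Sum.inr z)) ∨ (x ≠ y ∧ β (Sum.inl x) (Sum.inl y))

theorem Bad.card_TR_le {β : Setoid (Y ⊕ Z)} {x y : Y} (h : Bad β x y) :
    #(TR β) ≤ #{w : Y // w ≠ x} := by
  refine PartitionCongruences.card_TR_le (fun w => Sum.inl w.1) ?_
  rintro _ ⟨w, z, hz, rfl⟩
  by_cases hw : w = x
  · subst hw
    rcases h with ⟨rfl, h⟩ | ⟨h, h'⟩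
    · exact absurd hz (h z)
    · exact ⟨⟨y, h.symm⟩, blk_eq_iff.2 h'⟩
  · exact ⟨⟨w, hw⟩, rfl⟩

theorem exists_bad {β : Setoid (Y ⊕ Z)} (h : #(TR β) < #Y) : ∃ x y, Bad β x y := by
  by_contra! hb
  refine absurd (le_card_TR (α := β) (Sum.inl : Y → Y ⊕ Z) (fun t => ?_) fun t t' h' => ?_) h.not_ge
  · rw [blk_inl_mem_TR]
    by_contra! h
    exact hb t t (Or.inl ⟨rfl, h⟩)
  · by_contra h
    exact hb t t' (Or.inr ⟨h, h'⟩)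

theorem card_ne_eq_of_finite {Q : Type u} [Finite Q] (x z : Q) :
    #{w : Q // w ≠ x} = #{w : Q // w ≠ z} := by
  classical
  have := Fintype.ofFinite Q
  rw [mk_fintype, mk_fintype, Fintype.card_subtype_compl, Fintype.card_subtype_compl]
  simp

theorem KK_of_bad : ∀ (n : ℕ) {Q : Type u} [Finite Q], Nat.card Q = n → ∀ {β : Setoid (Q ⊕ Q)},
    F.R (idS Q) β → KK F PUnit → ∀ {x y : Q}, Bad β x y → KK F Q := by
  intro n
  induction n with
  | zero =>
    intro Q _ hQ β H H1 x y hb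
    have := (Nat.card_eq_zero.1 hQ).resolve_right (fun h => h.not_finite ‹_›)
    exact KK.of_isEmpty
  | succ n ih =>
    intro Q _ hQ β H H1 x y hb
    by_cases hz : ∃ z, z ≠ x ∧ z ≠ y
    · obtain ⟨z, hzx, hzy⟩ := hz
      have H' := F.comap H (Subtype.val : {w // w ≠ z} → Q) (Subtype.val : {w // w ≠ z} → Q)
      rw [comap_idS_of_injective Subtype.val_injective] at H'
      have hb' : Bad (β.comap (Sum.map (Subtype.val : {w // w ≠ z} → Q)
          (Subtype.val : {w // w ≠ z} → Q))) (⟨x, hzx.symm⟩ : {w // w ≠ z})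
          (⟨y, hzy.symm⟩ : {w // w ≠ z}) := by
        rcases hb with ⟨rfl, h⟩ | ⟨h, h'⟩
        · exact Or.inl ⟨rfl, fun z => h z.1⟩
        · exact Or.inr ⟨fun h'' => h (Subtype.ext_iff.1 h''), h'⟩
      have hc : Nat.card {w // w ≠ z} = n := by
        classical
        have := Fintype.ofFinite Q
        rw [Nat.card_eq_fintype_card] at hQ ⊢
        rw [Fintype.card_subtype_compl, hQ]
        simp
      refine KK_of_hat H (ih hc H' H1 hb') ?_
      rw [card_ne_eq_of_finite z x]
      exact hb.card_TR_le
    · push Not at hz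
      refine KK_of_hat H H1 (hb.card_TR_le.trans ?_)
      rw [mk_punit, Cardinal.le_one_iff_subsingleton]
      refine ⟨fun a b => Subtype.ext ?_⟩
      rw [hz _ a.2, hz _ b.2]

theorem KK_of_card_lt_of_infinite [Infinite Q] {β : Setoid (Q ⊕ Q)} (H : F.R (idS Q) β)
    (h : #(TR β) < #Q) : KK F Q := by
  classical
  have H1 := KK_punit_of_card_lt H h
  let c : Q → Option (TR β) := fun q =>
    if hq : blk β (Sum.inl q) ∈ TR β then some ⟨_, hq⟩ else none
  obtain ⟨θ, hθ, hθQ, hr, hθ'⟩ : ∃ θ : Cardinal.{u}, θ.IsRegular ∧ θ ≤ #Q ∧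
      #(Option (TR β)) < θ ∧ #(TR β) ≤ θ := by
    rw [mk_option]
    rcases lt_or_ge #(TR β) ℵ₀ with h1 | h1
    · exact ⟨ℵ₀, isRegular_aleph0, aleph0_le_mk Q, add_lt_aleph0 h1 one_lt_aleph0, h1.le⟩
    · refine ⟨Order.succ #(TR β), isRegular_succ h1, Order.succ_le_of_lt h, ?_,
        Order.le_succ _⟩
      rw [add_one_eq h1]
      exact Order.lt_succ _
  obtain ⟨a, ha⟩ := infinite_pigeonhole_card c θ hθQ hθ.aleph0_le (by rwa [hθ.cof_ord])
  have H' := F.comap H (Subtype.val : c ⁻¹' {a} → Q) (Subtype.val : c ⁻¹' {a} → Q)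
  rw [comap_idS_of_injective Subtype.val_injective] at H'
  refine KK_of_hat (T := c ⁻¹' {a}) H (KK_of_hat H' H1 ?_) (hθ'.trans ha)
  rw [mk_punit, mk_le_one_iff_set_subsingleton]
  rintro _ ⟨y, z, h, rfl⟩ _ ⟨y', z', h', rfl⟩
  rw [blk_eq_iff]
  have hy : blk β (Sum.inl y.1) ∈ TR β := blk_inl_mem_TR.2 ⟨z.1, h⟩
  have hy' : blk β (Sum.inl y'.1) ∈ TR β := blk_inl_mem_TR.2 ⟨z'.1, h'⟩
  have e : c y.1 = c y'.1 := Eq.trans y.2 y'.2.symm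
  simp only [c, dif_pos hy, dif_pos hy', Option.some.injEq, Subtype.mk.injEq] at e
  exact (blk_eq_iff (α := β)).1 e

theorem KK_of_card_lt {β : Setoid (Q ⊕ Q)} (H : F.R (idS Q) β) (h : #(TR β) < #Q) :
    KK F Q := by
  rcases finite_or_infinite Q with hQ | hQ
  · obtain ⟨x, y, hb⟩ := exists_bad h
    exact KK_of_bad _ rfl H (KK_punit_of_card_lt H h) hb
  · exact KK_of_card_lt_of_infinite H h

end RankDrop

/-- The setoid relating all points of `U`. -/
def mg {A : Type*} (U : Set A) : Setoid A := rep U ⊥ ⊤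

theorem mg_rel {A : Type*} {U : Set A} {x y : A} : mg U x y ↔ (x ∈ U ∧ y ∈ U) ∨ x = y := by
  rw [mg, rep_rel, bot_rel]
  constructor
  · rintro (⟨h, h', -⟩ | ⟨-, -, h⟩)
    · exact Or.inl ⟨h, h'⟩
    · exact Or.inr h
  · rintro (⟨h, h'⟩ | rfl)
    · exact Or.inl ⟨h, h', trivial⟩
    · by_cases h : x ∈ U
      · exact Or.inl ⟨h, h, trivial⟩
      · exact Or.inr ⟨h, h, rfl⟩

theorem mg_of_mem {A : Type*} {U : Set A} {x y : A} (hx : x ∈ U) (hy : y ∈ U) : mg U x y :=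
  mg_rel.2 (Or.inl ⟨hx, hy⟩)

/-- Joining with a setoid supported on a saturated set only changes that set. -/
theorem sup_le_rep {A : Type*} {β σ : Setoid A} {S : Set A}
    (hS : ∀ x y, β x y → (x ∈ S ↔ y ∈ S)) (hσ : ∀ x y, σ x y → x = y ∨ (x ∈ S ∧ y ∈ S)) :
    β ⊔ σ ≤ rep S β ⊤ := by
  have h1 : ∀ {x y}, β x y → rep S β ⊤ x y := by
    intro x y h
    rw [rep_rel]
    by_cases hx : x ∈ S
    · exact Or.inl ⟨hx, (hS x y h).1 hx, trivial⟩
    · exact Or.inr ⟨hx, fun hy => hx ((hS x y h).2 hy), h⟩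
  refine sup_le (fun x y h => h1 h) (fun x y h => ?_)
  rcases hσ x y h with rfl | ⟨hx, hy⟩
  · exact h1 (β.refl' _)
  · exact Or.inl ⟨hx, hy, trivial⟩

theorem card_le_of_le_add_self {a b : Cardinal.{u}} (ha : ℵ₀ ≤ a) (h : a ≤ b + (b + b)) :
    a ≤ b := by
  by_contra! hlt
  exact absurd h (add_lt_of_lt ha hlt (add_lt_of_lt ha hlt hlt)).not_ge

theorem exists_disjoint_ranges {S W : Type u} [Infinite S] {c d : S → W}
    (hc : Function.Injective c) (hd : Function.Injective d) (hcd : ∀ s, c s ≠ d s) :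
    ∃ S' : Set S, #S ≤ #S' ∧ ∀ s ∈ S', ∀ t ∈ S', c s ≠ d t := by
  obtain ⟨M, hM⟩ := zorn_subset {S' : Set S | ∀ s ∈ S', ∀ t ∈ S', c s ≠ d t} (by
    intro C hC hch
    refine ⟨⋃₀ C, ?_, fun s hs => Set.subset_sUnion_of_mem hs⟩
    rintro s ⟨A, hA, hs⟩ t ⟨B, hB, ht⟩
    rcases hch.total hA hB with h | h
    · exact hC hB s (h hs) t ht
    · exact hC hA s hs t (h ht))
  refine ⟨M, ?_, hM.prop⟩
  have hA : #{s | ∃ t ∈ M, c s = d t} ≤ #M := by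
    choose g hg using fun s : {s | ∃ t ∈ M, c s = d t} => s.2
    refine ⟨⟨fun s => ⟨g s, (hg s).1⟩, fun s s' h => Subtype.ext (hc ?_)⟩⟩
    rw [(hg s).2, (hg s').2, show g s = g s' from Subtype.ext_iff.1 h]
  have hB : #{s | ∃ t ∈ M, d s = c t} ≤ #M := by
    choose g hg using fun s : {s | ∃ t ∈ M, d s = c t} => s.2
    refine ⟨⟨fun s => ⟨g s, (hg s).1⟩, fun s s' h => Subtype.ext (hd ?_)⟩⟩
    rw [(hg s).2, (hg s').2, show g s = g s' from Subtype.ext_iff.1 h]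
  refine card_le_of_le_add_self (aleph0_le_mk S) ?_
  have hcov : (Set.univ : Set S) ⊆ M ∪ ({s | ∃ t ∈ M, c s = d t} ∪ {s | ∃ t ∈ M, d s = c t}) := by
    intro s _
    by_contra hs
    simp only [Set.mem_union, not_or, Set.mem_ofPred_eq, not_exists, not_and] at hs
    obtain ⟨h1, h2, h3⟩ := hs
    refine h1 (hM.le_of_ge (y := insert s M) ?_ (Set.subset_insert _ _) (Set.mem_insert _ _))
    rintro a (rfl | ha) b (rfl | hb)
    · exact hcd _
    · exact h2 b hb
    · exact fun h => h3 a ha h.symm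
    · exact hM.prop a ha b hb
  calc #S = #(Set.univ : Set S) := mk_univ.symm
    _ ≤ _ := mk_le_mk_of_subset hcov
    _ ≤ _ := (mk_union_le _ _).trans (add_le_add le_rfl (mk_union_le _ _))
    _ ≤ _ := add_le_add le_rfl (add_le_add hA hB)

/-- The partition of a permutation. -/
def permS {Q : Type*} (σ : Equiv.Perm Q) : Setoid (Q ⊕ Q) := Setoid.ker (Sum.elim σ id)

theorem permS_rel {Q : Type*} {σ : Equiv.Perm Q} {x y : Q ⊕ Q} :
    permS σ x y ↔ Sum.elim σ id x = Sum.elim σ id y := Iff.rfl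

section

variable {X : Type u} {F : Fam X} {Y Z P Q T W : Type u}

theorem KK_of_nonfix {β : Setoid (W ⊕ W)} (H : F.R (idS W) β)
    (hβ : ∀ i, ¬ β (Sum.inl i) (Sum.inr i)) (hW : #W = 1 ∨ ℵ₀ ≤ #W) : KK F W := by
  rcases lt_or_ge #(TR β) #W with h | h
  · exact KK_of_card_lt H h
  rcases hW with hW | hW
  · rw [Cardinal.eq_one_iff_unique] at hW
    obtain ⟨hs, -⟩ := hW
    exact KK.of_split H (fun y z h => hβ y (by rwa [Subsingleton.elim z y] at h))
  have : Infinite (TR β) := infinite_iff.2 (hW.trans h)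
  choose c d hcd hB using fun B : TR β => B.2
  have hc : Function.Injective c := fun B B' e => Subtype.ext (by rw [hB B, hB B', e])
  have hd : Function.Injective d := fun B B' e => Subtype.ext (by
    rw [hB B, hB B', blk_eq_iff]
    have := hcd B
    rw [e] at this
    exact β.trans' this (β.symm' (hcd B')))
  obtain ⟨S', hS', hne⟩ := exists_disjoint_ranges hc hd
    (fun B e => hβ (c B) (by simpa only [← e] using hcd B))
  refine KK.transfer (P := S') ?_ (h.trans hS')
  have := F.symm (F.comap H (fun s : S' => c s.1) (fun s : S' => d s.1))
  have hci : Function.Injective (fun s : S' => c s.1) := hc.comp Subtype.val_injective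
  have hdi : Function.Injective (fun s : S' => d s.1) := hd.comp Subtype.val_injective
  have hrel : ∀ s t : S', β (Sum.inl (c s.1)) (Sum.inr (d t.1)) ↔ s = t := by
    refine fun s t => ⟨fun h => Subtype.ext (Subtype.ext ?_), fun h => h ▸ hcd _⟩
    rw [hB s.1, hB t.1, blk_eq_iff]
    exact β.trans' h (β.symm' (hcd _))
  have hrel1 : ∀ s t : S', β (Sum.inl (c s.1)) (Sum.inl (c t.1)) ↔ s = t := fun s t => by
    rw [← hrel, rel_right_of_rel (hcd t.1)]
  have hrel2 : ∀ s t : S', β (Sum.inr (d s.1)) (Sum.inr (d t.1)) ↔ s = t := fun s t => by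
    rw [← hrel, rel_left_of_rel (hcd s.1)]
  have e1 : β.comap (Sum.map (fun s : S' => c s.1) (fun s : S' => d s.1)) = idS S' := by
    ext x y
    rw [Setoid.comap_rel]
    rcases x with x | x <;> rcases y with y | y
    · exact hrel1 x y
    · exact hrel x y
    · exact Iff.trans ⟨fun h => β.symm' h, fun h => β.symm' h⟩ ((hrel y x).trans eq_comm)
    · exact hrel2 x y
  have e2 : (idS W).comap (Sum.map (fun s : S' => c s.1) (fun s : S' => d s.1)) = ⊥ := by
    ext x y
    rw [Setoid.comap_rel, bot_rel]
    rcases x with x | x <;> rcases y with y | y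
    · simp [hc.eq_iff, Subtype.ext_iff]
    · simpa using hne x.1 x.2 y.1 y.2
    · simpa using (hne y.1 y.2 x.1 x.2).symm
    · simp [hd.eq_iff, Subtype.ext_iff]
  rw [e1, e2] at this
  exact this

theorem KK_or_perm [Finite Q] {β : Setoid (Q ⊕ Q)} (H : F.R (idS Q) β) :
    KK F Q ∨ ∃ σ : Equiv.Perm Q, β = permS σ := by
  rcases lt_or_ge #(TR β) #Q with h | h
  · exact Or.inl (KK_of_card_lt H h)
  right
  have hb : ∀ x y, ¬ Bad β x y := by
    intro x y hb
    have hle := h.trans hb.card_TR_le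
    classical
    have := Fintype.ofFinite Q
    rw [mk_fintype, mk_fintype, Fintype.card_subtype_compl, Nat.cast_le] at hle
    have hp : 0 < Fintype.card Q := Fintype.card_pos_iff.2 ⟨x⟩
    simp at hle
    omega
  have hinj : ∀ x y, β (Sum.inl x) (Sum.inl y) → x = y := fun x y h =>
    by_contra fun h' => hb x y (Or.inr ⟨h', h⟩)
  have htr : ∀ x, ∃ z, β (Sum.inl x) (Sum.inr z) := fun x => by
    by_contra! h
    exact hb x x (Or.inl ⟨rfl, h⟩)
  choose σ hσ using htr
  have hσi : Function.Injective σ := fun x y e => hinj x y (by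
    have := hσ x
    rw [e] at this
    exact β.trans' this (β.symm' (hσ y)))
  refine ⟨Equiv.ofBijective σ (Finite.injective_iff_bijective.1 hσi), ?_⟩
  have hσs : Function.Surjective σ := Finite.surjective_of_injective hσi
  have h12 : ∀ x z, β (Sum.inl x) (Sum.inr z) ↔ σ x = z := by
    intro x z
    refine ⟨fun h => ?_, fun h => h ▸ hσ x⟩
    obtain ⟨w, rfl⟩ := hσs z
    rw [hinj x w (β.trans' h (β.symm' (hσ w)))]
  ext x y
  rw [permS_rel]
  rcases x with x | x <;> rcases y with y | y
  · rw [rel_right_of_rel (hσ y), h12]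
    simp
  · rw [h12]
    simp
  · rw [Setoid.comm', h12]
    simp [eq_comm]
  · obtain ⟨w, rfl⟩ := hσs x
    rw [← rel_left_of_rel (hσ w), h12]
    simp

theorem KK_punit_of_ne_upper {α β : Setoid (Y ⊕ Z)} (hY : #Y ≤ #X) (hZ : #Z ≤ #X) (H : F.R α β)
    {x y : Y} (h : α (Sum.inl x) (Sum.inl y)) (h' : ¬ β (Sum.inl x) (Sum.inl y))
    (hT : (TR α).Nonempty) : KK F PUnit := by
  by_contra hK
  have key : ∀ y z, α (Sum.inl y) (Sum.inr z) ↔ β (Sum.inl y) (Sum.inr z) := fun y z =>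
    ⟨fun h => by_contra fun h' => hK (KK_punit_of_rel H h h'),
     fun h => by_contra fun h' => hK (KK_punit_of_rel (F.symm H) h h')⟩
  obtain ⟨_, a, b, hab, -⟩ := hT
  have hab' := (key a b).1 hab
  have hsplit := split_SS (mg {a, x}) (⊥ : Setoid Z)
  have hax : SS (mg {a, x}) (⊥ : Setoid Z) (Sum.inl x) (Sum.inl a) :=
    (SS_inl_inl _ _).2 (mg_of_mem (by simp) (by simp))
  refine hK (KK_punit_of_rel (F.join hY hZ H hsplit) (y := y) (z := b) ?_ ?_)
  · exact Setoid.trans' _ (le_join (α.symm' h)) (Setoid.trans' _ (le_join' hax) (le_join hab))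
  · intro hyb
    have hle := @sup_le_rep _ β (SS (mg {a, x}) (⊥ : Setoid Z))
      {w | β w (Sum.inl a) ∨ β w (Sum.inl x)} ?_ ?_
    · have := hle hyb
      rw [rep_rel] at this
      have hy : ¬ β (Sum.inl y) (Sum.inl a) := by
        intro hya
        refine h' (β.trans' ?_ (β.symm' (β.trans' hya hab')))
        rw [← key]
        exact α.trans' h ((key _ _).2 (β.trans' hya hab'))
      have hy' : ¬ β (Sum.inl y) (Sum.inl x) := fun h => h' (β.symm' h)
      have hb : β (Sum.inr b) (Sum.inl a) := β.symm' hab'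
      simp [hy, hy', hb] at this
    · intro v w hvw
      simp only [Set.mem_ofPred_eq, rel_left_of_rel hvw]
    · intro v w hvw
      rcases v with v | v <;> rcases w with w | w <;> simp at hvw
      · rw [mg_rel] at hvw
        rcases hvw with ⟨hv, hw⟩ | rfl
        · right
          constructor
          · rcases hv with rfl | rfl
            · exact Or.inl (β.refl' _)
            · exact Or.inr (β.refl' _)
          · rcases hw with rfl | rfl
            · exact Or.inl (β.refl' _)
            · exact Or.inr (β.refl' _)
        · exact Or.inl rfl
      · left
        rw [hvw]

theorem TR_swap_nonempty {α : Setoid (Y ⊕ Z)} (h : (TR α).Nonempty) :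
    (TR (α.comap (Sum.swap : Z ⊕ Y → Y ⊕ Z))).Nonempty := by
  obtain ⟨_, a, b, hab, -⟩ := h
  exact ⟨_, b, a, α.symm' hab, rfl⟩

theorem KK.of_flip (H : KK F.flip P) : KK F P := by
  rw [KK, Fam.flip_iff] at H
  have e1 : (idS P).comap Sum.swap = idS P := by
    ext x y
    rcases x with x | x <;> rcases y with y | y <;> rfl
  have e2 : (⊥ : Setoid (P ⊕ P)).comap Sum.swap = ⊥ := by
    ext x y
    rcases x with x | x <;> rcases y with y | y <;> simp
  rwa [e1, e2] at H

theorem KK_punit_of_ne_of_TR {α β : Setoid (Y ⊕ Z)} (hY : #Y ≤ #X) (hZ : #Z ≤ #X)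
    (H : F.R α β) (hne : α ≠ β) (hT : (TR α).Nonempty) : KK F PUnit := by
  by_contra hK
  have key : ∀ y z, α (Sum.inl y) (Sum.inr z) ↔ β (Sum.inl y) (Sum.inr z) := fun y z =>
    ⟨fun h => by_contra fun h' => hK (KK_punit_of_rel H h h'),
     fun h => by_contra fun h' => hK (KK_punit_of_rel (F.symm H) h h')⟩
  have hT' : (TR β).Nonempty := by
    obtain ⟨_, a, b, hab, -⟩ := hT
    exact ⟨_, a, b, (key a b).1 hab, rfl⟩
  have Hf := Fam.flip_swap.2 H
  refine hne (Setoid.ext fun x y => ?_)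
  rcases x with x | x <;> rcases y with y | y
  · exact ⟨fun h => by_contra fun h' => hK (KK_punit_of_ne_upper hY hZ H h h' hT),
      fun h => by_contra fun h' => hK (KK_punit_of_ne_upper hY hZ (F.symm H) h h' hT')⟩
  · exact key x y
  · rw [Setoid.comm', key, Setoid.comm']
  · exact ⟨fun h => by_contra fun h' => hK
        (KK_punit_of_ne_upper hZ hY Hf h h' (TR_swap_nonempty hT)).of_flip,
      fun h => by_contra fun h' => hK
        (KK_punit_of_ne_upper hZ hY (F.flip.symm Hf) h h' (TR_swap_nonempty hT')).of_flip⟩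

end

theorem le_or_le_of_le_add {ξ a b : Cardinal.{u}} (hξ : ξ = 1 ∨ ℵ₀ ≤ ξ) (h : ξ ≤ a + b) :
    ξ ≤ a ∨ ξ ≤ b := by
  by_contra! hn
  rcases hξ with rfl | hξ
  · rw [Cardinal.lt_one_iff, Cardinal.lt_one_iff] at hn
    rw [hn.1, hn.2, add_zero] at h
    exact absurd h (by simp)
  · exact absurd h (add_lt_of_lt hξ hn.1 hn.2).not_ge

theorem le_or_le_of_le_union {A : Type u} {ξ : Cardinal.{u}} (hξ : ξ = 1 ∨ ℵ₀ ≤ ξ) {S T : Set A}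
    (h : ξ ≤ #(S ∪ T : Set A)) : ξ ≤ #S ∨ ξ ≤ #T :=
  le_or_le_of_le_add hξ (h.trans (mk_union_le S T))

/-- The pairs `a i`, `b i` lie in pairwise distinct transversals of `γ`. -/
def Ind {Y Z Q : Type*} (γ : Setoid (Y ⊕ Z)) (a : Q → Y) (b : Q → Z) : Prop :=
  (∀ i, γ (Sum.inl (a i)) (Sum.inr (b i))) ∧
    ∀ i j, γ (Sum.inl (a i)) (Sum.inl (a j)) → i = j

section

variable {X : Type u} {F : Fam X} {Y Z P Q T W : Type u}

theorem Ind.comp {γ : Setoid (Y ⊕ Z)} {a : Q → Y} {b : Q → Z} (h : Ind γ a b) {f : P → Q}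
    (hf : Function.Injective f) : Ind γ (a ∘ f) (b ∘ f) :=
  ⟨fun i => h.1 (f i), fun _ _ h' => hf (h.2 _ _ h')⟩

theorem Ind.comap_eq {γ : Setoid (Y ⊕ Z)} {a : Q → Y} {b : Q → Z} (h : Ind γ a b) :
    γ.comap (Sum.map a b) = idS Q := by
  have h1 : ∀ i j, γ (Sum.inl (a i)) (Sum.inl (a j)) ↔ i = j :=
    fun i j => ⟨h.2 i j, fun h' => h' ▸ γ.refl' _⟩
  ext x y
  rw [Setoid.comap_rel]
  rcases x with x | x <;> rcases y with y | y
  · exact h1 x y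
  · exact (rel_right_of_rel (γ.symm' (h.1 y))).trans (h1 x y)
  · exact (rel_left_of_rel (γ.symm' (h.1 x))).trans (h1 x y)
  · exact (rel_left_of_rel (γ.symm' (h.1 x))).trans
      ((rel_right_of_rel (γ.symm' (h.1 y))).trans (h1 x y))

theorem Ind.comap_elim {γ : Setoid (Y ⊕ Z)} {a : Q → Y} {b : Q → Z} (h : Ind γ a b)
    {P' : Type u} {c : P → Y} {d : P' → Z} (hc : ∀ i w, ¬ γ (Sum.inl (a i)) (Sum.inl (c w)))
    (hd : ∀ i w, ¬ γ (Sum.inl (a i)) (Sum.inr (d w))) :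
    γ.comap (Sum.map (Sum.elim a c) (Sum.elim b d)) = DS Q (γ.comap (Sum.map c d)) := by
  have h1 : ∀ i j, γ (Sum.inl (a i)) (Sum.inl (a j)) ↔ i = j :=
    fun i j => ⟨h.2 i j, fun h' => h' ▸ γ.refl' _⟩
  have hs : ∀ i x, γ (Sum.inr (b i)) x ↔ γ (Sum.inl (a i)) x := fun i x =>
    rel_left_of_rel (γ.symm' (h.1 i))
  have hs' : ∀ i x, γ x (Sum.inr (b i)) ↔ γ x (Sum.inl (a i)) := fun i x =>
    rel_right_of_rel (γ.symm' (h.1 i))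
  have hc' : ∀ i w, ¬ γ (Sum.inl (c w)) (Sum.inl (a i)) := fun i w h => hc i w (γ.symm' h)
  have hd' : ∀ i w, ¬ γ (Sum.inr (d w)) (Sum.inl (a i)) := fun i w h => hd i w (γ.symm' h)
  ext x y
  rw [Setoid.comap_rel, DS_rel]
  rcases x with (x | x) | (x | x) <;> rcases y with (y | y) | (y | y) <;>
    simp [ds, hs, hs', h1, hc, hd, hc', hd', Setoid.comap_rel]

variable [Infinite X] {hQ : #Q ≤ #X}

theorem KK_under_of_not_rel {α β : Setoid (Y ⊕ Z)} (H : F.R α β) {a : Q → Y} {b : Q → Z}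
    (hα : Ind α a b) (hβ : Ind β a b) (hc : ∀ i x, α (Sum.inl (a i)) x ↔ β (Sum.inl (a i)) x)
    {c : W → Y} {d : W → Z} (hcd : Ind α c d) (hoff : ∀ i w, ¬ α (Sum.inl (a i)) (Sum.inl (c w)))
    (hne : ∀ w, ¬ β (Sum.inl (c w)) (Sum.inr (d w))) (hW : #W = 1 ∨ ℵ₀ ≤ #W) :
    KK (F.under Q hQ) W := by
  have hoff' : ∀ i w, ¬ α (Sum.inl (a i)) (Sum.inr (d w)) := fun i w h =>
    hoff i w (α.trans' h (α.symm' (hcd.1 w)))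
  have := F.comap H (Sum.elim a c) (Sum.elim b d)
  rw [hα.comap_elim hoff hoff', hcd.comap_eq,
    hβ.comap_elim (fun i w => by rw [← hc]; exact hoff i w)
      (fun i w => by rw [← hc]; exact hoff' i w)] at this
  exact KK_of_nonfix (F := F.under Q hQ) this hne hW

theorem KK_under_of_not_mem_TR {α β : Setoid (Y ⊕ Z)} (H : F.R α β) {a : Q → Y} {b : Q → Z}
    (hα : Ind α a b) (hβ : Ind β a b) (hc : ∀ i x, α (Sum.inl (a i)) x ↔ β (Sum.inl (a i)) x)
    {c : W → Y} {d : W → Z} (hcd : Ind α c d) (hoff : ∀ i w, ¬ α (Sum.inl (a i)) (Sum.inl (c w)))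
    (hne : ∀ w, blk α (Sum.inl (c w)) ∉ TR β) (hW : #W = 1 ∨ ℵ₀ ≤ #W) :
    KK (F.under Q hQ) W := by
  have hoff' : ∀ i w, ¬ α (Sum.inl (a i)) (Sum.inr (d w)) := fun i w h =>
    hoff i w (α.trans' h (α.symm' (hcd.1 w)))
  let S : Set W := {w | ∃ x y, α (Sum.inl (c w)) (Sum.inl x) ∧ α (Sum.inl (c w)) (Sum.inr y) ∧
    ¬ β (Sum.inl x) (Sum.inr y)}
  rcases le_or_le_of_le_add (a := #S) (b := #(Sᶜ : Set W)) hW (mk_sum_compl S).ge with hS | hS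
  · refine KK.transfer (P := S) ?_ hS
    choose p q hp hq hpq using fun w : S => w.2
    have hcp : Ind α p q := by
      refine ⟨fun w => α.trans' (α.symm' (hp w)) (hq w), fun w w' h => Subtype.ext (hcd.2 _ _ ?_)⟩
      exact α.trans' (hp w) (α.trans' h (α.symm' (hp w')))
    refine KK_under_of_not_rel H hα hβ hc hcp (fun i w h => hoff i w ?_) hpq ?_
    · exact α.trans' h (α.symm' (hp w))
    · rwa [le_antisymm (mk_set_le S) hS]
  · refine KK.transfer (P := (Sᶜ : Set W)) ?_ hS
    have hW' : #(Sᶜ : Set W) = #W := le_antisymm (mk_set_le _) hS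
    have hall : ∀ w : (Sᶜ : Set W), ∀ x y, α (Sum.inl (c w)) (Sum.inl x) →
        α (Sum.inl (c w)) (Sum.inr y) → β (Sum.inl x) (Sum.inr y) := fun w x y h h' =>
      by_contra fun h'' => w.2 ⟨x, y, h, h', h''⟩
    have hβcd : ∀ w : (Sᶜ : Set W), β (Sum.inl (c w)) (Sum.inr (d w)) := fun w =>
      hall w _ _ (α.refl' _) (hcd.1 _)
    have hu : ∀ w : (Sᶜ : Set W), ∃ v, β (Sum.inl (c w)) v ∧ ¬ α (Sum.inl (c w)) v := by
      intro w
      by_contra! hv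
      refine hne w ⟨c w, d w, hβcd w, Set.ext fun v => ⟨fun h => ?_, fun h => hv v h⟩⟩
      rw [mem_blk] at h ⊢
      rcases v with v | v
      · exact β.trans' (hβcd w) (β.symm' (hall w _ _ h (hcd.1 w)))
      · exact hall w _ _ (α.refl' _) h
    have hpr : ∀ w : (Sᶜ : Set W), ∃ p q, β (Sum.inl (c w)) (Sum.inl p) ∧
        β (Sum.inl (c w)) (Sum.inr q) ∧ ¬ α (Sum.inl p) (Sum.inr q) := by
      intro w
      obtain ⟨v | v, hv, hv'⟩ := hu w
      · exact ⟨v, d w, hv, hβcd w, fun h => hv' (α.trans' (hcd.1 w) (α.symm' h))⟩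
      · exact ⟨c w, v, β.refl' _, hv, hv'⟩
    choose p q hp hq hpq using hpr
    have h1 : F.R (idS (Q ⊕ (Sᶜ : Set W)))
        (DS Q (β.comap (Sum.map (c ∘ ((↑) : (Sᶜ : Set W) → W)) (d ∘ ((↑) : (Sᶜ : Set W) → W))))) := by
      have hcd' := hcd.comp (f := ((↑) : (Sᶜ : Set W) → W)) Subtype.val_injective
      have := F.comap H (Sum.elim a (c ∘ ((↑) : (Sᶜ : Set W) → W)))
        (Sum.elim b (d ∘ ((↑) : (Sᶜ : Set W) → W)))
      rwa [hα.comap_elim (c := c ∘ ((↑) : (Sᶜ : Set W) → W)) (d := d ∘ ((↑) : (Sᶜ : Set W) → W))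
          (fun i w => hoff i w) (fun i w => hoff' i w), hcd'.comap_eq,
        hβ.comap_elim (c := c ∘ ((↑) : (Sᶜ : Set W) → W)) (d := d ∘ ((↑) : (Sᶜ : Set W) → W))
          (fun i w => by rw [← hc]; exact hoff i w)
          (fun i w => by rw [← hc]; exact hoff' i w), DS_idS] at this
    set β' := β.comap (Sum.map (c ∘ ((↑) : (Sᶜ : Set W) → W)) (d ∘ ((↑) : (Sᶜ : Set W) → W))) with hβ'
    rcases lt_or_ge #(TR β') #(Sᶜ : Set W) with hlt | hge
    · rw [← DS_idS] at h1
      exact KK_of_card_lt (F := F.under Q hQ) h1 hlt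
    · have hle : #(TR β') ≤ #(Sᶜ : Set W) := by
        refine card_TR_le Sum.inl ?_
        rintro _ ⟨y, z, -, rfl⟩
        exact ⟨y, rfl⟩
      refine KK.transfer (P := TR β') ?_ hge
      choose s t hst hB using fun B : TR β' => B.2
      have hpq' : Ind β (fun B => p (s B)) (fun B => q (s B)) := by
        refine ⟨fun B => β.trans' (β.symm' (hp _)) (hq _), fun B B' h => Subtype.ext ?_⟩
        rw [hB B, hB B', blk_eq_iff]
        exact β.trans' (hp _) (β.trans' h (β.symm' (hp _)))
      refine KK_under_of_not_rel (F.symm H) hβ hα (fun i x => (hc i x).symm) hpq'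
        (fun i B h => hoff i (s B) ?_) (fun B => hpq _) ?_
      · rw [hc]
        exact β.trans' h (β.symm' (hp _))
      · rwa [le_antisymm hle hge, hW']

/-- Points of the common transversals of two setoids. -/
theorem exists_common_points {α β : Setoid (Y ⊕ Z)} {f : Q → Set (Y ⊕ Z)}
    (hf : Function.Injective f) (hfα : ∀ i, f i ∈ TR α) (hfβ : ∀ i, f i ∈ TR β) :
    ∃ (a : Q → Y) (b : Q → Z), Ind α a b ∧ Ind β a b ∧ (∀ i, f i = blk α (Sum.inl (a i))) ∧
      ∀ i x, α (Sum.inl (a i)) x ↔ β (Sum.inl (a i)) x := by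
  choose a b hab hB using hfα
  have hc : ∀ i x, α (Sum.inl (a i)) x ↔ β (Sum.inl (a i)) x := by
    intro i x
    have : f i = blk β (Sum.inl (a i)) := by
      obtain ⟨y, z, -, h⟩ := hfβ i
      rw [h, blk_eq_iff, ← mem_blk, ← h, hB, mem_blk]
    rw [← mem_blk, ← hB, this, mem_blk]
  have hind : ∀ i j, α (Sum.inl (a i)) (Sum.inl (a j)) → i = j := fun i j h => hf (by
    rw [hB, hB, blk_eq_iff]
    exact h)
  exact ⟨a, b, ⟨hab, hind⟩, ⟨fun i => (hc _ _).1 (hab i), fun i j h => hind i j ((hc _ _).2 h)⟩,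
    hB, hc⟩

theorem KK_under_of_card_diff {α β : Setoid (Y ⊕ Z)} (H : F.R α β) {f : Q → Set (Y ⊕ Z)}
    (hf : Function.Injective f) (hfα : ∀ i, f i ∈ TR α) (hfβ : ∀ i, f i ∈ TR β)
    (hW : #W = 1 ∨ ℵ₀ ≤ #W) (h : #W ≤ #(TR α \ TR β : Set (Set (Y ⊕ Z)))) :
    KK (F.under Q hQ) W := by
  obtain ⟨a, b, hα, hβ, hfa, hc⟩ := exists_common_points hf hfα hfβ
  obtain ⟨g, hg⟩ := h
  choose c d hcd hB using fun w => (g w).2.1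
  refine KK_under_of_not_mem_TR H hα hβ hc (c := c) (d := d) ⟨hcd, fun w w' h => ?_⟩ ?_ ?_ hW
  · exact hg (Subtype.ext (by rw [hB w, hB w', blk_eq_iff]; exact h))
  · intro i w h
    refine (g w).2.2 ?_
    rw [hB w, ← blk_eq_iff.2 h, ← hfa]
    exact hfβ i
  · intro w
    rw [← hB w]
    exact (g w).2.2

end

section Kernel

variable {X : Type u} {F : Fam X} {Y Z I I' P Q T : Type u}

theorem SS_sup_left (K K' : Setoid Y) (C : Setoid Z) : SS K C ⊔ SS K' ⊥ = SS (K ⊔ K') C := by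
  refine le_antisymm (sup_le ?_ ?_) ?_
  · intro x y h
    rcases x with x | x <;> rcases y with y | y <;> simp at h ⊢
    · exact le_join h
    · exact h
  · intro x y h
    rcases x with x | x <;> rcases y with y | y <;> simp at h ⊢
    · exact le_join' h
    · change x = y at h
      exact h ▸ C.refl' _
  · have key : K ⊔ K' ≤ (SS K C ⊔ SS K' ⊥).comap Sum.inl :=
      sup_le (fun x y h => le_join ((SS_inl_inl _ _).2 h))
        (fun x y h => le_join' ((SS_inl_inl _ _).2 h))
    intro x y h
    rcases x with x | x <;> rcases y with y | y <;> simp at h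
    · exact key h
    · exact le_join ((SS_inr_inr _ _).2 h)

theorem SS_comap {Y' Z' : Type u} (K : Setoid Y) (C : Setoid Z) (h : Y' → Y) (k : Z' → Z) :
    (SS K C).comap (Sum.map h k) = SS (K.comap h) (C.comap k) := by
  ext x y
  rw [Setoid.comap_rel]
  rcases x with x | x <;> rcases y with y | y <;> simp [Setoid.comap_rel]

/-- The family relates the trivial upper setoid on `I` to the full one. -/
def UU (F : Fam X) (I : Type u) : Prop :=
  F.R (SS (⊥ : Setoid I) (⊥ : Setoid PUnit.{u + 1})) (SS ⊤ ⊥)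

theorem UU.transfer (H : UU F I) (h : #T ≤ #I) : UU F T := by
  obtain ⟨i, hi⟩ := h
  have := F.comap H i id
  rw [SS_comap, SS_comap] at this
  rw [UU]
  convert this using 2
  · ext x y
    exact hi.eq_iff.symm
  · rfl

theorem mem_classes_blk {A : Type*} {K : Setoid A} {B : Set A} :
    B ∈ K.classes ↔ ∃ x, B = blk K x := by
  constructor
  · rintro ⟨x, rfl⟩
    exact ⟨x, Set.ext fun y => Setoid.comm' _⟩
  · rintro ⟨x, rfl⟩
    exact ⟨x, Set.ext fun y => Setoid.comm' _⟩

theorem UU_of_le [Nonempty Z] (hY : #Y ≤ #X) (hZ : #Z ≤ #X) {K J : Setoid Y} {C : Setoid Z}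
    (hKJ : K ≤ J) (H : F.R (SS K C) (SS J C)) {ξ : Cardinal.{u}} (hξ : ξ = 1 ∨ ℵ₀ ≤ ξ)
    (h : ξ ≤ #(K.classes ∆ J.classes : Set (Set Y))) (hI : #I ≤ ξ + 1) : UU F I := by
  classical
  let ρ : Y → Y := fun x => Quotient.out (Quotient.mk J x)
  have hρ : ∀ x, J x (ρ x) := fun x => J.symm' (Quotient.exact (Quotient.out_eq (Quotient.mk J x)))
  have hρ' : ∀ {x y}, J x y → ρ x = ρ y := fun h => by
    change Quotient.out _ = Quotient.out _
    rw [Quotient.sound h]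
  let N : Set (Set Y) := {B | ∃ x, B = blk K x ∧ ¬ K x (ρ x)}
  choose n hnB hn using fun B : N => B.2
  have hsub : (K.classes ∆ J.classes : Set (Set Y)) ⊆ N ∪ (Set.range (fun B : N => blk K (ρ (n B))) ∪
      Set.range (fun B : N => blk J (n B))) := by
    have hN : ∀ {x}, ¬ K x (ρ x) → ∃ B : N, K x (n B) := fun {x} hx =>
      ⟨⟨_, x, rfl, hx⟩, blk_eq_iff.1 (hnB ⟨_, x, rfl, hx⟩)⟩
    rintro B (⟨hB, hB'⟩ | ⟨hB, hB'⟩) <;> obtain ⟨x, rfl⟩ := mem_classes_blk.1 hB <;>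
      rw [mem_classes_blk] at hB' <;> push Not at hB'
    · by_cases hx : K x (ρ x)
      · right; left
        obtain ⟨y, hy, hy'⟩ : ∃ y, J x y ∧ ¬ K x y := by
          by_contra! h'
          exact hB' x (Set.ext fun y => ⟨fun h => hKJ h, h' y⟩)
        obtain ⟨B, hB⟩ := hN (x := y) (by
          rw [← hρ' hy]
          exact fun h => hy' (K.trans' hx (K.symm' h)))
        refine ⟨B, ?_⟩
        change blk K _ = blk K _
        rw [← hρ' (hKJ hB), ← hρ' hy, blk_eq_iff]
        exact K.symm' hx
      · exact Or.inl ⟨x, rfl, hx⟩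
    · right; right
      obtain ⟨y, hy, hy'⟩ : ∃ y, J x y ∧ ¬ K y (ρ y) := by
        by_contra! h'
        refine hB' x (Set.ext fun y => ⟨fun h => ?_, fun h => hKJ h⟩)
        have := h' y h
        rw [← hρ' h] at this
        exact K.trans' (h' x (J.refl' _)) (K.symm' this)
      obtain ⟨B, hB⟩ := hN hy'
      exact ⟨B, blk_eq_iff.2 (J.symm' (J.trans' hy (hKJ hB)))⟩
  have hN : ξ ≤ #N := by
    rcases le_or_le_of_le_union hξ (h.trans (mk_le_mk_of_subset hsub)) with h | h
    · exact h
    · rcases le_or_le_of_le_union hξ h with h | h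
      · exact h.trans mk_range_le
      · exact h.trans mk_range_le
  obtain ⟨B₀⟩ : Nonempty N := by
    rw [← mk_ne_zero_iff]
    rintro h0
    rw [h0, nonpos_iff_eq_zero] at hN
    rcases hξ with h | h <;> rw [hN] at h
    · exact zero_ne_one h
    · exact aleph0_pos.not_ge h
  refine UU.transfer (I := Option N) ?_ (by rw [mk_option]; exact hI.trans (by gcongr))
  have hjoin := F.join hY hZ H (σ := SS (mg (Set.range (ρ ∘ n))) ⊥) (split_SS _ _)
  rw [SS_sup_left, SS_sup_left] at hjoin
  have key := F.comap hjoin (fun o : Option N => o.elim (ρ (n B₀)) n)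
    (fun _ : PUnit.{u + 1} => Classical.arbitrary Z)
  rw [SS_comap, SS_comap] at key
  have hC : C.comap (fun _ : PUnit.{u + 1} => Classical.arbitrary Z) = ⊥ := by
    ext x y
    simp
  rw [hC] at key
  rw [UU]
  convert key using 2
  · let S : Set Y := {x | ∃ B, K x (ρ (n B))}
    have hle : K ⊔ mg (Set.range (ρ ∘ n)) ≤ rep S K ⊤ := by
      refine sup_le_rep (fun x y h => ?_) (fun x y h => ?_)
      · exact ⟨fun ⟨B, hB⟩ => ⟨B, K.trans' (K.symm' h) hB⟩, fun ⟨B, hB⟩ => ⟨B, K.trans' h hB⟩⟩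
      · rcases mg_rel.1 h with ⟨⟨B, rfl⟩, ⟨B', rfl⟩⟩ | h
        · exact Or.inr ⟨⟨B, K.refl' _⟩, ⟨B', K.refl' _⟩⟩
        · exact Or.inl h
    have hnS : ∀ B, n B ∉ S := by
      rintro B ⟨B', h⟩
      have : ρ (n B) = ρ (ρ (n B')) := hρ' (hKJ h)
      rw [← hρ' (hρ (n B'))] at this
      exact hn B (by rw [this]; exact h)
    ext x y
    rw [bot_rel]
    refine ⟨fun h => h ▸ Setoid.refl' _ _, fun h => ?_⟩
    have h' := hle h
    rw [rep_rel] at h'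
    rcases x with - | x <;> rcases y with - | y
    · rfl
    · rcases h' with ⟨-, h', -⟩ | ⟨h', -⟩
      · exact absurd h' (hnS y)
      · exact absurd ⟨B₀, K.refl' _⟩ h'
    · rcases h' with ⟨h', -⟩ | ⟨-, h', -⟩
      · exact absurd h' (hnS x)
      · exact absurd ⟨B₀, K.refl' _⟩ h'
    · rcases h' with ⟨h', -⟩ | ⟨-, -, h'⟩
      · exact absurd h' (hnS x)
      · rw [Subtype.ext (a1 := x) (a2 := y) (by rw [hnB x, hnB y]; exact blk_eq_iff.2 h')]
  · have hz : ∀ o : Option N, (J ⊔ mg (Set.range (ρ ∘ n))) (o.elim (ρ (n B₀)) n) (ρ (n B₀)) := by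
      rintro (- | B)
      · exact Setoid.refl' _ _
      · exact Setoid.trans' _ (le_join (hρ (n B))) (le_join' (mg_of_mem ⟨B, rfl⟩ ⟨B₀, rfl⟩))
    ext x y
    simp only [Setoid.top_def, Pi.top_apply, Prop.top_eq_true, true_iff]
    exact Setoid.trans' (J ⊔ _) (hz x) (Setoid.symm' (J ⊔ _) (hz y))

theorem UU_of_SS [Nonempty Z] (hY : #Y ≤ #X) (hZ : #Z ≤ #X) {K K' : Setoid Y} {C : Setoid Z}
    (H : F.R (SS K C) (SS K' C)) {ξ : Cardinal.{u}} (hξ : ξ = 1 ∨ ℵ₀ ≤ ξ)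
    (h : ξ ≤ #(K.classes ∆ K'.classes : Set (Set Y))) (hI : #I ≤ ξ + 1) : UU F I := by
  have h1 := F.join hY hZ H (σ := SS K ⊥) (split_SS _ _)
  have h2 := F.join hY hZ (F.symm H) (σ := SS K' ⊥) (split_SS _ _)
  rw [SS_sup_left, SS_sup_left, sup_idem] at h1 h2
  rw [sup_comm] at h1
  have hsub : (K.classes ∆ K'.classes : Set (Set Y)) ⊆
      K.classes ∆ (K ⊔ K').classes ∪ K'.classes ∆ (K ⊔ K').classes := by
    rw [symmDiff_comm K'.classes]
    exact symmDiff_triangle _ _ _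
  rcases le_or_le_of_le_union hξ (h.trans (mk_le_mk_of_subset hsub)) with h | h
  · exact UU_of_le hY hZ le_sup_left h1 hξ h hI
  · exact UU_of_le hY hZ le_sup_right h2 hξ h hI

theorem UU.merge (H : UU F I) {E : Setoid Y} {C : Setoid Z} {S : Set Y}
    (hS : ∀ x y, E x y → (x ∈ S ↔ y ∈ S)) (h : #(blk E '' S) ≤ #I) :
    F.R (SS E C) (SS (rep Sᶜ ⊤ E) C) := by
  classical
  rcases isEmpty_or_nonempty I with hI | ⟨⟨i₀⟩⟩
  · rw [mk_eq_zero I, nonpos_iff_eq_zero, mk_eq_zero_iff, Set.isEmpty_coe_sort,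
      Set.image_eq_empty] at h
    subst h
    convert F.refl _ using 2
    ext x y
    simp [rep_rel]
  obtain ⟨j, hj⟩ := h
  let f : Y → I := fun x => if hx : x ∈ S then j ⟨_, x, hx, rfl⟩ else i₀
  have hf : ∀ {x y}, x ∈ S → y ∈ S → (f x = f y ↔ E x y) := by
    intro x y hx hy
    simp only [f, dif_pos hx, dif_pos hy, hj.eq_iff, Subtype.ext_iff, blk_eq_iff]
  have key := F.rep (F.comap H f (fun _ : Z => PUnit.unit)) (Sum.inl '' S) (split_SS E C)
  rw [SS_comap, SS_comap] at key
  convert key using 1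
  · ext x y
    rw [rep_rel]
    rcases x with x | x <;> rcases y with y | y <;> simp
    by_cases hx : x ∈ S <;> by_cases hy : y ∈ S <;> simp [hx, hy, hf]
    · exact fun h => hy ((hS _ _ h).1 hx)
    · exact fun h => hx ((hS _ _ h).2 hy)
  · ext x y
    rw [rep_rel]
    rcases x with x | x <;> rcases y with y | y <;> simp [rep_rel]
    tauto

theorem UU.option (H : UU F I) (H' : UU F (ULift.{u} Bool)) : UU F (Option I) := by
  classical
  rcases isEmpty_or_nonempty I with hI | ⟨⟨i₀⟩⟩
  · refine H'.transfer ?_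
    rw [mk_option, mk_eq_zero I]
    simp
  have h1 := H'.merge (E := (⊥ : Setoid (Option I))) (C := (⊥ : Setoid PUnit.{u + 1}))
    (S := {none, some i₀}) (fun x y h => by rw [h]) (by
      refine mk_image_le.trans ?_
      rw [mk_insert (by simp)]
      simp only [mk_singleton, mk_uLift, mk_bool, lift_ofNat]
      norm_num)
  have h2 := F.comap H (fun o : Option I => o.getD i₀) id
  rw [SS_comap, SS_comap] at h2
  refine F.trans h1 ?_
  convert h2 using 2
  · ext x y
    rw [rep_rel, Setoid.comap_rel]
    rcases x with - | x <;> rcases y with - | y <;> simp [eq_comm]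
    by_cases hx : i₀ = x <;> by_cases hy : i₀ = y <;> grind
  · rfl

theorem UU.of_finite (H : UU F (ULift.{u} Bool)) [Finite I] : UU F I := by
  induction I using Finite.induction_empty_option with
  | of_equiv e h => exact h.transfer (mk_congr e).ge
  | h_empty => exact H.transfer (by simp)
  | h_option h => exact h.option H

theorem mem_bad_iff {A : Type*} {E E' : Setoid A} {x y : A} (h : E x y) :
    blk E x ≠ blk E' x ↔ blk E y ≠ blk E' y := by
  have aux : ∀ {x y}, E x y → blk E x = blk E' x → blk E y = blk E' y := fun {x y} h h' => by
    have : E' x y := by rw [← mem_blk, ← h']; exact h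
    rw [← blk_eq_iff.2 h, h', blk_eq_iff.2 this]
  exact not_congr ⟨aux h, aux (E.symm' h)⟩

theorem blk_image_bad_subset {A : Type*} {E E' : Setoid A} :
    blk E '' {x | blk E x ≠ blk E' x} ⊆ E.classes \ E'.classes := by
  rintro _ ⟨x, hx, rfl⟩
  refine ⟨mem_classes_blk.2 ⟨x, rfl⟩, fun h => hx ?_⟩
  obtain ⟨y, hy⟩ := mem_classes_blk.1 h
  have : x ∈ blk E' y := by rw [← hy]; exact E.refl' x
  rw [hy, blk_eq_iff]
  exact this

theorem UU.SS_rel (H : UU F I) {E E' : Setoid Y} {C : Setoid Z}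
    (h : #(E.classes ∆ E'.classes : Set (Set Y)) ≤ #I) : F.R (SS E C) (SS E' C) := by
  have h1 := H.merge (E := E) (C := C) (S := {x | blk E x ≠ blk E' x}) (fun x y => mem_bad_iff)
    ((mk_le_mk_of_subset (blk_image_bad_subset.trans Set.subset_union_left)).trans h)
  have h2 := H.merge (E := E') (C := C) (S := {x | blk E' x ≠ blk E x}) (fun x y => mem_bad_iff)
    ((mk_le_mk_of_subset (blk_image_bad_subset.trans Set.subset_union_right)).trans h)
  refine F.trans h1 (F.symm ?_)
  convert h2 using 2
  ext x y
  have : ∀ z, z ∈ ({x | blk E x ≠ blk E' x} : Set Y)ᶜ → ∀ y, (E z y ↔ E' z y) := by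
    intro z hz y
    simp only [Set.mem_compl_iff, Set.mem_ofPred_eq, not_not] at hz
    rw [← mem_blk, hz, mem_blk]
  rw [rep_rel, rep_rel]
  have e : {x | blk E x ≠ blk E' x} = {x | blk E' x ≠ blk E x} := by
    ext x
    exact ne_comm
  rw [← e]
  constructor
  · rintro (⟨a, b, h⟩ | h)
    · exact Or.inl ⟨a, b, (this _ a _).1 h⟩
    · exact Or.inr h
  · rintro (⟨a, b, h⟩ | h)
    · exact Or.inl ⟨a, b, (this _ a _).2 h⟩
    · exact Or.inr h

end Kernel

section Under

variable {X : Type u} {F : Fam X} {Y Z I P Q Q' T : Type u} 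

theorem UU_under_of_ker [Infinite X] {hQ : #Q ≤ #X} [Nonempty Z] (hY : #Y ≤ #X)
    {α β : Setoid (Y ⊕ Z)} (H : F.R α β) {a : Q → Y} {b : Q → Z} (hα : Ind α a b) (hβ : Ind β a b)
    (hc : ∀ i x, α (Sum.inl (a i)) x ↔ β (Sum.inl (a i)) x) {ξ : Cardinal.{u}}
    (hξ : ξ = 1 ∨ ℵ₀ ≤ ξ) (h : ξ ≤ #((α.comap Sum.inl).classes ∆ (β.comap Sum.inl).classes :
      Set (Set Y))) (hI : #I ≤ ξ + 1) : UU (F.under Q hQ) I := by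
  let V : Set Y := {y | ∀ i, ¬ α (Sum.inl (a i)) (Sum.inl y)}
  have key := F.rep (F.comap H (Sum.elim a ((↑) : V → Y))
    (Sum.elim b fun _ : PUnit.{u + 1} => Classical.arbitrary Z)) {x | ∀ p, x ≠ Sum.inr (Sum.inr p)}
    (split_bot)
  have e : ∀ γ : Setoid (Y ⊕ Z), Ind γ a b → (∀ i x, α (Sum.inl (a i)) x ↔ γ (Sum.inl (a i)) x) →
      rep {x | ∀ p, x ≠ Sum.inr (Sum.inr p)} ⊥ (γ.comap (Sum.map (Sum.elim a ((↑) : V → Y))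
        (Sum.elim b fun _ : PUnit.{u + 1} => Classical.arbitrary Z))) =
      DS Q (SS ((γ.comap Sum.inl).comap ((↑) : V → Y)) (⊥ : Setoid PUnit.{u + 1})) := by
    intro γ hγ hγ'
    have h1 : ∀ i j, γ (Sum.inl (a i)) (Sum.inl (a j)) ↔ i = j :=
      fun i j => ⟨hγ.2 i j, fun h' => h' ▸ γ.refl' _⟩
    have hs : ∀ i x, γ (Sum.inr (b i)) x ↔ γ (Sum.inl (a i)) x := fun i x =>
      rel_left_of_rel (γ.symm' (hγ.1 i))
    have hs' : ∀ i x, γ x (Sum.inr (b i)) ↔ γ x (Sum.inl (a i)) := fun i x =>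
      rel_right_of_rel (γ.symm' (hγ.1 i))
    have hV : ∀ i (v : V), ¬ γ (Sum.inl (a i)) (Sum.inl v) := fun i v h =>
      v.2 i ((hγ' _ _).2 h)
    have hV' : ∀ i (v : V), ¬ γ (Sum.inl v) (Sum.inl (a i)) := fun i v h => hV i v (γ.symm' h)
    ext x y
    rw [rep_rel, DS_rel, Setoid.comap_rel]
    rcases x with (x | x) | (x | x) <;> rcases y with (y | y) | (y | y) <;>
      simp [ds, hs, hs', h1, hV, hV', Setoid.comap_rel]
  rw [e α hα fun _ _ => Iff.rfl, e β hβ hc] at key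
  refine UU_of_SS (F := F.under Q hQ) (Z := PUnit) ((mk_set_le V).trans hY) ?_ key hξ
    (h.trans ?_) hI
  · rw [mk_punit]
    exact Cardinal.one_le_iff_ne_zero.2 (mk_ne_zero X)
  have aux : ∀ γ δ : Setoid (Y ⊕ Z), (∀ i x, α (Sum.inl (a i)) x ↔ γ (Sum.inl (a i)) x) →
      (∀ i x, α (Sum.inl (a i)) x ↔ δ (Sum.inl (a i)) x) →
      ∀ B ∈ (γ.comap Sum.inl).classes \ (δ.comap Sum.inl).classes, B ⊆ V ∧
      ((↑) : V → Y) ⁻¹' B ∈ ((γ.comap Sum.inl).comap ((↑) : V → Y)).classes \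
        ((δ.comap Sum.inl).comap ((↑) : V → Y)).classes := by
    rintro γ δ hγ hδ B ⟨hB, hB'⟩
    obtain ⟨x, rfl⟩ := mem_classes_blk.1 hB
    have hsub : blk (γ.comap Sum.inl) x ⊆ V := by
      intro y hy i hi
      refine hB' (mem_classes_blk.2 ⟨a i, ?_⟩)
      have : (γ.comap Sum.inl) x (a i) := γ.trans' hy (γ.symm' ((hγ _ _).1 hi))
      rw [blk_eq_iff.2 this]
      ext z
      exact (hγ i _).symm.trans (hδ i _)
    have hx : x ∈ V := hsub (mem_blk.2 (Setoid.refl' _ x))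
    refine ⟨hsub, mem_classes_blk.2 ⟨⟨x, hx⟩, rfl⟩, fun h => hB' ?_⟩
    obtain ⟨y, hy⟩ := mem_classes_blk.1 h
    refine mem_classes_blk.2 ⟨y, Set.ext fun z => ?_⟩
    by_cases hz : z ∈ V
    · exact Set.ext_iff.1 hy ⟨z, hz⟩
    · refine ⟨fun h => absurd (hsub h) hz, fun h => ?_⟩
      simp only [V, Set.mem_ofPred_eq, not_forall, not_not] at hz
      obtain ⟨i, hi⟩ := hz
      exact absurd ((hδ _ _).2 (δ.trans' ((hδ _ _).1 hi) (δ.symm' h))) (y.2 i)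
  have hmem : ∀ B ∈ (α.comap Sum.inl).classes ∆ (β.comap Sum.inl).classes, B ⊆ V ∧
      ((↑) : V → Y) ⁻¹' B ∈ ((α.comap Sum.inl).comap ((↑) : V → Y)).classes ∆
        ((β.comap Sum.inl).comap ((↑) : V → Y)).classes := by
    rintro B (hB | hB)
    · have := aux α β (fun _ _ => Iff.rfl) hc B hB
      exact ⟨this.1, Or.inl this.2⟩
    · have := aux β α hc (fun _ _ => Iff.rfl) B hB
      exact ⟨this.1, Or.inr this.2⟩
  refine ⟨⟨fun B => ⟨_, (hmem B.1 B.2).2⟩, fun B B' h => Subtype.ext ?_⟩⟩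
  have := Subtype.ext_iff.1 h
  rwa [Set.preimage_eq_preimage' ] at this
  · simpa using (hmem B.1 B.2).1
  · simpa using (hmem B'.1 B'.2).1

theorem KK_under_of_UU [Infinite X] {hQ : #Q ≤ #X} (hI : #I ≤ #X) {hQI : #(Q ⊕ I) ≤ #X} [Nontrivial I]
    (H : UU (F.under (Q ⊕ I) hQI) I) : KK (F.under Q hQ) I := by
  have h1 : F.R (DS (Q ⊕ I) (SS (⊥ : Setoid I) (⊥ : Setoid PUnit.{u + 1})))
    (DS (Q ⊕ I) (SS (⊤ : Setoid I) (⊥ : Setoid PUnit.{u + 1}))) := H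
  have h2 := F.comap h1 (Y' := Q ⊕ (I ⊕ I)) (Z' := Q ⊕ I)
    (Sum.elim (fun q => Sum.inl (Sum.inl q)) (Sum.elim (fun i => Sum.inl (Sum.inr i)) Sum.inr))
    Sum.inl
  have e : ∀ K : Setoid I, (DS (Q ⊕ I) (SS K (⊥ : Setoid PUnit.{u + 1}))).comap (Sum.map
      (Sum.elim (fun q => Sum.inl (Sum.inl q)) (Sum.elim (fun i => Sum.inl (Sum.inr i)) Sum.inr))
      Sum.inl) = DS Q (DS I (SS K (⊥ : Setoid PEmpty.{u + 1})) |>.comap (Sum.map id Sum.inl)) := by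
    intro K
    ext x y
    rw [Setoid.comap_rel, DS_rel, DS_rel]
    rcases x with (x | x | x) | (x | x) <;> rcases y with (y | y | y) | (y | y) <;>
      simp [ds, Setoid.comap_rel, DS_rel]
  rw [e, e] at h2
  have h3 := Fam.join (F.under Q hQ) (card_sum_le hI hI) hI h2
    (σ := SS (Setoid.ker (Sum.elim id id)) ⊥) (split_SS _ _)
  have h4 := Fam.comap _ h3 Sum.inl id
  obtain ⟨p, r, hpr⟩ := exists_pair_ne I
  refine KK.of_merge (p := p) (r := r) ?_ hpr
  convert h4 using 1
  · refine le_antisymm ?_ ?_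
    · intro x y h
      rw [idS_rel] at h
      refine le_join ?_
      rw [Setoid.comap_rel, DS_rel]
      rcases x with x | x <;> rcases y with y | y <;> simp at h <;> subst h <;> simp [ds]
    · have : ((DS I (SS (⊥ : Setoid I) (⊥ : Setoid PEmpty.{u + 1}))).comap (Sum.map id Sum.inl)) ⊔
          SS (Setoid.ker (Sum.elim id id)) ⊥ ≤ (idS I).comap (Sum.map (Sum.elim id id) id) := by
        refine sup_le ?_ ?_
        · intro x y h
          rw [Setoid.comap_rel, DS_rel] at h
          rw [Setoid.comap_rel]
          rcases x with (x | x) | x <;> rcases y with (y | y) | y <;> simp [ds] at h ⊢ <;> exact h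
        · intro x y h
          rw [Setoid.comap_rel]
          rcases x with (x | x) | x <;> rcases y with (y | y) | y <;> simp [Setoid.ker_def] at h ⊢ <;>
            exact h
      intro x y h
      have h' := this h
      rcases x with x | x <;> rcases y with y | y <;> exact h'
  · symm
    rw [eq_top_iff]
    set M := ((DS I (SS (⊤ : Setoid I) (⊥ : Setoid PEmpty.{u + 1}))).comap (Sum.map id Sum.inl)) ⊔
          SS (Setoid.ker (Sum.elim id id)) ⊥ with hM
    have a1 : ∀ i, M (Sum.inl (Sum.inl i)) (Sum.inl (Sum.inr i)) := fun i => le_join' (by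
      simp [Setoid.ker_def])
    have a2 : ∀ i, M (Sum.inr i) (Sum.inl (Sum.inl i)) := fun i => le_join (by
      rw [Setoid.comap_rel, DS_rel]
      simp [ds])
    have a3 : ∀ i j, M (Sum.inl (Sum.inr i)) (Sum.inl (Sum.inr j)) := fun i j => le_join (by
      rw [Setoid.comap_rel, DS_rel]
      simp [ds])
    have a4 : ∀ x : I ⊕ I, M (Sum.map Sum.inl id x) (Sum.inl (Sum.inr p)) := by
      rintro (i | i)
      · exact M.trans' (a1 i) (a3 _ _)
      · exact M.trans' (a2 i) (M.trans' (a1 i) (a3 _ _))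
    intro x y _
    exact M.trans' (a4 x) (M.symm' (a4 y))

theorem KK_under_mono [Infinite X] {hQ : #Q ≤ #X} {hQ' : #Q' ≤ #X} (H : KK (F.under Q hQ) P)
    (hQQ : #Q' ≤ #Q) (hT : #T ≤ #P) : KK (F.under Q' hQ') T := by
  obtain ⟨i, hi⟩ := hQQ
  obtain ⟨j, hj⟩ := hT
  have h1 : F.R (DS Q (idS P)) (DS Q ⊥) := H
  have h2 := F.comap h1 (Sum.map i j) (Sum.map i j)
  have e : ∀ γ : Setoid (P ⊕ P), (DS Q γ).comap (Sum.map (Sum.map i j) (Sum.map i j)) =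
      DS Q' (γ.comap (Sum.map j j)) := by
    intro γ
    ext x y
    rw [Setoid.comap_rel, DS_rel, DS_rel]
    rcases x with (x | x) | (x | x) <;> rcases y with (y | y) | (y | y) <;>
      simp [ds, Setoid.comap_rel, hi.eq_iff]
  rw [e, e, comap_idS_of_injective hj, comap_bot_of_injective hj hj] at h2
  exact h2

theorem KK_under_option [Infinite X] {hQ : #Q ≤ #X} [Infinite Q] [Finite I]
    (H : KK (F.under Q hQ) I) (H' : KK (F.under Q hQ) PUnit) : KK (F.under Q hQ) (Option I) := by
  classical
  have hQI : #(Q ⊕ I) ≤ #Q := by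
    rw [← add_def]
    exact add_le_of_le (aleph0_le_mk Q) le_rfl ((lt_aleph0_of_finite I).le.trans (aleph0_le_mk Q))
  have H'' := KK_under_mono (hQ' := hQI.trans hQ) H' hQI le_rfl
  have h1 : F.R (DS Q (idS I)) (DS Q ⊥) := H
  have h2 : F.R (DS (Q ⊕ I) (idS PUnit)) (DS (Q ⊕ I) ⊥) := H''
  let S : Set ((Q ⊕ Option I) ⊕ (Q ⊕ Option I)) := {x | Sum.elim id id x ≠ Sum.inr none}
  let f : Q ⊕ Option I → Q ⊕ I := Sum.elim Sum.inl
    (fun o => o.elim (Sum.inl (Classical.arbitrary Q)) Sum.inr)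
  let g : Q ⊕ Option I → (Q ⊕ I) ⊕ PUnit := Sum.elim (fun q => Sum.inl (Sum.inl q))
    (fun o => o.elim (Sum.inr PUnit.unit) (fun i => Sum.inl (Sum.inr i)))
  have h3 := F.rep (F.comap h1 f f) S split_bot
  have h4 := F.comap h2 g g
  have e1 : idS (Q ⊕ Option I) = (DS (Q ⊕ I) (idS PUnit)).comap (Sum.map g g) := by
    rw [← DS_idS]
    ext x y
    change SS _ _ _ _ ↔ SS _ _ (ds _ _ _ (Sum.map g g x)) (ds _ _ _ (Sum.map g g y))
    rcases x with (x | - | x) | (x | - | x) <;> rcases y with (y | - | y) | (y | - | y) <;>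
      simp [g, ds]
  have e2 : (DS (Q ⊕ I) (⊥ : Setoid (PUnit ⊕ PUnit))).comap (Sum.map g g) =
      rep S ⊥ ((DS Q (idS I)).comap (Sum.map f f)) := by
    ext x y
    change SS _ _ (ds _ _ _ (Sum.map g g x)) (ds _ _ _ (Sum.map g g y)) ↔
      (x ∈ S ∧ y ∈ S ∧ SS _ _ (ds _ _ _ (Sum.map f f x)) (ds _ _ _ (Sum.map f f y))) ∨ _
    rcases x with (x | - | x) | (x | - | x) <;> rcases y with (y | - | y) | (y | - | y) <;>
      simp [g, f, S, ds]
  have e3 : rep S ⊥ ((DS Q (⊥ : Setoid (I ⊕ I))).comap (Sum.map f f)) = DS Q ⊥ := by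
    ext x y
    rw [rep_rel, Setoid.comap_rel, DS_rel, DS_rel]
    rcases x with (x | - | x) | (x | - | x) <;> rcases y with (y | - | y) | (y | - | y) <;>
      simp [f, S, ds]
  rw [KK, Fam.under_iff, DS_idS, e1, ← e3]
  rw [e2] at h4
  exact F.trans h4 h3

end Under

section Frame

variable {X : Type u} {F : Fam X} {Y Z P Q T : Type u}

theorem KK.top (H : KK F P) (hP : #P ≤ #X) : F.R (idS P) (SS ⊤ ⊤) := by
  have h1 := F.join hP hP H (σ := SS (⊥ : Setoid P) (⊤ : Setoid P)) (split_SS _ _)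
  have h2 := F.join hP hP H (σ := SS (⊤ : Setoid P) (⊥ : Setoid P)) (split_SS _ _)
  have e : ∀ p : P, ∀ K C : Setoid P, (K = ⊤ ∨ C = ⊤) → idS P ⊔ SS K C = ⊤ := by
    intro p K C hKC
    set M := idS P ⊔ SS K C
    have h : ∀ i, M (Sum.inl i) (Sum.inr i) := fun i => le_join (by simp)
    have h' : ∀ i j, M (Sum.inl i) (Sum.inl j) := by
      intro i j
      rcases hKC with rfl | rfl
      · exact le_join' (by simp)
      · exact M.trans' (h i) (M.trans' (le_join' (by simp)) (M.symm' (h j)))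
    have h'' : ∀ x, M x (Sum.inl p) := by
      rintro (i | i)
      · exact h' i p
      · exact M.trans' (M.symm' (h i)) (h' i p)
    rw [eq_top_iff]
    intro x y _
    exact M.trans' (h'' x) (M.symm' (h'' y))
  rcases isEmpty_or_nonempty P with hP | ⟨⟨p⟩⟩
  · convert F.refl _ using 1
    exact Setoid.ext fun x => isEmptyElim x
  rw [e p _ _ (Or.inr rfl), bot_sup_eq] at h1
  rw [e p _ _ (Or.inl rfl), bot_sup_eq] at h2
  have h3 := F.rep h1 (Set.range Sum.inl) (split_SS (⊤ : Setoid P) (⊤ : Setoid P))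
  have h4 := F.rep h2 (Set.range Sum.inr) (split_SS (⊤ : Setoid P) (⊤ : Setoid P))
  have h5 := F.rep h3 (Set.range Sum.inl) (split_bot)
  have e1 : rep (Set.range Sum.inl) (SS ⊤ ⊤) (⊤ : Setoid (P ⊕ P)) = SS ⊤ ⊤ := by
    ext x y
    rw [rep_rel]
    rcases x with x | x <;> rcases y with y | y <;> simp
  have e2 : rep (Set.range Sum.inr) (SS ⊤ ⊤) (⊤ : Setoid (P ⊕ P)) = SS ⊤ ⊤ := by
    ext x y
    rw [rep_rel]
    rcases x with x | x <;> rcases y with y | y <;> simp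
  have e3 : rep (Set.range Sum.inr) (SS ⊤ ⊤) (SS (⊤ : Setoid P) (⊥ : Setoid P)) = SS ⊤ ⊥ := by
    ext x y
    rw [rep_rel]
    rcases x with x | x <;> rcases y with y | y <;> simp
  have e4 : rep (Set.range Sum.inl) ⊥ (SS (⊤ : Setoid P) (⊤ : Setoid P)) = SS ⊤ ⊥ := by
    ext x y
    rw [rep_rel]
    rcases x with x | x <;> rcases y with y | y <;> simp
  have e5 : rep (Set.range Sum.inl) ⊥ (rep (Set.range Sum.inl) (SS ⊤ ⊤)
      (SS (⊥ : Setoid P) (⊤ : Setoid P))) = ⊥ := by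
    ext x y
    rw [rep_rel, rep_rel]
    rcases x with x | x <;> rcases y with y | y <;> simp
  rw [e2, e3] at h4
  rw [e1, e4, e5] at h5
  exact F.trans H (F.trans (F.symm h5) (F.symm h4))

variable [Infinite X] {hQ : #Q ≤ #X}

theorem KK.frame (H : KK (F.under Q hQ) P) (hP : #P ≤ #X) {γ : Setoid (Y ⊕ Z)} {S : Set (Y ⊕ Z)}
    (hS : ∀ x y, γ x y → (x ∈ S ↔ y ∈ S)) (hSP : #(blk γ '' S) ≤ #P) (hT : #(TR γ) ≤ #Q) :
    F.R γ (rep Sᶜ (SS ⊤ ⊤) γ) := by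
  classical
  rcases isEmpty_or_nonempty (Q ⊕ P) with hQP | ⟨⟨t₀⟩⟩
  · have hP : IsEmpty P := ⟨fun p => isEmptyElim (Sum.inr p : Q ⊕ P)⟩
    rw [mk_eq_zero P, nonpos_iff_eq_zero, mk_eq_zero_iff, Set.isEmpty_coe_sort,
      Set.image_eq_empty] at hSP
    subst hSP
    convert F.refl γ using 1
    ext x y
    simp [rep_rel]
  obtain ⟨j, hj⟩ := hSP
  obtain ⟨i, hi⟩ := hT
  have h1 : F.R (DS Q (idS P)) (DS Q (SS ⊤ ⊤)) := H.top hP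
  let f : Y ⊕ Z → Q ⊕ P := fun x => if hx : x ∈ S then Sum.inr (j ⟨_, x, hx, rfl⟩) else
    if hx' : blk γ x ∈ TR γ then Sum.inl (i ⟨_, hx'⟩) else t₀
  have hf : ∀ {x} (hx : x ∈ S), f x = Sum.inr (j ⟨_, x, hx, rfl⟩) := fun hx => dif_pos hx
  have hf' : ∀ {x} (_ : x ∉ S) (hx : blk γ x ∈ TR γ), f x = Sum.inl (i ⟨_, hx⟩) := fun hx hx' => by
    simp only [f, dif_neg hx, dif_pos hx']
  have hsame : ∀ {x y}, γ x y → (blk γ x ∈ TR γ ↔ blk γ y ∈ TR γ) := fun h => by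
    rw [blk_eq_iff.2 h]
  have h2 := F.rep (F.comap h1 (f ∘ Sum.inl) (f ∘ Sum.inr)) {x | x ∈ S ∨ blk γ x ∈ TR γ}
    (split_hat γ)
  have hhat : ∀ {x y}, blk γ x ∉ TR γ → (PartitionCongruences.hat γ x y ↔ γ x y) := by
    intro x y hx
    rcases x with x | x <;> rcases y with y | y
    · simp
    · simp only [hat_inl_inr, false_iff]
      exact fun h => hx (blk_inl_mem_TR.2 ⟨_, h⟩)
    · simp only [hat_inr_inl, false_iff]
      exact fun h => hx (blk_inr_mem_TR.2 ⟨_, γ.symm' h⟩)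
    · simp
  have hll : ∀ (β : Setoid (P ⊕ P)) {x y p p'}, f x = Sum.inl p → f y = Sum.inl p' →
      (DS Q β (Sum.map (f ∘ Sum.inl) (f ∘ Sum.inr) x) (Sum.map (f ∘ Sum.inl) (f ∘ Sum.inr) y) ↔
        p = p') := by
    intro β x y p p' hx hy
    rcases x with x | x <;> rcases y with y | y <;> simp [DS_rel, hx, hy, ds]
  have hlr : ∀ (β : Setoid (P ⊕ P)) {x y p p'}, f x = Sum.inl p → f y = Sum.inr p' →
      ¬ DS Q β (Sum.map (f ∘ Sum.inl) (f ∘ Sum.inr) x) (Sum.map (f ∘ Sum.inl) (f ∘ Sum.inr) y) := by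
    intro β x y p p' hx hy
    rcases x with x | x <;> rcases y with y | y <;> simp [DS_rel, hx, hy, ds]
  have hrr : ∀ {x y p p'}, f x = Sum.inr p → f y = Sum.inr p' →
      (DS Q (idS P) (Sum.map (f ∘ Sum.inl) (f ∘ Sum.inr) x)
        (Sum.map (f ∘ Sum.inl) (f ∘ Sum.inr) y) ↔ p = p') := by
    intro x y p p' hx hy
    rcases x with x | x <;> rcases y with y | y <;> simp [DS_rel, hx, hy, ds]
  have hrr' : ∀ {x y p p'}, f x = Sum.inr p → f y = Sum.inr p' →
      (DS Q (SS ⊤ ⊤) (Sum.map (f ∘ Sum.inl) (f ∘ Sum.inr) x)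
        (Sum.map (f ∘ Sum.inl) (f ∘ Sum.inr) y) ↔ SS (⊤ : Setoid Y) (⊤ : Setoid Z) x y) := by
    intro x y p p' hx hy
    rcases x with x | x <;> rcases y with y | y <;> simp [DS_rel, hx, hy, ds]
  have key : ∀ x y, (rep {x | x ∈ S ∨ blk γ x ∈ TR γ} (PartitionCongruences.hat γ)
      ((DS Q (idS P)).comap (Sum.map (f ∘ Sum.inl) (f ∘ Sum.inr))) x y ↔ γ x y) ∧
      (rep {x | x ∈ S ∨ blk γ x ∈ TR γ} (PartitionCongruences.hat γ)
      ((DS Q (SS ⊤ ⊤)).comap (Sum.map (f ∘ Sum.inl) (f ∘ Sum.inr))) x y ↔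
        rep Sᶜ (SS ⊤ ⊤) γ x y) := by
    intro x y
    simp only [rep_rel, Set.mem_ofPred_eq, Setoid.comap_rel, Set.mem_compl_iff, not_or, not_not]
    have hSxy := hS x y
    have hTxy := @hsame x y
    by_cases hx : x ∈ S
    · by_cases hy : y ∈ S
      · rw [hrr (hf hx) (hf hy), hrr' (hf hx) (hf hy)]
        have : j ⟨blk γ x, x, hx, rfl⟩ = j ⟨blk γ y, y, hy, rfl⟩ ↔ γ x y :=
          hj.eq_iff.trans (Subtype.ext_iff.trans blk_eq_iff)
        simp [hx, hy, this]
      · have h3 : ¬ γ x y := by tauto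
        by_cases hy' : blk γ y ∈ TR γ
        · have := fun β => mt (Setoid.symm' _) (hlr β (hf' hy hy') (hf hx))
          simp [hx, hy, hy', h3, this]
        · simp [hx, hy, hy', h3]
    · by_cases hy : y ∈ S
      · have h3 : ¬ γ x y := by tauto
        by_cases hx' : blk γ x ∈ TR γ
        · have := fun β => hlr β (hf' hx hx') (hf hy)
          simp [hx, hy, hx', h3, this]
        · simp [hx, hy, hx', h3]
      · by_cases hx' : blk γ x ∈ TR γ
        · by_cases hy' : blk γ y ∈ TR γ
          · have := fun β => hll β (hf' hx hx') (hf' hy hy')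
            simp [hx, hy, hx', hy', this, hi.eq_iff, blk_eq_iff]
          · have h3 : ¬ γ x y := by tauto
            simp [hx, hy, hx', hy', h3]
        · have := @hhat x y hx'
          simp only [hx, hy, hx', false_or, false_and, or_false, not_false_eq_true, true_and, this]
          tauto
  convert h2 using 1
  · exact (Setoid.ext fun x y => (key x y).1).symm
  · exact (Setoid.ext fun x y => (key x y).2).symm

theorem KK.rel_of_card_le (H : KK (F.under Q hQ) P) (hP : #P ≤ #X) {α β : Setoid (Y ⊕ Z)}
    (hα : #(TR α) ≤ #Q) (hβ : #(TR β) ≤ #Q)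
    (h : #(α.classes ∆ β.classes : Set (Set (Y ⊕ Z))) ≤ #P) : F.R α β := by
  have h1 := H.frame hP (γ := α) (S := {x | blk α x ≠ blk β x}) (fun x y => mem_bad_iff)
    ((mk_le_mk_of_subset (blk_image_bad_subset.trans Set.subset_union_left)).trans h) hα
  have h2 := H.frame hP (γ := β) (S := {x | blk β x ≠ blk α x}) (fun x y => mem_bad_iff)
    ((mk_le_mk_of_subset (blk_image_bad_subset.trans Set.subset_union_right)).trans h) hβ
  refine F.trans h1 (F.symm ?_)
  convert h2 using 1
  have e : {x | blk α x ≠ blk β x} = {x | blk β x ≠ blk α x} := by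
    ext x
    exact ne_comm
  rw [← e]
  ext x y
  rw [rep_rel, rep_rel]
  refine or_congr_left (and_congr_right fun hx => and_congr_right fun _ => ?_)
  simp only [Set.mem_compl_iff, Set.mem_ofPred_eq, not_not] at hx
  rw [← mem_blk, hx, mem_blk]

theorem KK_under_of_finite [Infinite Q] [Finite P] (H : KK (F.under Q hQ) PUnit) :
    KK (F.under Q hQ) P := by
  induction P using Finite.induction_empty_option with
  | of_equiv e h => exact h.transfer (mk_congr e).ge
  | h_empty => exact KK.of_isEmpty
  | h_option h => exact KK_under_option h H

theorem KK.of_under (H : KK (F.under Q hQ) P) : KK F P := by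
  have h1 : F.R (DS Q (idS P)) (DS Q ⊥) := H
  have h2 := F.comap h1 Sum.inr Sum.inr
  rw [KK]
  convert h2 using 1
  · ext x y
    change _ ↔ SS ⊥ (idS P) (ds Q P P (Sum.map Sum.inr Sum.inr x)) (ds Q P P _)
    rcases x with x | x <;> rcases y with y | y <;> simp [ds]
  · ext x y
    change _ ↔ SS ⊥ ⊥ (ds Q P P (Sum.map Sum.inr Sum.inr x)) (ds Q P P _)
    rcases x with x | x <;> rcases y with y | y <;> simp [ds]

theorem KK.under (H : KK F T) (h : #(Q ⊕ P) ≤ #T) : KK (F.under Q hQ) P := by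
  have h1 : KK F (Q ⊕ P) := H.transfer h
  have hT : #(TR (DS Q (⊥ : Setoid (P ⊕ P)))) ≤ #T := by
    refine (card_TR_le (T := Q) (fun q => Sum.inl (Sum.inl q)) ?_).trans
      (le_trans (mk_le_of_injective Sum.inl_injective) h)
    rintro _ ⟨y, z, hyz, rfl⟩
    rcases y with q | p
    · exact ⟨q, rfl⟩
    · exfalso
      rw [DS_rel] at hyz
      rcases z with z | z <;> simp [ds] at hyz
  have h2 := H.hat hT
  rw [KK, Fam.under_iff, DS_idS]
  refine F.trans h1 (F.symm ?_)
  convert h2 using 1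
  ext x y
  rw [bot_rel]
  rcases x with (x | x) | (x | x) <;> rcases y with (y | y) | (y | y) <;>
    simp [DS_rel, ds]

theorem KK_under_of_flip (H : KK (F.flip.under Q hQ) P) : KK (F.under Q hQ) P := by
  have h1 : F.flip.R (DS Q (idS P)) (DS Q ⊥) := H
  have h2 : F.R ((DS Q (idS P)).comap Sum.swap) ((DS Q ⊥).comap Sum.swap) := h1
  rw [KK, Fam.under_iff]
  convert h2 using 1
  · ext x y
    change SS ⊥ (idS P) (ds Q P P x) _ ↔ SS ⊥ (idS P) (ds Q P P x.swap) (ds Q P P y.swap)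
    rcases x with (x | x) | (x | x) <;> rcases y with (y | y) | (y | y) <;> simp [ds]
  · ext x y
    change SS ⊥ ⊥ (ds Q P P x) _ ↔ SS ⊥ ⊥ (ds Q P P x.swap) (ds Q P P y.swap)
    rcases x with (x | x) | (x | x) <;> rcases y with (y | y) | (y | y) <;> simp [ds]

end Frame

section Blocks

variable {Y Z : Type u}

theorem blk_eq_image_inl {x : Setoid (Y ⊕ Z)} {a : Y} (h : blk x (Sum.inl a) ∉ TR x) :
    blk x (Sum.inl a) = Sum.inl '' blk (x.comap Sum.inl) a := by
  rw [blk_inl_mem_TR] at h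
  push Not at h
  ext (z | z)
  · simp [mem_blk, Setoid.comap_rel]
  · simp [mem_blk, h z]

theorem blk_eq_image_inr {x : Setoid (Y ⊕ Z)} {a : Z} (h : blk x (Sum.inr a) ∉ TR x) :
    blk x (Sum.inr a) = Sum.inr '' blk (x.comap Sum.inr) a := by
  rw [blk_inr_mem_TR] at h
  push Not at h
  ext (z | z)
  · simpa [mem_blk] using fun h' => h z (x.symm' h')
  · simp [mem_blk, Setoid.comap_rel]

theorem eq_blk_of_mem {A : Type*} {K : Setoid A} {B : Set A} {x : A} (h : B ∈ K.classes)
    (hx : x ∈ B) : B = blk K x := by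
  obtain ⟨y, rfl⟩ := mem_classes_blk.1 h
  exact blk_eq_iff.2 hx

theorem TR_subset_classes {x : Setoid (Y ⊕ Z)} : TR x ⊆ x.classes := by
  rintro _ ⟨a, z, -, rfl⟩
  exact mem_classes_blk.2 ⟨_, rfl⟩

theorem classes_diff_subset {x y : Setoid (Y ⊕ Z)} : x.classes \ y.classes ⊆
    (TR x \ TR y) ∪ ((fun T => Sum.inl '' (Sum.inl ⁻¹' T)) '' (TR y \ TR x) ∪
      ((fun T => Sum.inr '' (Sum.inr ⁻¹' T)) '' (TR y \ TR x) ∪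
        ((Set.image Sum.inl) '' ((x.comap Sum.inl).classes \ (y.comap Sum.inl).classes) ∪
          (Set.image Sum.inr) '' ((x.comap Sum.inr).classes \ (y.comap Sum.inr).classes)))) := by
  rintro B ⟨hB, hB'⟩
  by_cases hT : B ∈ TR x
  · exact Or.inl ⟨hT, fun h => hB' (TR_subset_classes h)⟩
  refine Or.inr ?_
  obtain ⟨z, rfl⟩ := mem_classes_blk.1 hB
  rcases z with a | a
  · by_cases hy : blk (x.comap Sum.inl) a ∈ (y.comap Sum.inl).classes
    · refine Or.inl ⟨blk y (Sum.inl a), ⟨?_, ?_⟩, ?_⟩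
      all_goals
        have e := eq_blk_of_mem hy (mem_blk.2 (Setoid.refl' _ a))
        have e' := blk_eq_image_inl hT
      · by_contra h
        refine hB' (mem_classes_blk.2 ⟨Sum.inl a, ?_⟩)
        rw [e', blk_eq_image_inl h, e]
      · intro h
        refine hB' ?_
        rw [eq_blk_of_mem (TR_subset_classes h) (mem_blk.2 (Setoid.refl' _ _))] at h
        exact absurd h hT
      · rw [e', e]
        rfl
    · exact Or.inr (Or.inr (Or.inl ⟨_, ⟨mem_classes_blk.2 ⟨a, rfl⟩, hy⟩,
        (blk_eq_image_inl hT).symm⟩))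
  · by_cases hy : blk (x.comap Sum.inr) a ∈ (y.comap Sum.inr).classes
    · refine Or.inr (Or.inl ⟨blk y (Sum.inr a), ⟨?_, ?_⟩, ?_⟩)
      all_goals
        have e := eq_blk_of_mem hy (mem_blk.2 (Setoid.refl' _ a))
        have e' := blk_eq_image_inr hT
      · by_contra h
        refine hB' (mem_classes_blk.2 ⟨Sum.inr a, ?_⟩)
        rw [e', blk_eq_image_inr h, e]
      · intro h
        rw [eq_blk_of_mem (TR_subset_classes h) (mem_blk.2 (Setoid.refl' _ _))] at h
        exact absurd h hT
      · rw [e', e]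
        rfl
    · exact Or.inr (Or.inr (Or.inr ⟨_, ⟨mem_classes_blk.2 ⟨a, rfl⟩, hy⟩,
        (blk_eq_image_inr hT).symm⟩))

theorem card_classes_diff {x y : Setoid (Y ⊕ Z)} {ξ : Cardinal.{u}} (hξ : ξ = 1 ∨ ℵ₀ ≤ ξ)
    (h : ξ ≤ #(x.classes \ y.classes : Set (Set (Y ⊕ Z)))) :
    ξ ≤ #(TR x \ TR y : Set (Set (Y ⊕ Z))) ∨ ξ ≤ #(TR y \ TR x : Set (Set (Y ⊕ Z))) ∨
      ξ ≤ #((x.comap Sum.inl).classes \ (y.comap Sum.inl).classes : Set (Set Y)) ∨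
      ξ ≤ #((x.comap Sum.inr).classes \ (y.comap Sum.inr).classes : Set (Set Z)) := by
  rcases le_or_le_of_le_union hξ (h.trans (mk_le_mk_of_subset classes_diff_subset)) with h | h
  · exact Or.inl h
  rcases le_or_le_of_le_union hξ h with h | h
  · exact Or.inr (Or.inl (h.trans mk_image_le))
  rcases le_or_le_of_le_union hξ h with h | h
  · exact Or.inr (Or.inl (h.trans mk_image_le))
  rcases le_or_le_of_le_union hξ h with h | h
  · exact Or.inr (Or.inr (Or.inl (h.trans mk_image_le)))
  · exact Or.inr (Or.inr (Or.inr (h.trans mk_image_le)))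

theorem card_classes_symmDiff {x y : Setoid (Y ⊕ Z)} {ξ : Cardinal.{u}} (hξ : ξ = 1 ∨ ℵ₀ ≤ ξ)
    (h : ξ ≤ #(x.classes ∆ y.classes : Set (Set (Y ⊕ Z)))) :
    ξ ≤ #(TR x \ TR y : Set (Set (Y ⊕ Z))) ∨ ξ ≤ #(TR y \ TR x : Set (Set (Y ⊕ Z))) ∨
      ξ ≤ #((x.comap Sum.inl).classes ∆ (y.comap Sum.inl).classes : Set (Set Y)) ∨
      ξ ≤ #((x.comap Sum.inr).classes ∆ (y.comap Sum.inr).classes : Set (Set Z)) := by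
  rcases le_or_le_of_le_union hξ h with h | h <;>
    rcases card_classes_diff hξ h with h | h | h | h
  · exact Or.inl h
  · exact Or.inr (Or.inl h)
  · exact Or.inr (Or.inr (Or.inl (h.trans (mk_le_mk_of_subset Set.subset_union_left))))
  · exact Or.inr (Or.inr (Or.inr (h.trans (mk_le_mk_of_subset Set.subset_union_left))))
  · exact Or.inr (Or.inl h)
  · exact Or.inl h
  · exact Or.inr (Or.inr (Or.inl (h.trans (mk_le_mk_of_subset Set.subset_union_right))))
  · exact Or.inr (Or.inr (Or.inr (h.trans (mk_le_mk_of_subset Set.subset_union_right))))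

end Blocks

section InfiniteRank

variable {X : Type u} [Infinite X] {F : Fam X} {Y Z P Q : Type u} {hQ : #Q ≤ #X}

theorem KK_under_of_ker (hY : #Y ≤ #X) [Nonempty Z] [Nonempty P] {α β : Setoid (Y ⊕ Z)}
    (H : F.R α β) {a : Q ⊕ Option P → Y} {b : Q ⊕ Option P → Z} (hα : Ind α a b) (hβ : Ind β a b)
    (hc : ∀ i x, α (Sum.inl (a i)) x ↔ β (Sum.inl (a i)) x) (hξ : #P = 1 ∨ ℵ₀ ≤ #P)
    (hQP : #(Q ⊕ Option P) ≤ #X)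
    (h : #P ≤ #((α.comap Sum.inl).classes ∆ (β.comap Sum.inl).classes : Set (Set Y))) :
    KK (F.under Q hQ) P := by
  have h1 : UU (F.under (Q ⊕ Option P) hQP) (Option P) :=
    UU_under_of_ker hY H hα hβ hc hξ h (mk_option).le
  have h2 : KK (F.under Q hQ) (Option P) :=
    KK_under_of_UU ((mk_le_of_injective Sum.inr_injective).trans hQP) h1
  exact h2.transfer (mk_le_of_injective (Option.some_injective P))

theorem KK_under_of_card_classes [Infinite Q] (hY : #Y ≤ #X) (hZ : #Z ≤ #X)
    {α β : Setoid (Y ⊕ Z)} (H : F.R α β) (hα : #Q ≤ #(TR α)) (hP : #P ≤ #Q)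
    (hξ : #P = 1 ∨ ℵ₀ ≤ #P) (h : #P ≤ #(α.classes ∆ β.classes : Set (Set (Y ⊕ Z)))) :
    KK (F.under Q hQ) P := by
  have hP0 : Nonempty P := by
    rw [← mk_ne_zero_iff]
    rintro e
    rw [e] at hξ
    rcases hξ with h | h
    · exact zero_ne_one h
    · exact absurd h (not_le.2 aleph0_pos)
  have hQQ : ℵ₀ ≤ #Q := aleph0_le_mk Q
  have hsplit : #Q ≤ #((TR α \ TR β) ∪ (TR α ∩ TR β) : Set (Set (Y ⊕ Z))) := by
    rwa [Set.sdiff_union_inter]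
  rcases le_or_le_of_le_union (Or.inr hQQ) hsplit with h' | h'
  · have h1 : KK (F.under PEmpty (by simp)) Q :=
      KK_under_of_card_diff (Q := PEmpty) H (f := PEmpty.elim) (fun i => i.elim) (fun i => i.elim)
        (fun i => i.elim) (Or.inr hQQ) h'
    refine h1.of_under.under ?_
    rw [← add_def]
    exact add_le_of_le hQQ le_rfl hP
  · have hle : #(Q ⊕ Option P) ≤ #Q := by
      rw [← add_def, mk_option]
      exact add_le_of_le hQQ le_rfl (add_le_of_le hQQ hP (one_le_aleph0.trans hQQ))
    obtain ⟨g, hg⟩ := hle.trans h'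
    have hf : Function.Injective (fun i => (g i : Set (Y ⊕ Z))) := Subtype.val_injective.comp hg
    have hfα : ∀ i, (g i : Set (Y ⊕ Z)) ∈ TR α := fun i => (g i).2.1
    have hfβ : ∀ i, (g i : Set (Y ⊕ Z)) ∈ TR β := fun i => (g i).2.2
    rcases card_classes_symmDiff hξ h with h | h | h | h
    · exact KK_under_of_card_diff H (f := fun q => g (Sum.inl q)) (hf.comp Sum.inl_injective)
        (fun i => hfα _) (fun i => hfβ _) hξ h
    · exact KK_under_of_card_diff (F.symm H) (f := fun q => g (Sum.inl q))
        (hf.comp Sum.inl_injective) (fun i => hfβ _) (fun i => hfα _) hξ h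
    · obtain ⟨a, b, h1, h2, -, hc⟩ := exists_common_points hf hfα hfβ
      have : Nonempty Z := ⟨b (Sum.inr none)⟩
      exact KK_under_of_ker hY H h1 h2 hc hξ (hle.trans hQ) h
    · obtain ⟨a, b, h1, h2, -, hc⟩ := exists_common_points hf hfα hfβ
      have : Nonempty Y := ⟨a (Sum.inr none)⟩
      have aux : ∀ {γ : Setoid (Y ⊕ Z)}, Ind γ a b → Ind (γ.comap Sum.swap) b a := fun {γ} hγ =>
        ⟨fun i => γ.symm' (hγ.1 i), fun i j hij =>
          hγ.2 i j (γ.trans' (hγ.1 i) (γ.trans' hij (γ.symm' (hγ.1 j))))⟩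
      refine KK_under_of_flip (KK_under_of_ker hZ (Fam.flip_swap.2 H) (aux h1) (aux h2)
        (fun i x => ?_) hξ (hle.trans hQ) h)
      have e1 := rel_left_of_rel (b := x.swap) (h1.1 i)
      have e2 := rel_left_of_rel (b := x.swap) (h2.1 i)
      exact e1.symm.trans ((hc i _).trans e2)

end InfiniteRank

section FiniteRank

variable {X : Type u} {F : Fam X} {Y Z Q : Type u}

theorem Ind.symm {γ : Setoid (Y ⊕ Z)} {a : Q → Y} {b : Q → Z} (h : Ind γ a b) :
    Ind (γ.comap Sum.swap) b a :=
  ⟨fun i => γ.symm' (h.1 i), fun i j hij =>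
    h.2 i j (γ.trans' (h.1 i) (γ.trans' hij (γ.symm' (h.1 j))))⟩

theorem Ind.exists_index [Nontrivial Q] {γ : Setoid (Y ⊕ Z)} {a : Q → Y} {b : Q → Z}
    (h : Ind γ a b) {x y : Y} (hxy : ¬ γ (Sum.inl x) (Sum.inl y)) :
    ∃ i j, i ≠ j ∧ (∀ k, γ (Sum.inl (a k)) (Sum.inl x) → k = i) ∧
      ∀ k, γ (Sum.inl (a k)) (Sum.inl y) → k = j := by
  have huniq : ∀ {w k l}, γ (Sum.inl (a k)) w → γ (Sum.inl (a l)) w → k = l := fun h1 h2 =>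
    h.2 _ _ (γ.trans' h1 (γ.symm' h2))
  by_cases hx : ∃ k, γ (Sum.inl (a k)) (Sum.inl x)
  · obtain ⟨i, hi⟩ := hx
    by_cases hy : ∃ k, γ (Sum.inl (a k)) (Sum.inl y)
    · obtain ⟨j, hj⟩ := hy
      refine ⟨i, j, ?_, fun k hk => huniq hk hi, fun k hk => huniq hk hj⟩
      rintro rfl
      exact hxy (γ.trans' (γ.symm' hi) hj)
    · obtain ⟨j, hj⟩ := exists_ne i
      exact ⟨i, j, hj.symm, fun k hk => huniq hk hi, fun k hk => absurd ⟨k, hk⟩ hy⟩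
  · by_cases hy : ∃ k, γ (Sum.inl (a k)) (Sum.inl y)
    · obtain ⟨j, hj⟩ := hy
      obtain ⟨i, hi⟩ := exists_ne j
      exact ⟨i, j, hi, fun k hk => absurd ⟨k, hk⟩ hx, fun k hk => huniq hk hj⟩
    · obtain ⟨i, j, hij⟩ := exists_pair_ne Q
      exact ⟨i, j, hij, fun k hk => absurd ⟨k, hk⟩ hx, fun k hk => absurd ⟨k, hk⟩ hy⟩

theorem KK_of_rel_of_not_rel [Finite Q] [Nontrivial Q] (hY : #Y ≤ #X) (hZ : #Z ≤ #X)
    {α β : Setoid (Y ⊕ Z)} (H : F.R α β) {a : Q → Y} {b : Q → Z} (hα : Ind α a b) {x y : Y}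
    (hxy : ¬ α (Sum.inl x) (Sum.inl y)) (hxy' : β (Sum.inl x) (Sum.inl y)) : KK F Q := by
  classical
  obtain ⟨i, j, hij, hi, hj⟩ := hα.exists_index hxy
  let K : Setoid Y := Relation.EqvGen.setoid fun u v => (u = x ∧ v = a i) ∨ (u = y ∧ v = a j)
  have H1 := F.comap (F.join hY hZ H (σ := SS K ⊥) (split_SS _ _)) a b
  let φ : Y ⊕ Z → Option Q := fun w =>
    if h : ∃ k, α (Sum.inl (a k)) w then some h.choose else
      if α (Sum.inl x) w then some i else if α (Sum.inl y) w then some j else none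
  have hφ : ∀ {k w}, α (Sum.inl (a k)) w → φ w = some k := by
    intro k w h
    have h' : ∃ k, α (Sum.inl (a k)) w := ⟨k, h⟩
    simp only [φ, dif_pos h', Option.some.injEq]
    exact hα.2 _ _ (α.trans' h'.choose_spec (α.symm' h))
  have hx : φ (Sum.inl x) = some i := by
    by_cases h : ∃ k, α (Sum.inl (a k)) (Sum.inl x)
    · obtain ⟨k, hk⟩ := h
      rw [hφ hk, hi k hk]
    · simp [φ, dif_neg h]
  have hy : φ (Sum.inl y) = some j := by
    by_cases h : ∃ k, α (Sum.inl (a k)) (Sum.inl y)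
    · obtain ⟨k, hk⟩ := h
      rw [hφ hk, hj k hk]
    · simp [φ, dif_neg h, hxy]
  have hle : α ⊔ SS K ⊥ ≤ Setoid.ker φ := by
    refine sup_le (fun u v huv => ?_) (fun u v huv => ?_)
    · rw [Setoid.ker_def]
      have : ∀ w, α w u ↔ α w v := fun w => rel_right_of_rel huv
      simp only [φ, this]
    · have hK : K ≤ (Setoid.ker φ).comap Sum.inl := by
        refine Setoid.eqvGen_le ?_
        rintro u v (⟨rfl, rfl⟩ | ⟨rfl, rfl⟩)
        · exact hx.trans (hφ (α.refl' _)).symm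
        · exact hy.trans (hφ (α.refl' _)).symm
      rcases u with u | u <;> rcases v with v | v <;> simp at huv
      · exact hK huv
      · rw [huv]
  have e : (α ⊔ SS K ⊥).comap (Sum.map a b) = idS Q := by
    ext u v
    have hm : ∀ w : Q ⊕ Q, φ (Sum.map a b w) = some (Sum.elim id id w) := by
      rintro (w | w)
      · exact hφ (α.refl' _)
      · exact hφ (hα.1 w)
    constructor
    · intro h
      have h' : φ _ = φ _ := hle h
      rw [hm, hm] at h'
      exact Option.some.inj h'
    · intro h
      rw [← hα.comap_eq] at h
      exact le_join h
  rw [e] at H1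
  refine (KK_or_perm H1).resolve_right ?_
  rintro ⟨σ, hσ⟩
  refine hij (σ.injective ?_)
  change permS σ (Sum.inl i) (Sum.inl j)
  rw [← hσ]
  set M := β ⊔ SS K ⊥
  have hxi : M (Sum.inl x) (Sum.inl (a i)) :=
    le_join' ((SS_inl_inl _ _).2 (.rel _ _ (Or.inl ⟨rfl, rfl⟩)))
  have hyj : M (Sum.inl y) (Sum.inl (a j)) :=
    le_join' ((SS_inl_inl _ _).2 (.rel _ _ (Or.inr ⟨rfl, rfl⟩)))
  exact M.trans' (M.symm' hxi) (M.trans' (le_join hxy') hyj)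

theorem exists_perm_of_not_KK [Finite Q] [Nontrivial Q] (hY : #Y ≤ #X) (hZ : #Z ≤ #X)
    {α β : Setoid (Y ⊕ Z)} (H : F.R α β) {a : Q → Y} {b : Q → Z} (hα : Ind α a b)
    (hα' : ∀ x z, α (Sum.inl x) (Sum.inr z) → ∃ i, α (Sum.inl (a i)) (Sum.inl x))
    (hβ : #(TR β) ≤ #Q) (hK : ¬ KK F Q) :
    (∀ x y, α (Sum.inl x) (Sum.inl y) ↔ β (Sum.inl x) (Sum.inl y)) ∧
      (∀ x y, α (Sum.inr x) (Sum.inr y) ↔ β (Sum.inr x) (Sum.inr y)) ∧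
      ∃ σ : Equiv.Perm Q, β.comap (Sum.map a b) = permS σ ∧
        ∀ E : Fam X, E.R (idS Q) (permS σ) → E.R α β := by
  classical
  have H1 := F.comap H a b
  rw [hα.comap_eq] at H1
  obtain ⟨σ, hσ⟩ := (KK_or_perm H1).resolve_left hK
  have hab : ∀ i j, β (Sum.inl (a i)) (Sum.inr (b j)) ↔ σ i = j := fun i j => by
    change β.comap (Sum.map a b) (Sum.inl i) (Sum.inr j) ↔ _
    rw [hσ]
    rfl
  have haa : ∀ i j, β (Sum.inl (a i)) (Sum.inl (a j)) → i = j := fun i j h => by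
    change β.comap (Sum.map a b) (Sum.inl i) (Sum.inl j) at h
    rw [hσ] at h
    exact σ.injective h
  have hβab : Ind β a (b ∘ σ) := ⟨fun i => (hab _ _).2 rfl, haa⟩
  have hl : ∀ x y, α (Sum.inl x) (Sum.inl y) ↔ β (Sum.inl x) (Sum.inl y) := fun x y =>
    ⟨fun h => by_contra fun h' => hK (KK_of_rel_of_not_rel hY hZ (F.symm H) hβab h' h),
      fun h => by_contra fun h' => hK (KK_of_rel_of_not_rel hY hZ H hα h' h)⟩
  have Hs : F.flip.R (α.comap Sum.swap) (β.comap Sum.swap) := Fam.flip_swap.2 H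
  have hr : ∀ x y, α (Sum.inr x) (Sum.inr y) ↔ β (Sum.inr x) (Sum.inr y) := fun x y =>
    ⟨fun h => by_contra fun h' =>
      hK (KK_of_rel_of_not_rel hZ hY (F.flip.symm Hs) hβab.symm h' h).of_flip,
      fun h => by_contra fun h' => hK (KK_of_rel_of_not_rel hZ hY Hs hα.symm h' h).of_flip⟩
  have hβ' : ∀ x z, β (Sum.inl x) (Sum.inr z) → ∃ i, α (Sum.inl (a i)) (Sum.inl x) := by
    intro x z h
    by_contra! hn
    have h1 : #(Option Q) ≤ #(TR β) := by
      refine le_card_TR (α := β) (fun o => o.elim (Sum.inl x) fun i => Sum.inl (a i)) ?_ ?_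
      · rintro (_ | i)
        · exact blk_inl_mem_TR.2 ⟨z, h⟩
        · exact blk_inl_mem_TR.2 ⟨_, hβab.1 i⟩
      · rintro (_ | i) (_ | j) hij
        · rfl
        · exact absurd ((hl _ _).2 (β.symm' hij)) (hn j)
        · exact absurd ((hl _ _).2 hij) (hn i)
        · rw [haa i j hij]
    have h2 := h1.trans hβ
    have := Fintype.ofFinite Q
    rw [mk_fintype, mk_fintype, Fintype.card_option, Nat.cast_le] at h2
    exact absurd h2 (by simp)
  refine ⟨hl, hr, σ, hσ, fun E hE => ?_⟩
  let S : Set (Y ⊕ Z) := {w | ∃ i, α (Sum.inl (a i)) w}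
  obtain ⟨i₀⟩ : Nonempty Q := inferInstance
  let f : Y ⊕ Z → Q := fun w => if h : ∃ i, α (Sum.inl (a i)) w then h.choose else i₀
  have hf : ∀ {w}, w ∈ S → α (Sum.inl (a (f w))) w := fun {w} hw => by
    have hw' : ∃ i, α (Sum.inl (a i)) w := hw
    simp only [f, dif_pos hw']
    exact hw'.choose_spec
  have H2 := E.rep (E.comap hE (f ∘ Sum.inl) (f ∘ Sum.inr)) S (split_hat α)
  have hff : ∀ {w w'}, w ∈ S → w' ∈ S → (f w = f w' ↔ α w w') := fun {w w'} hw hw' =>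
    ⟨fun h => α.trans' (α.symm' (hf hw)) (h ▸ hf hw'),
      fun h => hα.2 _ _ (α.trans' (hf hw) (α.trans' h (α.symm' (hf hw'))))⟩
  have hSα : ∀ {w w'}, α w w' → (w ∈ S ↔ w' ∈ S) := fun h =>
    exists_congr fun i => rel_right_of_rel h
  have hlr : ∀ {x z}, Sum.inl x ∈ S → Sum.inr z ∈ S →
      (σ (f (Sum.inl x)) = f (Sum.inr z) ↔ β (Sum.inl x) (Sum.inr z)) := fun {x z} hx hz => by
    rw [← hab]
    have h1 := (hl _ _).1 (hf hx)
    have h2 := (hr _ _).1 (α.trans' (α.symm' (hα.1 _)) (hf hz))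
    exact (rel_left_of_rel h1).trans (rel_right_of_rel h2)
  have hSβ : ∀ {x z}, β (Sum.inl x) (Sum.inr z) → Sum.inl x ∈ S ∧ Sum.inr z ∈ S :=
      fun {x z} h => by
    obtain ⟨i, hi⟩ := hβ' _ _ h
    refine ⟨⟨i, hi⟩, σ i, ?_⟩
    refine α.trans' (hα.1 _) ((hr _ _).2 (β.trans' (β.symm' ((hab i _).2 rfl)) ?_))
    exact β.trans' ((hl _ _).1 hi) h
  have hSα' : ∀ {x z}, α (Sum.inl x) (Sum.inr z) → Sum.inl x ∈ S := fun h => hα' _ _ h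
  have key : ∀ w w', (α w w' ↔ rep S (hat α)
      ((idS Q).comap (Sum.map (f ∘ Sum.inl) (f ∘ Sum.inr))) w w') ∧ (β w w' ↔ rep S (hat α)
      ((permS σ).comap (Sum.map (f ∘ Sum.inl) (f ∘ Sum.inr))) w w') := by
    have aux : ∀ x z, (α (Sum.inl x) (Sum.inr z) ↔ rep S (hat α)
      ((idS Q).comap (Sum.map (f ∘ Sum.inl) (f ∘ Sum.inr))) (Sum.inl x) (Sum.inr z)) ∧
      (β (Sum.inl x) (Sum.inr z) ↔ rep S (hat α)
      ((permS σ).comap (Sum.map (f ∘ Sum.inl) (f ∘ Sum.inr))) (Sum.inl x) (Sum.inr z)) := by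
      intro x z
      constructor
      · rw [rep_rel]
        constructor
        · intro h
          have h1 := hSα' h
          have h2 := (hSα h).1 h1
          exact Or.inl ⟨h1, h2, (hff h1 h2).2 h⟩
        · rintro (⟨h1, h2, h⟩ | ⟨h1, h2, h⟩)
          · exact (hff h1 h2).1 h
          · simp at h
      · rw [rep_rel]
        constructor
        · intro h
          obtain ⟨h1, h2⟩ := hSβ h
          exact Or.inl ⟨h1, h2, (hlr h1 h2).2 h⟩
        · rintro (⟨h1, h2, h⟩ | ⟨h1, h2, h⟩)
          · exact (hlr h1 h2).1 h
          · simp at h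
    have aux' : ∀ w w', (Sum.isLeft w = Sum.isLeft w') → ∀ ρ : Setoid (Q ⊕ Q),
        ((w ∈ S → w' ∈ S → (α w w' ↔ ρ.comap (Sum.map (f ∘ Sum.inl) (f ∘ Sum.inr)) w w'))) →
        (α w w' ↔ rep S (hat α) (ρ.comap (Sum.map (f ∘ Sum.inl) (f ∘ Sum.inr))) w w') := by
      intro w w' hww ρ hρ
      have h1 : hat α w w' ↔ α w w' := by
        rcases w with w | w <;> rcases w' with w' | w' <;> simp at hww ⊢
      have h2 := @hSα w w'
      rw [rep_rel, h1]
      tauto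
    rintro (x | x) (y | y)
    · refine ⟨aux' _ _ (by rfl) _ fun hx hy => (hff hx hy).symm, ?_⟩
      rw [← hl]
      exact aux' _ _ (by rfl) _ fun hx hy => (hff hx hy).symm.trans σ.injective.eq_iff.symm
    · exact aux x y
    · rw [Setoid.comm' α, Setoid.comm' β, Setoid.comm' (rep _ _ _),
        Setoid.comm' (rep _ _ (Setoid.comap _ (permS σ)))]
      exact aux y x
    · refine ⟨aux' _ _ (by rfl) _ fun hx hy => (hff hx hy).symm, ?_⟩
      rw [← hr]
      exact aux' _ _ (by rfl) _ fun hx hy => (hff hx hy).symm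
  convert H2 using 1
  · exact Setoid.ext fun w w' => (key w w').1
  · exact Setoid.ext fun w w' => (key w w').2

end FiniteRank

section NormalSubgroups

open Equiv

theorem mem_of_normal {G : Type*} [Group G] {N : Subgroup G} [hN : N.Normal] {x y g h : G}
    (hx : x ∈ N) (e : y = x * (g * x * g⁻¹) ∨ y = x * (g * x * g⁻¹) * (h * x * h⁻¹)) : y ∈ N := by
  have hg := hN.conj_mem x hx g
  have hh := hN.conj_mem x hx h
  rcases e with rfl | rfl
  · exact N.mul_mem hx hg
  · exact N.mul_mem (N.mul_mem hx hg) hh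

theorem mem_iff_of_normal {G : Type*} [Group G] {N : Subgroup G} [N.Normal] {x y g : G}
    (e : g * x * g⁻¹ = y) : x ∈ N ↔ y ∈ N := by
  rw [← e, ← Subgroup.Normal.mem_comm_iff inferInstance, ← mul_assoc, inv_mul_cancel, one_mul]

theorem normal_le_or_le_of_reps {G : Type*} [Group G] {v r t f g1 g2 g3 h3 g4 h4 : G}
    (hrep : ∀ σ : G, ∃ g : G, g * σ * g⁻¹ = 1 ∨ g * σ * g⁻¹ = v ∨ g * σ * g⁻¹ = r ∨
      g * σ * g⁻¹ = t ∨ g * σ * g⁻¹ = f)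
    (e1 : v = r * (g1 * r * g1⁻¹)) (e2 : r = t * (g2 * t * g2⁻¹))
    (e3 : f = t * (g3 * t * g3⁻¹) * (h3 * t * h3⁻¹))
    (e4 : t = f * (g4 * f * g4⁻¹) * (h4 * f * h4⁻¹))
    (N M : Subgroup G) [N.Normal] [M.Normal] : N ≤ M ∨ M ≤ N := by
  have key : ∀ K : Subgroup G, K.Normal →
      (r ∈ K → v ∈ K) ∧ (t ∈ K → r ∈ K) ∧ (t ∈ K → f ∈ K) ∧ (f ∈ K → t ∈ K) := fun K hK =>
    ⟨fun h => mem_of_normal (h := 1) h (Or.inl e1), fun h => mem_of_normal (h := 1) h (Or.inl e2),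
      fun h => mem_of_normal h (Or.inr e3), fun h => mem_of_normal h (Or.inr e4)⟩
  obtain ⟨a1, a2, a3, a4⟩ := key N inferInstance
  obtain ⟨b1, b2, b3, b4⟩ := key M inferInstance
  have hle : ∀ K L : Subgroup G, K.Normal → L.Normal → (v ∈ K → v ∈ L) → (r ∈ K → r ∈ L) →
      (t ∈ K → t ∈ L) → (f ∈ K → f ∈ L) → K ≤ L := by
    intro K L hK hL hv hr ht hf σ hσ
    obtain ⟨g, hg⟩ := hrep σ
    rcases hg with hg | hg | hg | hg | hg <;> rw [mem_iff_of_normal hg] at hσ ⊢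
    exacts [L.one_mem, hv hσ, hr hσ, ht hσ, hf hσ]
  clear hrep e1 e2 e3 e4 key
  have h : ((v ∈ N → v ∈ M) ∧ (r ∈ N → r ∈ M) ∧ (t ∈ N → t ∈ M) ∧ (f ∈ N → f ∈ M)) ∨
      ((v ∈ M → v ∈ N) ∧ (r ∈ M → r ∈ N) ∧ (t ∈ M → t ∈ N) ∧ (f ∈ M → f ∈ N)) := by
    by_cases hv : v ∈ N <;> by_cases hv' : v ∈ M <;> by_cases hr : r ∈ N <;>
      by_cases hr' : r ∈ M <;> by_cases ht : t ∈ N <;> by_cases ht' : t ∈ M <;> simp_all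
  rcases h with ⟨x1, x2, x3, x4⟩ | ⟨x1, x2, x3, x4⟩
  · exact Or.inl (hle N M inferInstance inferInstance x1 x2 x3 x4)
  · exact Or.inr (hle M N inferInstance inferInstance x1 x2 x3 x4)

theorem normal_le_or_le_four (N M : Subgroup (Perm (Fin 4))) [N.Normal] [M.Normal] :
    N ≤ M ∨ M ≤ N := by
  have hrep : ∀ σ : Perm (Fin 4), ∃ g : Perm (Fin 4),
      g * σ * g⁻¹ = 1 ∨ g * σ * g⁻¹ = swap 0 1 * swap 2 3 ∨ g * σ * g⁻¹ = swap 0 1 * swap 1 2 ∨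
        g * σ * g⁻¹ = swap 0 1 ∨ g * σ * g⁻¹ = swap 0 1 * swap 1 2 * swap 2 3 := by
    decide +kernel
  obtain ⟨g1, e1⟩ : ∃ g : Perm (Fin 4), swap 0 1 * swap 2 3 =
      (swap 0 1 * swap 1 2) * (g * (swap 0 1 * swap 1 2) * g⁻¹) := by decide +kernel
  obtain ⟨g2, e2⟩ : ∃ g : Perm (Fin 4), swap 0 1 * swap 1 2 = swap 0 1 * (g * swap 0 1 * g⁻¹) := by
    decide +kernel
  obtain ⟨g3, h3, e3⟩ : ∃ g h : Perm (Fin 4), swap 0 1 * swap 1 2 * swap 2 3 =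
      swap 0 1 * (g * swap 0 1 * g⁻¹) * (h * swap 0 1 * h⁻¹) := by decide +kernel
  obtain ⟨g4, h4, e4⟩ : ∃ g h : Perm (Fin 4), swap 0 1 = (swap 0 1 * swap 1 2 * swap 2 3) *
      (g * (swap 0 1 * swap 1 2 * swap 2 3) * g⁻¹) *
        (h * (swap 0 1 * swap 1 2 * swap 2 3) * h⁻¹) := by decide +kernel
  exact normal_le_or_le_of_reps hrep e1 e2 e3 e4 N M

theorem normal_le_or_le_three (N M : Subgroup (Perm (Fin 3))) [N.Normal] [M.Normal] :
    N ≤ M ∨ M ≤ N := by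
  have hrep : ∀ σ : Perm (Fin 3), ∃ g : Perm (Fin 3),
      g * σ * g⁻¹ = 1 ∨ g * σ * g⁻¹ = swap 0 1 * swap 1 2 ∨ g * σ * g⁻¹ = swap 0 1 := by
    decide +kernel
  have e2 : ∃ g : Perm (Fin 3), swap 0 1 * swap 1 2 = swap 0 1 * (g * swap 0 1 * g⁻¹) := by
    decide +kernel
  obtain ⟨g2, e2⟩ := e2
  have key : ∀ K : Subgroup (Perm (Fin 3)), K.Normal →
      (swap 0 1 ∈ K → swap 0 1 * swap 1 2 ∈ K) := fun K hK h =>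
    mem_of_normal (h := 1) h (Or.inl e2)
  have hN := key N inferInstance
  have hM := key M inferInstance
  by_contra! hn
  obtain ⟨⟨σ, hσ, hσ'⟩, ⟨τ, hτ, hτ'⟩⟩ := And.imp SetLike.not_le_iff_exists.1
    SetLike.not_le_iff_exists.1 hn
  obtain ⟨g, hg⟩ := hrep σ
  obtain ⟨h, hh⟩ := hrep τ
  have i1 := N.one_mem
  have i2 := M.one_mem
  rcases hg with hg | hg | hg <;> rw [mem_iff_of_normal hg] at hσ hσ' <;>
    rcases hh with hh | hh | hh <;> rw [mem_iff_of_normal hh] at hτ hτ' <;> tauto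

theorem normal_le_or_le_two (N M : Subgroup (Perm (Fin 2))) : N ≤ M ∨ M ≤ N := by
  have hrep : ∀ σ : Perm (Fin 2), σ = 1 ∨ σ = swap 0 1 := by decide
  by_contra! hn
  obtain ⟨⟨σ, hσ, hσ'⟩, ⟨τ, hτ, hτ'⟩⟩ := And.imp SetLike.not_le_iff_exists.1
    SetLike.not_le_iff_exists.1 hn
  have i1 := N.one_mem
  have i2 := M.one_mem
  rcases hrep σ with rfl | rfl <;> rcases hrep τ with rfl | rfl <;> tauto

theorem normal_le_or_le_of_five_le {Q : Type*} [Finite Q] (h : 5 ≤ Nat.card Q)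
    (N M : Subgroup (Perm Q)) [N.Normal] [M.Normal] : N ≤ M ∨ M ≤ N := by
  classical
  have := Fintype.ofFinite Q
  rcases N.bot_or_nontrivial with rfl | hN
  · exact Or.inl bot_le
  rcases M.bot_or_nontrivial with rfl | hM
  · exact Or.inr bot_le
  have hN' := Perm.alternatingGroup_le_of_normal h hN
  have hM' := Perm.alternatingGroup_le_of_normal h hM
  by_cases hNA : N ≤ alternatingGroup Q
  · exact Or.inl (hNA.trans hM')
  refine Or.inr fun τ _ => ?_
  obtain ⟨σ, hσ, hσ'⟩ := SetLike.not_le_iff_exists.1 hNA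
  by_cases hτ : τ ∈ alternatingGroup Q
  · exact hN' hτ
  rw [Perm.mem_alternatingGroup] at hσ' hτ
  have h1 : τ * σ⁻¹ ∈ N := hN' (by
    rw [Perm.mem_alternatingGroup, Perm.sign_mul, Perm.sign_inv,
      (Int.units_eq_one_or _).resolve_left hσ', (Int.units_eq_one_or _).resolve_left hτ]
    rfl)
  simpa using N.mul_mem h1 hσ

/-- The normal subgroups of a finite symmetric group form a chain. -/
theorem normal_le_or_le {Q : Type*} [Finite Q] (N M : Subgroup (Perm Q)) [N.Normal] [M.Normal] :
    N ≤ M ∨ M ≤ N := by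
  obtain ⟨n, ⟨e⟩⟩ := Finite.exists_equiv_fin Q
  by_cases hn : 5 ≤ n
  · refine normal_le_or_le_of_five_le ?_ N M
    rwa [Nat.card_congr e, Nat.card_fin]
  let φ := (e.permCongrHom).symm.toMonoidHom
  have hφ : Function.Surjective φ := e.permCongrHom.symm.surjective
  suffices h : N.comap φ ≤ M.comap φ ∨ M.comap φ ≤ N.comap φ by
    rwa [Subgroup.comap_le_comap_of_surjective hφ, Subgroup.comap_le_comap_of_surjective hφ] at h
  have h1 : (N.comap φ).Normal := inferInstance
  have h2 : (M.comap φ).Normal := inferInstance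
  generalize N.comap φ = N' at *
  generalize M.comap φ = M' at *
  interval_cases n
  · exact Or.inl fun σ _ => by
      rw [Subsingleton.elim σ 1]
      exact M'.one_mem
  · exact Or.inl fun σ _ => by
      rw [Subsingleton.elim σ 1]
      exact M'.one_mem
  · exact normal_le_or_le_two N' M'
  · exact normal_le_or_le_three N' M'
  · exact normal_le_or_le_four N' M'

end NormalSubgroups

section Escape

/-- A relation of `G` leaving a set does so in a step of `D` or `E`. -/
structure Escapes {X : Type u} (D E G : Fam X) : Prop where
  step : ∀ {Y Z : Type u}, #Y ≤ #X → #Z ≤ #X → ∀ {α β : Setoid (Y ⊕ Z)}, G.R α β →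
    ∀ S : Set (Setoid (Y ⊕ Z)), α ∈ S → β ∉ S → ∃ x ∈ S, ∃ y ∉ S, D.R x y ∨ E.R x y

variable {X : Type u} {D E G : Fam X} {Y Z Q T : Type u}

theorem Escapes.comm (H : Escapes D E G) : Escapes E D G :=
  ⟨fun hY hZ _ _ h S hα hβ => by
    obtain ⟨x, hx, y, hy, hxy⟩ := H.step hY hZ h S hα hβ
    exact ⟨x, hx, y, hy, hxy.symm⟩⟩

theorem Escapes.flip (H : Escapes D E G) : Escapes D.flip E.flip G.flip :=
  ⟨fun hY hZ α β h S hα hβ => by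
    obtain ⟨x, hx, y, hy, hxy⟩ := H.step hZ hY h {γ | γ.comap Sum.swap ∈ S}
      (by simpa only [Set.mem_ofPred_eq, comap_swap_swap] using hα)
      (by simpa only [Set.mem_ofPred_eq, comap_swap_swap] using hβ)
    refine ⟨_, hx, _, hy, ?_⟩
    rwa [Fam.flip_swap, Fam.flip_swap]⟩

theorem exists_of_con_sup {M : Type*} [Mul M] {d e : Con M} {a b : M} (h : (d ⊔ e) a b)
    {S : Set M} (ha : a ∈ S) (hb : b ∉ S) : ∃ x ∈ S, ∃ y ∉ S, d x y ∨ e x y := by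
  by_contra! hS
  have hS' : ∀ x y, d x y ∨ e x y → (x ∈ S ↔ y ∈ S) := by
    intro x y hxy
    refine ⟨fun hx => by_contra fun hy => ?_, fun hy => by_contra fun hx => ?_⟩
    · have := hS x hx y hy
      tauto
    · have := hS y hy x hx
      exact hxy.elim (fun h => this.1 (d.symm h)) (fun h => this.2 (e.symm h))
  let r : M → M → Prop := fun x y => d x y ∨ e x y
  let c : Con M :=
    { Relation.EqvGen.setoid r with
      mul' := by
        have h1 : ∀ x y z, Relation.EqvGen r x y → Relation.EqvGen r (x * z) (y * z) := by
          intro x y z h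
          induction h with
          | rel x y h => exact .rel _ _ (h.imp (fun h => d.mul h (d.refl z))
              (fun h => e.mul h (e.refl z)))
          | refl x => exact .refl _
          | symm x y _ ih => exact ih.symm
          | trans x y z _ _ ih ih' => exact ih.trans _ _ _ ih'
        have h2 : ∀ x y z, Relation.EqvGen r x y → Relation.EqvGen r (z * x) (z * y) := by
          intro x y z h
          induction h with
          | rel x y h => exact .rel _ _ (h.imp (fun h => d.mul (d.refl z) h)
              (fun h => e.mul (e.refl z) h))
          | refl x => exact .refl _
          | symm x y _ ih => exact ih.symm
          | trans x y z _ _ ih ih' => exact ih.trans _ _ _ ih'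
        exact fun {_ _ _ _} h h' => (h1 _ _ _ h).trans _ _ _ (h2 _ _ _ h') }
  have hle : d ⊔ e ≤ c :=
    sup_le (fun x y h => .rel _ _ (Or.inl h)) (fun x y h => .rel _ _ (Or.inr h))
  have hc : Relation.EqvGen r a b := hle h
  have key : ∀ x y, Relation.EqvGen r x y → (x ∈ S ↔ y ∈ S) := by
    intro x y h
    induction h with
    | rel x y h => exact hS' x y h
    | refl x => exact Iff.rfl
    | symm x y _ ih => exact ih.symm
    | trans x y z _ _ ih ih' => exact ih.trans ih'
  exact hb ((key a b hc).1 ha)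

theorem Escapes.ofCon [Infinite X] (d e : Con (PMon X)) :
    Escapes (Fam.ofCon d) (Fam.ofCon e) (Fam.ofCon (d ⊔ e)) := by
  refine ⟨fun {Y Z} hY hZ α β h S hα hβ => ?_⟩
  rcases isEmpty_or_nonempty Y with hYe | hYe
  · exact ⟨α, hα, β, hβ, Or.inl fun h => (isEmptyElim (h (Classical.arbitrary X)))⟩
  rcases isEmpty_or_nonempty Z with hZe | hZe
  · exact ⟨α, hα, β, hβ, Or.inl fun _ h => (isEmptyElim (h (Classical.arbitrary X)))⟩
  obtain ⟨r, hr⟩ := exists_surjective_of_card_le hY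
  obtain ⟨t, ht⟩ := exists_surjective_of_card_le hZ
  obtain ⟨r', hr'⟩ := hr.hasRightInverse
  obtain ⟨t', ht'⟩ := ht.hasRightInverse
  have e1 : ∀ γ : Setoid (Y ⊕ Z), (γ.comap (Sum.map r t)).comap (Sum.map r' t') = γ := by
    intro γ
    ext x y
    rcases x with x | x <;> rcases y with y | y <;> simp [Setoid.comap_rel, hr' _, ht' _]
  obtain ⟨x, hx, y, hy, hxy⟩ := exists_of_con_sup (h r t)
    (S := {γ | γ.comap (Sum.map r' t') ∈ S}) (by rwa [Set.mem_ofPred_eq, e1])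
    (by rwa [Set.mem_ofPred_eq, e1])
  refine ⟨_, hx, _, hy, hxy.imp (fun h => ?_) fun h => ?_⟩
  · exact (Fam.ofCon d).comap (Fam.ofCon_iff.2 h) r' t'
  · exact (Fam.ofCon e).comap (Fam.ofCon_iff.2 h) r' t'

theorem exists_ind {α : Setoid (Y ⊕ Z)} {f : Q → Set (Y ⊕ Z)} (hf : Function.Injective f)
    (hfα : ∀ i, f i ∈ TR α) :
    ∃ (a : Q → Y) (b : Q → Z), Ind α a b ∧ ∀ i, f i = blk α (Sum.inl (a i)) := by
  obtain ⟨a, b, h, -, h', -⟩ := exists_common_points hf hfα hfα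
  exact ⟨a, b, h, h'⟩

theorem card_TR_comap_le {Y' Z' : Type u} (α : Setoid (Y ⊕ Z)) (h : Y' → Y) (k : Z' → Z) :
    #(TR (α.comap (Sum.map h k))) ≤ #(TR α) := by
  choose p q hpq hp using fun B : TR (α.comap (Sum.map h k)) => B.2
  refine le_card_TR (fun B => Sum.inl (h (p B))) (fun B => blk_inl_mem_TR.2 ⟨_, hpq B⟩) ?_
  intro B B' e
  refine Subtype.ext ?_
  rw [hp B, hp B', blk_eq_iff]
  exact e

theorem KK.of_rel_of_card_lt {F : Fam X} {α β : Setoid (Y ⊕ Z)} (H : F.R α β)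
    (hα : #T ≤ #(TR α)) (hβ : #(TR β) < #T) : KK F T := by
  obtain ⟨g⟩ := hα
  obtain ⟨a, b, hab, -⟩ := exists_ind (Subtype.val_injective.comp g.injective) fun i => (g i).2
  have := F.comap H a b
  rw [hab.comap_eq] at this
  exact KK_of_card_lt this ((card_TR_comap_le _ _ _).trans_lt hβ)

theorem Escapes.KK_or_KK (esc : Escapes D E G) (hT : #T ≤ #X) (H : KK G T) : KK D T ∨ KK E T := by
  rcases isEmpty_or_nonempty T with hT' | hT'
  · exact Or.inl KK.of_isEmpty
  have h0 : ∀ B, B ∈ TR (⊥ : Setoid (T ⊕ T)) → False := fun B hB => by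
    rw [split_bot.TR_eq] at hB
    exact hB
  obtain ⟨x, hx, y, hy, hxy⟩ := esc.step hT hT H {x | #T ≤ #(TR x)}
    (le_card_TR Sum.inl (fun t => blk_inl_mem_TR.2 ⟨t, idS_inl_inr.2 rfl⟩) fun t t' h => h)
    (by
      rw [Set.mem_ofPred_eq, split_bot.TR_eq]
      simp)
  rw [Set.mem_ofPred_eq] at hx hy
  exact hxy.imp (fun h => KK.of_rel_of_card_lt h hx (not_le.1 hy))
    fun h => KK.of_rel_of_card_lt h hx (not_le.1 hy)

end Escape

section Permutations

variable {X : Type u} {D E G F : Fam X} {Q : Type u}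

theorem permS_one : permS (1 : Equiv.Perm Q) = idS Q := rfl

theorem permS_comap (σ g h : Equiv.Perm Q) :
    (permS σ).comap (Sum.map g h) = permS (h⁻¹ * σ * g) := by
  ext x y
  rcases x with x | x <;> rcases y with y | y <;>
    simp [Setoid.comap_rel, permS_rel, Equiv.eq_symm_apply, Equiv.symm_apply_eq]

theorem permS_injective : Function.Injective (permS (Q := Q)) := by
  intro σ τ h
  ext q
  have : permS τ (Sum.inl q) (Sum.inr (σ q)) := by
    rw [← h]
    exact permS_rel.2 rfl
  exact (permS_rel.1 this).symm

/-- The permutations related to the identity. -/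
def permSubgroup (F : Fam X) (Q : Type u) : Subgroup (Equiv.Perm Q) where
  carrier := {τ | F.R (idS Q) (permS τ)}
  one_mem' := F.refl _
  mul_mem' := by
    intro τ σ hτ hσ
    have := F.comap hτ σ (1 : Equiv.Perm Q)
    rw [← permS_one, permS_comap, permS_comap] at this
    simp only [inv_one, one_mul] at this
    exact F.trans hσ this
  inv_mem' := by
    intro σ hσ
    have := F.comap hσ (σ⁻¹ : Equiv.Perm Q) (1 : Equiv.Perm Q)
    rw [← permS_one, permS_comap, permS_comap] at this
    simp only [inv_one, one_mul, mul_inv_cancel] at this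
    exact F.symm this

theorem mem_permSubgroup {τ : Equiv.Perm Q} :
    τ ∈ permSubgroup F Q ↔ F.R (idS Q) (permS τ) := Iff.rfl

instance permSubgroup_normal : (permSubgroup F Q).Normal where
  conj_mem := by
    intro σ hσ g
    have := F.comap (mem_permSubgroup.1 hσ) (g⁻¹ : Equiv.Perm Q) (g⁻¹ : Equiv.Perm Q)
    rw [← permS_one, permS_comap, permS_comap] at this
    simp only [inv_inv, mul_one, mul_inv_cancel, permS_one] at this
    exact this

theorem KK.rel_permS (H : KK F Q) (σ : Equiv.Perm Q) : F.R (idS Q) (permS σ) := by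
  have h : ∀ τ : Equiv.Perm Q, F.R (permS τ) ⊥ := by
    intro τ
    have := H.hat (γ := permS τ) (card_TR_le Sum.inl (by
      rintro B ⟨y, -, -, h⟩
      exact ⟨y, h⟩))
    convert this using 1
    ext x y
    rcases x with x | x <;> rcases y with y | y <;> simp [permS_rel]
  exact F.trans (h 1) (F.symm (h σ))

theorem Escapes.rel_permS_of_le [Infinite X] [Finite Q] (esc : Escapes D E G)
    (hle : permSubgroup D Q ≤ permSubgroup E Q) {σ : Equiv.Perm Q}
    (H : G.R (idS Q) (permS σ)) : D.R (idS Q) (permS σ) ∨ E.R (idS Q) (permS σ) := by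
  by_cases hσ : σ ∈ permSubgroup E Q
  · exact Or.inr hσ
  have hQ : #Q ≤ #X := (lt_aleph0_of_finite Q).le.trans (aleph0_le_mk X)
  obtain ⟨x, ⟨τ, hτ, rfl⟩, y, hy, hxy⟩ := esc.step hQ hQ H (permS '' (permSubgroup E Q : Set _))
    ⟨1, one_mem _, rfl⟩ (by
      rintro ⟨τ, hτ, e⟩
      exact hσ (permS_injective e ▸ hτ))
  have key : ∀ F : Fam X, permSubgroup F Q ≤ permSubgroup E Q → F.R (permS τ) y → KK F Q := by
    intro F hF h
    have h1 := F.comap h (τ⁻¹ : Equiv.Perm Q) (1 : Equiv.Perm Q)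
    rw [permS_comap] at h1
    simp only [inv_one, one_mul, mul_inv_cancel] at h1
    refine (KK_or_perm h1).resolve_right ?_
    rintro ⟨ρ, hρ⟩
    rw [hρ] at h1
    refine hy ⟨ρ * τ, mul_mem (hF h1) hτ, ?_⟩
    have h2 := congrArg (Setoid.comap (Sum.map τ (1 : Equiv.Perm Q))) hρ
    rw [permS_comap] at h2
    rw [← one_mul (ρ * τ), ← inv_one, ← mul_assoc, ← h2]
    ext u v
    rcases u with u | u <;> rcases v with v | v <;> simp [Setoid.comap_rel]
  exact hxy.imp (fun h => (key D hle h).rel_permS σ) fun h => (key E le_rfl h).rel_permS σ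

theorem Escapes.rel_permS [Infinite X] [Finite Q] (esc : Escapes D E G) {σ : Equiv.Perm Q}
    (H : G.R (idS Q) (permS σ)) : D.R (idS Q) (permS σ) ∨ E.R (idS Q) (permS σ) := by
  rcases normal_le_or_le (permSubgroup D Q) (permSubgroup E Q) with h | h
  · exact esc.rel_permS_of_le h H
  · exact (esc.comm.rel_permS_of_le h H).symm

end Permutations

section Assembly

/-- `S` contains all pairs in `A` and `D`, and all pairs in `A` and `E`, and relations of `G`
decompose into steps of `D` and `E`. -/
structure Distributes {X : Type u} (A D E G S : Fam X) : Prop extends Escapes D E G where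
  left : ∀ {Y Z : Type u} {α β : Setoid (Y ⊕ Z)}, A.R α β → D.R α β → S.R α β
  right : ∀ {Y Z : Type u} {α β : Setoid (Y ⊕ Z)}, A.R α β → E.R α β → S.R α β

variable {X : Type u} {A D E G S : Fam X} {Y Z Q T W : Type u}

theorem Distributes.of_or (H : Distributes A D E G S) {α β : Setoid (Y ⊕ Z)} (hA : A.R α β)
    (h : D.R α β ∨ E.R α β) : S.R α β :=
  h.elim (H.left hA) (H.right hA)

theorem Distributes.flip (H : Distributes A D E G S) :
    Distributes A.flip D.flip E.flip G.flip S.flip :=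
  { H.toEscapes.flip with
    left := fun h h' => H.left h h'
    right := fun h h' => H.right h h' }

theorem Escapes.exists_step (esc : Escapes D E G) (hY : #Y ≤ #X) (hZ : #Z ≤ #X)
    (f : Setoid (Y ⊕ Z) → Set W) {α β : Setoid (Y ⊕ Z)} (H : G.R α β) {ξ : Cardinal.{u}}
    (hξ : ξ = 1 ∨ ℵ₀ ≤ ξ) (h : ξ ≤ #(f α ∆ f β : Set W)) :
    ∃ x y, #(f α ∆ f x : Set W) < ξ ∧ ξ ≤ #(f x ∆ f y : Set W) ∧ (D.R x y ∨ E.R x y) := by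
  have hξ0 : 0 < ξ := by
    rcases hξ with rfl | h
    · exact one_pos
    · exact aleph0_pos.trans_le h
  obtain ⟨x, hx, y, hy, hxy⟩ := esc.step hY hZ H {x | #(f α ∆ f x : Set W) < ξ}
    (by simpa using hξ0) (by simpa using h)
  rw [Set.mem_ofPred_eq] at hx hy
  refine ⟨x, y, hx, ?_, hxy⟩
  refine (le_or_le_of_le_union hξ ?_).resolve_left (not_le.2 hx)
  exact (not_lt.1 hy).trans (mk_le_mk_of_subset (symmDiff_triangle _ _ _))

theorem rep_range_inl (α : Setoid (Y ⊕ Z)) :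
    rep (Set.range Sum.inl) ⊥ α = SS (α.comap Sum.inl) ⊥ := by
  ext x y
  rcases x with x | x <;> rcases y with y | y <;> simp [rep_rel, Setoid.comap_rel]

theorem Distributes.SS_rel (H : Distributes A D E G S) [Nonempty Z] (hY : #Y ≤ #X)
    (hZ : #Z ≤ #X) {K K' : Setoid Y} {C : Setoid Z} (hA : A.R (SS K C) (SS K' C))
    (hG : G.R (SS K C) (SS K' C)) : S.R (SS K C) (SS K' C) := by
  by_cases h0 : K = K'
  · rw [h0]
    exact S.refl _
  have e : ∀ L : Setoid Y, (SS L C).comap Sum.inl = L := fun L =>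
    Setoid.ext fun x y => SS_inl_inl _ _
  have key : ∀ {ξ : Cardinal.{u}}, ξ = 1 ∨ ℵ₀ ≤ ξ →
      ξ ≤ #(K.classes ∆ K'.classes : Set (Set Y)) → ∀ I : Type u, #I ≤ ξ + 1 →
      UU D I ∨ UU E I := by
    intro ξ hξ h I hI
    obtain ⟨x, y, -, hxy, h'⟩ := H.toEscapes.exists_step hY hZ
      (fun γ => (γ.comap Sum.inl).classes) hG hξ (by rwa [e, e])
    have aux : ∀ F : Fam X, F.R x y → UU F I := by
      intro F hF
      have := F.rep hF (Set.range Sum.inl) split_bot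
      rw [rep_range_inl, rep_range_inl] at this
      exact UU_of_SS hY hZ this hξ hxy hI
    exact h'.imp (aux D) (aux E)
  suffices h : UU D (K.classes ∆ K'.classes : Set (Set Y)) ∨
      UU E (K.classes ∆ K'.classes : Set (Set Y)) from
    H.of_or hA (h.imp (fun h => h.SS_rel le_rfl) fun h => h.SS_rel le_rfl)
  rcases finite_or_infinite (K.classes ∆ K'.classes : Set (Set Y)) with hfin | hinf
  · have : Nonempty (K.classes ∆ K'.classes : Set (Set Y)) := by
      rw [Set.nonempty_coe_sort, Set.symmDiff_nonempty]
      exact fun h => h0 (Setoid.classes_inj.2 h)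
    refine (key (Or.inl rfl) (Cardinal.one_le_iff_ne_zero.2 (mk_ne_zero _)) (ULift.{u} Bool)
      ?_).imp (fun h => h.of_finite) fun h => h.of_finite
    simp [one_add_one_eq_two]
  · exact key (Or.inr (aleph0_le_mk _)) le_rfl _ (self_le_add_right _ _)

theorem hat_comap_eq (α β : Setoid (Y ⊕ Z)) :
    rep (Set.range Sum.inl) (hat β) α = SS (α.comap Sum.inl) (β.comap Sum.inr) := by
  ext x y
  rcases x with x | x <;> rcases y with y | y <;> simp [rep_rel, Setoid.comap_rel]

theorem Distributes.hat (H : Distributes A D E G S) [Nonempty Y] [Nonempty Z] (hY : #Y ≤ #X)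
    (hZ : #Z ≤ #X) {α β : Setoid (Y ⊕ Z)} (hA : A.R α β) (hG : G.R α β) :
    S.R (hat α) (hat β) := by
  have h1 : ∀ F : Fam X, F.R α β → F.R (SS (α.comap Sum.inl) (α.comap Sum.inr))
      (SS (β.comap Sum.inl) (α.comap Sum.inr)) := fun F h => by
    rw [← hat_comap_eq, ← hat_comap_eq]
    exact F.rep h _ (split_hat _)
  have h2 : ∀ F : Fam X, F.R α β → F.flip.R (SS (α.comap Sum.inr) (β.comap Sum.inl))
      (SS (β.comap Sum.inr) (β.comap Sum.inl)) := fun F h => by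
    have e : ∀ γ : Setoid (Y ⊕ Z), SS (γ.comap Sum.inr) (β.comap Sum.inl) =
        rep (Set.range Sum.inl) (PartitionCongruences.hat (β.comap Sum.swap))
          (γ.comap Sum.swap) := fun γ =>
      (hat_comap_eq (γ.comap Sum.swap) (β.comap Sum.swap)).symm
    rw [e, e]
    exact F.flip.rep (Fam.flip_swap.2 h) _ (split_hat _)
  have h3 := H.flip.SS_rel hZ hY (h2 A hA) (h2 G hG)
  have e : ∀ (K : Setoid Y) (C : Setoid Z), (SS C K).comap Sum.swap = SS K C := by
    intro K C
    ext x y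
    rcases x with x | x <;> rcases y with y | y <;> simp [Setoid.comap_rel]
  rw [Fam.flip_iff, e, e] at h3
  exact S.trans (H.SS_rel hY hZ (h1 A hA) (h1 G hG)) h3

theorem mem_TR_of_mem_classes {α x : Setoid (Y ⊕ Z)} {B : Set (Y ⊕ Z)} (h : B ∈ TR α)
    (hx : B ∈ x.classes) : B ∈ TR x := by
  obtain ⟨y, z, hyz, rfl⟩ := h
  have e := eq_blk_of_mem hx (mem_blk.2 (α.refl' (Sum.inl y)))
  rw [e]
  refine blk_inl_mem_TR.2 ⟨z, ?_⟩
  rw [← mem_blk, ← e]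
  exact hyz

theorem Distributes.rel_of_KK (H : Distributes A D E G S) [Nonempty Y] [Nonempty Z]
    (hY : #Y ≤ #X) (hZ : #Z ≤ #X) {α β : Setoid (Y ⊕ Z)} (hA : A.R α β) (hG : G.R α β)
    (hT : #T ≤ #X) (hAT : KK A T) (hGT : KK G T) (hα : #(TR α) ≤ #T) (hβ : #(TR β) ≤ #T) :
    S.R α β := by
  have h : KK S T := H.of_or hAT (H.toEscapes.KK_or_KK hT hGT)
  exact S.trans (h.hat hα) (S.trans (H.hat hY hZ hA hG) (S.symm (h.hat hβ)))

theorem Distributes.rel_of_finite [Infinite X] (H : Distributes A D E G S) [Nonempty Y]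
    [Nonempty Z] (hY : #Y ≤ #X) (hZ : #Z ≤ #X) {α β : Setoid (Y ⊕ Z)} (hA : A.R α β)
    (hG : G.R α β) (hαβ : #(TR β) ≤ #(TR α)) [Finite (TR α)] [Nontrivial (TR α)] :
    S.R α β := by
  have hT : #(TR α) ≤ #X := (lt_aleph0_of_finite _).le.trans (aleph0_le_mk X)
  obtain ⟨a, b, hab, hf⟩ := exists_ind (Q := TR α) Subtype.val_injective fun i => i.2
  have hα' : ∀ x z, α (Sum.inl x) (Sum.inr z) → ∃ i, α (Sum.inl (a i)) (Sum.inl x) := fun x z h =>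
    ⟨_, α.symm' (blk_eq_iff.1 (hf ⟨_, blk_inl_mem_TR.2 ⟨z, h⟩⟩))⟩
  have key : ∀ F : Fam X, F.R α β → ¬ KK F (TR α) → S.R α β := by
    intro F hF hK
    obtain ⟨-, -, σ, hσ, h⟩ := exists_perm_of_not_KK hY hZ hF hab hα' hαβ hK
    have := G.comap hG a b
    rw [hσ, hab.comap_eq] at this
    exact H.of_or hA ((H.toEscapes.rel_permS this).imp (h D) (h E))
  by_cases h1 : KK A (TR α)
  · by_cases h2 : KK G (TR α)
    · exact H.rel_of_KK hY hZ hA hG hT h1 h2 le_rfl hαβ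
    · exact key G hG h2
  · exact key A hA h1

theorem card_TR_le_of_card_le [Infinite X] (hY : #Y ≤ #X) (α : Setoid (Y ⊕ Z)) :
    #(TR α) ≤ #X :=
  (card_TR_le (T := Y) Sum.inl (by
    rintro B ⟨y, -, -, h⟩
    exact ⟨y, h⟩)).trans hY

theorem Distributes.rel_of_infinite [Infinite X] (H : Distributes A D E G S) [Nonempty Y]
    [Nonempty Z] (hY : #Y ≤ #X) (hZ : #Z ≤ #X) {α β : Setoid (Y ⊕ Z)} (hA : A.R α β)
    (hG : G.R α β) (hαβ : #(TR β) ≤ #(TR α)) (hne : α ≠ β) [Infinite (TR α)] :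
    S.R α β := by
  have hT : #(TR α) ≤ #X := card_TR_le_of_card_le hY α
  have hT' : ℵ₀ ≤ #(TR α) := aleph0_le_mk _
  rcases le_or_gt #(TR α) #(α.classes ∆ β.classes : Set (Set (Y ⊕ Z))) with h | h
  · have key : ∀ F : Fam X, F.R α β → KK F (TR α) := fun F hF =>
      (KK_under_of_card_classes (hQ := hT) hY hZ hF le_rfl le_rfl (Or.inr hT') h).of_under
    exact H.rel_of_KK hY hZ hA hG hT (key A hA) (key G hG) le_rfl hαβ
  · have key : ∀ P : Type u, #P = 1 ∨ ℵ₀ ≤ #P → #P ≤ #(TR α) →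
        #P ≤ #(α.classes ∆ β.classes : Set (Set (Y ⊕ Z))) →
        KK (D.under (TR α) hT) P ∨ KK (E.under (TR α) hT) P := by
      intro P hP hPT hPc
      obtain ⟨x, y, hx, hxy, hD⟩ := H.toEscapes.exists_step hY hZ Setoid.classes hG hP hPc
      have hTx : #(TR α) ≤ #(TR x) := by
        have hsub : TR α ⊆ TR x ∪ α.classes ∆ x.classes := fun B hB => by
          by_cases hBx : B ∈ x.classes
          · exact Or.inl (mem_TR_of_mem_classes hB hBx)
          · exact Or.inr (Or.inl ⟨TR_subset_classes hB, hBx⟩)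
        exact (le_or_le_of_le_union (Or.inr hT') (mk_le_mk_of_subset hsub)).resolve_right
          (not_le.2 (hx.trans_le hPT))
      exact hD.imp (fun h => KK_under_of_card_classes hY hZ h hTx hPT hP hxy)
        fun h => KK_under_of_card_classes hY hZ h hTx hPT hP hxy
    have fin : KK (D.under (TR α) hT) (α.classes ∆ β.classes : Set (Set (Y ⊕ Z))) ∨
        KK (E.under (TR α) hT) (α.classes ∆ β.classes : Set (Set (Y ⊕ Z))) := by
      rcases finite_or_infinite (α.classes ∆ β.classes : Set (Set (Y ⊕ Z))) with hfin | hinf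
      · have : Nonempty (α.classes ∆ β.classes : Set (Set (Y ⊕ Z))) := by
          rw [Set.nonempty_coe_sort, Set.symmDiff_nonempty]
          exact fun h => hne (Setoid.classes_inj.2 h)
        refine (key PUnit (Or.inl (by simp)) ?_ ?_).imp (fun h => KK_under_of_finite h)
          fun h => KK_under_of_finite h
        · rw [mk_punit]
          exact one_le_aleph0.trans hT'
        · rw [mk_punit]
          exact Cardinal.one_le_iff_ne_zero.2 (mk_ne_zero _)
      · exact key _ (Or.inr (aleph0_le_mk _)) h.le le_rfl
    exact H.of_or hA (fin.imp (fun h' => h'.rel_of_card_le (h.le.trans hT) le_rfl hαβ le_rfl)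
      fun h' => h'.rel_of_card_le (h.le.trans hT) le_rfl hαβ le_rfl)

theorem Distributes.rel_of_card_le [Infinite X] (H : Distributes A D E G S) [Nonempty Y]
    [Nonempty Z] (hY : #Y ≤ #X) (hZ : #Z ≤ #X) {α β : Setoid (Y ⊕ Z)} (hA : A.R α β)
    (hG : G.R α β) (hαβ : #(TR β) ≤ #(TR α)) : S.R α β := by
  by_cases hne : α = β
  · subst hne
    exact S.refl _
  rcases finite_or_infinite (TR α) with hfin | hinf
  · rcases subsingleton_or_nontrivial (TR α) with hs | hs
    · have key : ∀ F : Fam X, F.R α β → KK F (TR α) := by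
        intro F hF
        rcases isEmpty_or_nonempty (TR α) with he | he
        · exact KK.of_isEmpty
        · refine (KK_punit_of_ne_of_TR hY hZ hF hne (Set.nonempty_coe_sort.1 he)).transfer ?_
          rw [mk_punit]
          exact le_one_iff_subsingleton.2 hs
      exact H.rel_of_KK hY hZ hA hG (card_TR_le_of_card_le hY α) (key A hA) (key G hG) le_rfl hαβ
    · exact H.rel_of_finite hY hZ hA hG hαβ
  · exact H.rel_of_infinite hY hZ hA hG hαβ hne

theorem Distributes.rel [Infinite X] (H : Distributes A D E G S) {α β : Setoid (X ⊕ X)}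
    (hA : A.R α β) (hG : G.R α β) : S.R α β := by
  rcases le_total #(TR β) #(TR α) with h | h
  · exact H.rel_of_card_le le_rfl le_rfl hA hG h
  · exact S.symm (H.rel_of_card_le le_rfl le_rfl (A.symm hA) (G.symm hG) h)

theorem Fam.ofCon_mono {c d : Con (PMon X)} (h : c ≤ d) {α β : Setoid (Y ⊕ Z)}
    (H : (Fam.ofCon c).R α β) : (Fam.ofCon d).R α β := fun r t => h (H r t)

end Assembly

/-- Theorem 6.1 (for `P_X`): the congruence lattice of the partition monoid over an
infinite set is distributive. -/
theorem con_lattice_distrib [Infinite X] (c d e : Con (PMon X)) :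
    c ⊓ (d ⊔ e) = (c ⊓ d) ⊔ (c ⊓ e) := by
  refine le_antisymm ?_ le_inf_sup
  intro α β h
  have H : Distributes (Fam.ofCon c) (Fam.ofCon d) (Fam.ofCon e) (Fam.ofCon (d ⊔ e))
      (Fam.ofCon ((c ⊓ d) ⊔ (c ⊓ e))) :=
    { Escapes.ofCon d e with
      left := fun hc hd => Fam.ofCon_mono le_sup_left fun r t => ⟨hc r t, hd r t⟩
      right := fun hc he => Fam.ofCon_mono le_sup_right fun r t => ⟨hc r t, he r t⟩ }
  exact Fam.ofCon_iff.1 (H.rel (Fam.ofCon_iff.2 h.1) (Fam.ofCon_iff.2 h.2))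

end PartitionCongruences
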